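/- Let G be a connected planar graph with n ≥ 2 vertices and m edges, and suppose that for some ε ∈ (0, 1] the average degree satisfies 2m/n = 9/2 − ε. Then the 2-surviving rate satisfies ρ₂(G) ≥ (2/9)ε. -/

import Mathlib

/-- The set of vertices on fire after `t` fire-spread rounds, when the fire breaks out
at `v` and the firefighters protect the vertices of `P s` in round `s + 1` (protection
happens just before the `s`-th spread step and is permanent). -/
def burnedSet {V : Type*} (G : SimpleGraph V) (v : V) (P : ℕ → Set V) : ℕ → Set V
  | 0 => {v}
  | t + 1 => burnedSet G v P t ∪
      {w | (∃ u ∈ burnedSet G v P t, G.Adj u w) ∧ ∀ s ≤ t, w ∉ P s}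

/-- A strategy `P` is valid for the per-round budgets `b` if in each round it protects
at most `b t` vertices, none of which are already on fire. -/
def ValidStrategy {V : Type*} (G : SimpleGraph V) (b : ℕ → ℕ) (v : V) (P : ℕ → Set V) : Prop :=
  ∀ t, (P t).Finite ∧ (P t).ncard ≤ b t ∧ Disjoint (P t) (burnedSet G v P t)

/-- `sn G b v` is the maximum number of vertices that can be saved (i.e. that never
catch fire) when the fire breaks out at `v` and the firefighters may protect at most
`b t` vertices in round `t + 1`. -/
noncomputable def sn {V : Type*} (G : SimpleGraph V) (b : ℕ → ℕ) (v : V) : ℕ :=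
  sSup {m | ∃ P, ValidStrategy G b v P ∧
    m = Nat.card {w : V | ∀ t, w ∉ burnedSet G v P t}}

/-- The surviving rate of `G` with per-round budgets `b` : the expected fraction of
vertices that can be saved when the starting vertex is chosen uniformly at random. -/
noncomputable def survivingRate {V : Type*} [Fintype V] (G : SimpleGraph V) (b : ℕ → ℕ) : ℝ :=
  (∑ v : V, (sn G b v : ℝ)) / (Fintype.card V : ℝ) ^ 2

/-- A plane embedding of a simple graph: vertices are points of the plane and edges are
simple arcs between their endpoints, such that arcs avoid all other vertices and two
arcs of distinct edges meet only in common endpoints. -/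
structure PlaneEmbedding {V : Type*} (G : SimpleGraph V) where
  pos : V → ℝ × ℝ
  arc : V → V → ℝ → ℝ × ℝ
  pos_inj : Function.Injective pos
  arc_cont : ∀ ⦃u v⦄, G.Adj u v → Continuous (arc u v)
  arc_injOn : ∀ ⦃u v⦄, G.Adj u v → Set.InjOn (arc u v) (Set.Icc 0 1)
  arc_zero : ∀ ⦃u v⦄, G.Adj u v → arc u v 0 = pos u
  arc_one : ∀ ⦃u v⦄, G.Adj u v → arc u v 1 = pos v
  arc_symm : ∀ ⦃u v⦄, G.Adj u v → ∀ t, arc v u t = arc u v (1 - t)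
  arc_avoid : ∀ ⦃u v⦄, G.Adj u v → ∀ w : V, pos w ∉ arc u v '' Set.Ioo 0 1
  arc_meet : ∀ ⦃u v x y⦄, G.Adj u v → G.Adj x y → s(u, v) ≠ s(x, y) →
      arc u v '' Set.Icc 0 1 ∩ arc x y '' Set.Icc 0 1 ⊆
        ({pos u, pos v} : Set (ℝ × ℝ)) ∩ {pos x, pos y}

/-- A graph is planar if it admits a plane embedding. -/
def IsPlanar {V : Type*} (G : SimpleGraph V) : Prop :=
  Nonempty (PlaneEmbedding G)

section

section PartA

variable {V : Type} [Fintype V]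

theorem sn_ge (G : SimpleGraph V) (s : V) (C X : Set V) (f h : V → ℕ)
    (hsC : s ∉ C) (hsX : s ∉ X)
    (hbd : ∀ w w', w ∉ C → w ∉ X → G.Adj w w' → w' ∈ X → w' ∈ C)
    (hlip : ∀ w w', w ∉ C → w ∉ X → G.Adj w w' → h w' ≤ h w + 1)
    (hs : h s = 0) (hf : ∀ c ∈ C, f c < h c)
    (hcard : ∀ t, {c | c ∈ C ∧ f c = t}.ncard ≤ 2) :
    (X ∪ C).ncard ≤ sn G (fun _ => 2) s := by
  classical
  set P : ℕ → Set V := fun t => {c | c ∈ C ∧ f c = t} with hP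
  have key : ∀ t, burnedSet G s P t ⊆ {w | w ∉ C ∧ w ∉ X ∧ h w ≤ t} := by
    intro t
    induction t with
    | zero =>
      intro w hw
      simp only [burnedSet, Set.mem_singleton_iff] at hw
      subst hw
      exact ⟨hsC, hsX, by omega⟩
    | succ t ih =>
      intro w hw
      simp only [burnedSet] at hw
      rcases hw with hw | ⟨⟨u, hu, huw⟩, hnp⟩
      · obtain ⟨a, b, c⟩ := ih hw
        exact ⟨a, b, by omega⟩
      · obtain ⟨a, b, c⟩ := ih hu
        have h1 := hlip u w a b huw
        have hwC : w ∉ C := by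
          intro hwC
          have := hf w hwC
          exact hnp (f w) (by omega) ⟨hwC, rfl⟩
        exact ⟨hwC, fun hx => hwC (hbd u w a b huw hx), by omega⟩
  have hval : ValidStrategy G (fun _ => 2) s P := by
    intro t
    refine ⟨Set.toFinite _, hcard t, ?_⟩
    rw [Set.disjoint_left]
    intro w hw hw'
    exact (key t hw').1 hw.1
  have hbdd : BddAbove {m | ∃ P, ValidStrategy G (fun _ => 2) s P ∧
      m = Nat.card {w : V | ∀ t, w ∉ burnedSet G s P t}} := by
    refine ⟨Fintype.card V, ?_⟩
    rintro m ⟨P, -, rfl⟩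
    rw [← Nat.card_eq_fintype_card]
    exact Finite.card_subtype_le _
  have h1 := le_csSup hbdd ⟨P, hval, rfl⟩
  refine le_trans ?_ h1
  rw [← Nat.card_coe_set_eq]
  apply Nat.card_mono (Set.toFinite _)
  intro w hw t hwt
  obtain ⟨a, b, -⟩ := key t hwt
  rcases hw with hw | hw
  · exact b hw
  · exact a hw

/-- saving with distance-based schedule, version where we only count a subset -/
theorem sn_ge_sub (G : SimpleGraph V) (s : V) (C X : Set V) (f h : V → ℕ) (Y : Set V)
    (hY : Y ⊆ X ∪ C)
    (hsC : s ∉ C) (hsX : s ∉ X)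
    (hbd : ∀ w w', w ∉ C → w ∉ X → G.Adj w w' → w' ∈ X → w' ∈ C)
    (hlip : ∀ w w', w ∉ C → w ∉ X → G.Adj w w' → h w' ≤ h w + 1)
    (hs : h s = 0) (hf : ∀ c ∈ C, f c < h c)
    (hcard : ∀ t, {c | c ∈ C ∧ f c = t}.ncard ≤ 2) :
    Y.ncard ≤ sn G (fun _ => 2) s :=
  le_trans (Set.ncard_le_ncard hY (Set.toFinite _)) (sn_ge G s C X f h hsC hsX hbd hlip hs hf hcard)

theorem sn_deg_two (G : SimpleGraph V) (s : V) (hd : (G.neighborSet s).ncard ≤ 2) :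
    Fintype.card V ≤ sn G (fun _ => 2) s + 1 := by
  classical
  have h1 := sn_ge G s (G.neighborSet s) {w | w ≠ s} (fun _ => 0) (fun w => if w = s then 0 else 1)
    (by simp) (by simp)
    (by
      intro w w' h1 h2 h3 h4
      simp only [ne_eq, Set.mem_ofPred_eq, not_not] at h2
      subst h2; exact h3)
    (by intro w w' h1 h2 h3; split_ifs <;> omega)
    (by simp)
    (by
      intro c hc
      have : c ≠ s := fun h => by subst h; simp at hc
      simp [this])
    (by
      intro t
      refine le_trans (Set.ncard_le_ncard (fun x hx => hx.1) (Set.toFinite _)) hd)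
  have h2 : ({w | w ≠ s} ∪ G.neighborSet s : Set V) = ({s} : Set V)ᶜ := by
    ext w
    simp only [Set.mem_union, Set.mem_ofPred_eq, SimpleGraph.mem_neighborSet, Set.mem_compl_iff,
      Set.mem_singleton_iff]
    constructor
    · rintro (h | h)
      · exact h
      · exact h.ne'
    · exact Or.inl
  rw [h2, Set.ncard_compl, Set.ncard_singleton, Nat.card_eq_fintype_card] at h1
  omega

theorem sn_two (G : SimpleGraph V) (s : V) (hn : 3 ≤ Fintype.card V) :
    2 ≤ sn G (fun _ => 2) s := by
  classical
  have h0 : 2 ≤ (({s} : Set V)ᶜ).ncard := by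
    rw [Set.ncard_compl, Set.ncard_singleton, Nat.card_eq_fintype_card]; omega
  obtain ⟨C, hC, hC2⟩ := Set.exists_subset_card_eq h0
  have h1 := sn_ge_sub G s C ∅ (fun _ => 0) (fun w => if w = s then 0 else 1) C (by simp)
    (by intro h; exact hC h rfl) (by simp) (by simp)
    (by intro w w' h1 h2 h3; split_ifs <;> omega)
    (by simp)
    (by
      intro c hc
      have : c ≠ s := hC hc
      simp [this])
    (by
      intro t
      refine le_trans (Set.ncard_le_ncard (fun x hx => hx.1) (Set.toFinite _)) hC2.le)
  omega

end PartA

end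

section

set_option linter.all false
set_option linter.unusedSectionVars false
set_option linter.unusedVariables false
set_option linter.unusedSimpArgs false

section PartB

variable {V : Type} [Fintype V] [DecidableEq V]

/-- A planar rotation system: cyclic order of darts at each vertex, together with the
potential property. -/
structure Rot (G : SimpleGraph V) [DecidableRel G.Adj] where
  σ : Equiv.Perm G.Dart
  fst : ∀ d, (σ d).fst = d.fst
  cyc : ∀ d d' : G.Dart, d.fst = d'.fst → σ.SameCycle d d'
  pot : ∀ z : G.Dart → ℝ, (∀ d, z d.symm = - z d) →
    (∀ x, ∑ d with d.fst = x, z d = 0) →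
    ∃ N : G.Dart → ℝ, (∀ d, N (σ d) = N d + z d) ∧ ∀ d, N d.symm = N d + z d

/-- the mirror image -/
def Rot.mirror {G : SimpleGraph V} [DecidableRel G.Adj] (R : Rot G) : Rot G where
  σ := R.σ⁻¹
  fst := by
    intro d
    have := R.fst (R.σ⁻¹ d)
    simpa using this.symm
  cyc := by
    intro d d' h
    exact (R.cyc d d' h).inv
  pot := by
    intro z h1 h2
    obtain ⟨N, hN1, hN2⟩ := R.pot z h1 h2
    refine ⟨fun d => - N (R.σ d), ?_, ?_⟩
    · intro d
      have h := hN1 d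
      have h2 : R.σ (R.σ⁻¹ d) = d := by simp
      change - N (R.σ (R.σ⁻¹ d)) = - N (R.σ d) + z d
      rw [h2]
      linarith
    · intro d
      have e1 := hN1 d
      have e2 := hN1 d.symm
      have e3 := hN2 d
      have e4 := h1 d
      linarith

/-- BFS parent function -/
structure IsPar (G : SimpleGraph V) (v : V) (par : V → V) : Prop where
  root : par v = v
  adj : ∀ w, w ≠ v → G.Adj (par w) w
  dist : ∀ w, w ≠ v → G.dist v (par w) + 1 = G.dist v w

def isT {G : SimpleGraph V} (par : V → V) (d : G.Dart) : Prop :=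
  par d.snd = d.fst ∨ par d.fst = d.snd

instance {G : SimpleGraph V} (par : V → V) (d : G.Dart) : Decidable (isT par d) := by
  unfold isT; infer_instance

theorem isT_symm {G : SimpleGraph V} (par : V → V) (d : G.Dart) : isT par d.symm ↔ isT par d := by
  unfold isT
  exact Or.comm

def Anc (par : V → V) (x w : V) : Prop := ∃ m, par^[m] w = x

theorem Anc.refl (par : V → V) (x : V) : Anc par x x := ⟨0, rfl⟩

theorem Anc.step {par : V → V} {x w : V} (h : Anc par x (par w)) : Anc par x w := by
  obtain ⟨m, hm⟩ := h
  exact ⟨m + 1, by simpa using hm⟩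

theorem Anc.cases {par : V → V} {x w : V} (h : Anc par x w) : x = w ∨ Anc par x (par w) := by
  obtain ⟨m, hm⟩ := h
  cases m with
  | zero => left; exact hm.symm
  | succ m => right; exact ⟨m, by simpa using hm⟩

theorem anc_iff {par : V → V} {x w : V} : Anc par x w ↔ x = w ∨ Anc par x (par w) := by
  constructor
  · exact Anc.cases
  · rintro (rfl | h)
    · exact Anc.refl _ _
    · exact h.step

theorem Anc.trans {par : V → V} {x y w : V} (h : Anc par x y) (h' : Anc par y w) :
    Anc par x w := by
  obtain ⟨m, rfl⟩ := h
  obtain ⟨k, rfl⟩ := h'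
  exact ⟨m + k, by rw [Function.iterate_add_apply]⟩

theorem IsPar.anc_root {G : SimpleGraph V} {v : V} {par : V → V} (hp : IsPar G v par) {x : V}
    (h : Anc par x v) : x = v := by
  obtain ⟨m, rfl⟩ := h
  exact Function.iterate_fixed hp.root m

theorem IsPar.dist_pos {G : SimpleGraph V} {v : V} {par : V → V} (hp : IsPar G v par) {w : V}
    (h : w ≠ v) : 0 < G.dist v w := by
  have := hp.dist w h
  omega

/-- induction along the tree -/
theorem IsPar.induct {G : SimpleGraph V} {v : V} {par : V → V} (hp : IsPar G v par)
    {P : V → Prop} (h0 : P v) (h1 : ∀ w, w ≠ v → P (par w) → P w) (w : V) : P w := by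
  have : ∀ n, ∀ w, G.dist v w ≤ n → P w := by
    intro n
    induction n with
    | zero =>
      intro w hw
      by_cases h : w = v
      · exact h ▸ h0
      · have := hp.dist_pos h; omega
    | succ n ih =>
      intro w hw
      by_cases h : w = v
      · exact h ▸ h0
      · have := hp.dist w h
        exact h1 w h (ih _ (by omega))
  exact this _ w le_rfl

theorem IsPar.root_anc {G : SimpleGraph V} {v : V} {par : V → V} (hp : IsPar G v par) (w : V) :
    Anc par v w := hp.induct (P := fun w => Anc par v w) (Anc.refl _ _) (fun _ _ h => h.step) w

theorem IsPar.anc_dist {G : SimpleGraph V} {v : V} {par : V → V} (hp : IsPar G v par) {x w : V}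
    (h : Anc par x w) : x = w ∨ G.dist v x < G.dist v w := by
  revert h
  refine hp.induct (P := fun w => Anc par x w → x = w ∨ G.dist v x < G.dist v w) ?_ ?_ w
  · intro h; left; exact hp.anc_root h
  · intro w hw ih h
    rcases h.cases with h | h
    · left; exact h
    · have := hp.dist w hw
      rcases ih h with h | h
      · right; rw [h]; omega
      · right; omega

/-- at each depth at most one ancestor -/
theorem IsPar.anc_unique {G : SimpleGraph V} {v : V} {par : V → V} (hp : IsPar G v par) {x y w : V}
    (hx : Anc par x w) (hy : Anc par y w) (h : G.dist v x = G.dist v y) : x = y := by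
  revert hx hy
  refine hp.induct (P := fun w => Anc par x w → Anc par y w → x = y) ?_ ?_ w
  · intro h1 h2; rw [hp.anc_root h1, hp.anc_root h2]
  · intro w hw ih h1 h2
    rcases hp.anc_dist h1 with h3 | h3
    · rcases hp.anc_dist h2 with h4 | h4
      · rw [h3, h4]
      · rw [h3] at h; omega
    · rcases hp.anc_dist h2 with h4 | h4
      · rw [h4] at h; omega
      · rcases h1.cases with h5 | h5
        · rw [h5] at h3; omega
        · rcases h2.cases with h6 | h6
          · rw [h6] at h4; omega
          · exact ih h5 h6

theorem IsPar.anc_total {G : SimpleGraph V} {v : V} {par : V → V} (hp : IsPar G v par) {x y w : V}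
    (hx : Anc par x w) (hy : Anc par y w) (h : G.dist v x ≤ G.dist v y) : Anc par x y := by
  revert hx hy
  refine hp.induct (P := fun w => Anc par x w → Anc par y w → Anc par x y) ?_ ?_ w
  · intro h1 h2; rw [hp.anc_root h1, hp.anc_root h2]; exact Anc.refl _ _
  · intro w hw ih h1 h2
    rcases h2.cases with h3 | h3
    · rw [h3]; exact h1
    · rcases h1.cases with h4 | h4
      · rcases hp.anc_dist h2 with h5 | h5
        · rw [h5]; exact h1
        · rw [← h4] at h5; omega
      · exact ih h4 h3

theorem IsPar.ne_par {G : SimpleGraph V} {v : V} {par : V → V} (hp : IsPar G v par) {w : V}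
    (h : w ≠ v) : par w ≠ w := (hp.adj w h).ne

/-- tree dart other than the one at `x` does not change the ancestor relation with x -/
theorem IsPar.anc_tree {G : SimpleGraph V} {v : V} {par : V → V} (hp : IsPar G v par) {x : V}
    (d : G.Dart) (hd : isT par d)
    (h1 : ¬ (d.fst = par x ∧ d.snd = x)) (h2 : ¬ (d.fst = x ∧ d.snd = par x)) :
    Anc par x d.fst ↔ Anc par x d.snd := by
  rcases hd with hd | hd
  · rw [anc_iff (w := d.snd), hd]
    constructor
    · exact Or.inr
    · rintro (h | h)
      · exact absurd ⟨by rw [← hd, h], h.symm⟩ h1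
      · exact h
  · rw [anc_iff (w := d.fst), hd]
    constructor
    · rintro (h | h)
      · exact absurd ⟨h.symm, by rw [← hd, h]⟩ h2
      · exact h
    · exact Or.inr

structure Layout (G : SimpleGraph V) (v : V) (par : V → V) where
  L : ℕ
  δ : ℕ → G.Dart
  idx : G.Dart → ℕ
  idx_lt : ∀ d, idx d < L
  δ_idx : ∀ d, δ (idx d) = d
  idx_δ : ∀ k, k < L → idx (δ k) = k
  fst_zero : (δ 0).fst = v
  fst_L : (δ L).fst = v
  step_tree : ∀ k, isT par (δ k) → (δ (k+1)).fst = (δ k).snd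
  step_non : ∀ k, ¬ isT par (δ k) → (δ (k+1)).fst = (δ k).fst
  noncross : ∀ e f, ¬ isT par e → ¬ isT par f → idx e < idx e.symm → idx e < idx f →
    idx f < idx e.symm → idx e < idx f.symm ∧ idx f.symm < idx e.symm

section exist

variable {G : SimpleGraph V} [DecidableRel G.Adj] {v : V} {par : V → V}

def trev (G : SimpleGraph V) (par : V → V) : Equiv.Perm G.Dart :=
  Function.Involutive.toPerm (fun d => if isT par d then d.symm else d) (by
    intro d
    by_cases h : isT par d
    · simp [h, isT_symm]
    · simp [h])

theorem trev_pos {d : G.Dart} (h : isT par d) : trev G par d = d.symm := if_pos h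

theorem trev_neg {d : G.Dart} (h : ¬ isT par d) : trev G par d = d := if_neg h

def psi (R : Rot G) (par : V → V) : Equiv.Perm G.Dart := (trev G par).trans R.σ

theorem psi_pos (R : Rot G) {d : G.Dart} (h : isT par d) : psi R par d = R.σ d.symm := by
  simp [psi, trev_pos h]

theorem psi_neg (R : Rot G) {d : G.Dart} (h : ¬ isT par d) : psi R par d = R.σ d := by
  simp [psi, trev_neg h]

theorem psi_fst_pos (R : Rot G) {d : G.Dart} (h : isT par d) : (psi R par d).fst = d.snd := by
  rw [psi_pos R h, R.fst]; rfl

theorem psi_fst_neg (R : Rot G) {d : G.Dart} (h : ¬ isT par d) : (psi R par d).fst = d.fst := by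
  rw [psi_neg R h, R.fst]

/-- a set of darts invariant under `psi` is closed under reversing tree darts -/
theorem psi_inv_trev (R : Rot G) (hp : IsPar G v par) (S : Finset G.Dart)
    (hS : ∀ d, psi R par d ∈ S ↔ d ∈ S) (d : G.Dart) (hd : isT par d) (hdS : d ∈ S) :
    d.symm ∈ S := by
  classical
  -- balance across a tree edge
  have bal : ∀ x, ∀ e : G.Dart, e.fst = par x → e.snd = x → (e ∈ S ↔ e.symm ∈ S) := by
    intro x e he1 he2
    have hTe : isT par e := Or.inl (by rw [he1, he2])
    let F : G.Dart → ℤ := fun d => if Anc par x d.fst then 1 else 0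
    have h0 : ∑ d ∈ S, F (psi R par d) = ∑ d ∈ S, F d := by
      apply Finset.sum_bij (fun d _ => psi R par d)
      · intro a ha; exact (hS a).2 ha
      · intro a _ b _ h; exact (psi R par).injective h
      · intro b hb
        refine ⟨(psi R par).symm b, ?_, by simp⟩
        rw [← hS]; simpa using hb
      · intros; rfl
    have hxv : x ≠ v := by
      intro h; subst h
      have := e.adj.ne
      rw [he1, he2, hp.root] at this; exact this rfl
    have hnpar : ¬ Anc par x (par x) := by
      intro h
      have h2 := hp.dist x hxv
      rcases hp.anc_dist h with h3 | h3
      · exact hp.ne_par hxv h3.symm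
      · omega
    have h1 : ∀ d ∈ S, F (psi R par d) - F d = (if d = e then 1 else 0) - (if d = e.symm then 1 else 0) := by
      intro d _
      have hne : e ≠ e.symm := (SimpleGraph.Dart.symm_ne e).symm
      by_cases h1 : d = e
      · subst h1
        simp only [F, psi_fst_pos R hTe, if_pos, if_neg hne]
        rw [he1, he2, if_neg hnpar, if_pos (Anc.refl _ _)]
      · by_cases h2 : d = e.symm
        · subst h2
          simp only [F, psi_fst_pos R ((isT_symm par e).2 hTe), if_neg h1, if_pos]
          change (if Anc par x e.fst then (1 : ℤ) else 0) - (if Anc par x e.snd then 1 else 0) = _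
          rw [he1, he2, if_neg hnpar, if_pos (Anc.refl _ _)]
        · rw [if_neg h1, if_neg h2]
          by_cases hT : isT par d
          · simp only [F, psi_fst_pos R hT]
            have := hp.anc_tree (x := x) d hT
              (by
                rintro ⟨a, b⟩; apply h1
                apply SimpleGraph.Dart.ext; ext <;> simp [he1, he2, a, b])
              (by
                rintro ⟨a, b⟩; apply h2
                apply SimpleGraph.Dart.ext; ext <;> simp [he1, he2, a, b])
            simp [this]
          · simp only [F, psi_fst_neg R hT]; simp
    have h2 : ∑ d ∈ S, ((if d = e then (1:ℤ) else 0) - (if d = e.symm then 1 else 0)) = 0 := by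
      rw [← Finset.sum_congr rfl h1, Finset.sum_sub_distrib, h0, sub_self]
    rw [Finset.sum_sub_distrib, Finset.sum_ite_eq', Finset.sum_ite_eq'] at h2
    by_cases a : e ∈ S <;> by_cases b : e.symm ∈ S <;> simp_all
  rcases hd with hd | hd
  · exact (bal d.snd d hd.symm rfl).1 hdS
  · have := (bal d.fst d.symm hd.symm rfl)
    rw [SimpleGraph.Dart.symm_symm] at this
    exact this.2 hdS

theorem psi_sameCycle (R : Rot G) (hp : IsPar G v par) (d0 : G.Dart) (h0 : d0.fst = v)
    (d : G.Dart) : (psi R par).SameCycle d0 d := by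
  classical
  let S : Finset G.Dart := Finset.univ.filter (fun d => (psi R par).SameCycle d0 d)
  have hS : ∀ d, psi R par d ∈ S ↔ d ∈ S := by
    intro d; simp [S]
  have htr := psi_inv_trev R hp S hS
  have hσ : ∀ d, d ∈ S → R.σ d ∈ S := by
    intro d hd
    have : psi R par (trev G par d) = R.σ d := by
      by_cases h : isT par d
      · rw [trev_pos h, psi_pos R ((isT_symm par d).2 h)]; simp
      · rw [trev_neg h, psi_neg R h]
    rw [← this, hS]
    by_cases h : isT par d
    · rw [trev_pos h]; exact htr d h hd
    · rw [trev_neg h]; exact hd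
  have hσn : ∀ (n : ℕ) d, d ∈ S → (R.σ ^ n) d ∈ S := by
    intro n
    induction n with
    | zero => intro d hd; simpa using hd
    | succ n ih => intro d hd; rw [pow_succ]; exact ih _ (hσ _ hd)
  have hall : ∀ x d, d ∈ S → d.fst = x → ∀ d', d'.fst = x → d' ∈ S := by
    intro x d hd hx d' hx'
    obtain ⟨n, -, hn⟩ := (R.cyc d d' (hx.trans hx'.symm)).exists_pow_eq'
    rw [← hn]; exact hσn _ _ hd
  have hfin : ∀ x, ∀ d' : G.Dart, d'.fst = x → d' ∈ S := by
    intro x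
    refine hp.induct (P := fun x => ∀ d' : G.Dart, d'.fst = x → d' ∈ S) ?_ ?_ x
    · exact hall v d0 (by simp [S, Equiv.Perm.SameCycle.refl]) h0
    · intro w hw ih
      let e : G.Dart := ⟨(par w, w), hp.adj w hw⟩
      have he : e ∈ S := ih e rfl
      have he' : e.symm ∈ S := htr e (Or.inl rfl) he
      exact hall w e.symm he' rfl
  have := hfin _ d rfl
  simpa [S] using this

theorem sum_fst_single (e : G.Dart) (x : V) :
    ∑ d with d.fst = x, (if d = e then (1:ℝ) else 0) = if x = e.fst then 1 else 0 := by
  rw [Finset.sum_ite_eq']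
  simp [eq_comm]

theorem tree_chain (hp : IsPar G v par) (w : V) : ∃ z : G.Dart → ℝ, (∀ d, z d.symm = - z d) ∧
    (∀ d, ¬ isT par d → z d = 0) ∧
    ∀ x, ∑ d with d.fst = x, z d = (if x = w then 1 else 0) - (if x = v then 1 else 0) := by
  refine hp.induct (P := fun w => ∃ z : G.Dart → ℝ, (∀ d, z d.symm = - z d) ∧
    (∀ d, ¬ isT par d → z d = 0) ∧
    ∀ x, ∑ d with d.fst = x, z d = (if x = w then 1 else 0) - (if x = v then 1 else 0)) ?_ ?_ w
  · exact ⟨0, by simp, by simp, by simp⟩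
  · rintro w hw ⟨z, h1, h2, h3⟩
    let e : G.Dart := ⟨(par w, w), hp.adj w hw⟩
    have hTe : isT par e := Or.inl rfl
    refine ⟨fun d => z d + ((if d = e.symm then 1 else 0) - (if d = e then 1 else 0)), ?_, ?_, ?_⟩
    · intro d
      have a1 : d.symm = e.symm ↔ d = e := SimpleGraph.Dart.symm_involutive.injective.eq_iff
      have a2 : d.symm = e ↔ d = e.symm := by
        constructor
        · intro h; rw [← h]; simp
        · intro h; rw [h]; simp
      simp only [h1, a1, a2]; ring
    · intro d hd
      have a1 : d ≠ e := by rintro rfl; exact hd hTe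
      have a2 : d ≠ e.symm := by rintro rfl; exact hd ((isT_symm par e).2 hTe)
      simp [h2 d hd, a1, a2]
    · intro x
      rw [Finset.sum_add_distrib, Finset.sum_sub_distrib, h3, sum_fst_single, sum_fst_single]
      change _ + ((if x = w then (1:ℝ) else 0) - (if x = par w then 1 else 0)) = _
      ring

theorem edge_potential (R : Rot G) (hp : IsPar G v par) (e : G.Dart) (he : ¬ isT par e) :
    ∃ N : G.Dart → ℝ,
      (∀ d, N (psi R par d) = N d + ((if d = e then 1 else 0) - (if d = e.symm then 1 else 0))) ∧
      ∀ d, ¬ isT par d → N d.symm = N d + ((if d = e then 1 else 0) - (if d = e.symm then 1 else 0)) := by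
  obtain ⟨zx, x1, x2, x3⟩ := tree_chain hp e.fst
  obtain ⟨zy, y1, y2, y3⟩ := tree_chain hp e.snd
  obtain ⟨N, hN1, hN2⟩ := R.pot
    (fun d => ((if d = e then 1 else 0) - (if d = e.symm then 1 else 0)) + (zy d - zx d))
    (by
      intro d
      have a1 : d.symm = e.symm ↔ d = e := SimpleGraph.Dart.symm_involutive.injective.eq_iff
      have a2 : d.symm = e ↔ d = e.symm := by
        constructor
        · intro h; rw [← h]; simp
        · intro h; rw [h]; simp
      simp only [x1, y1, a1, a2]; ring)
    (by
      intro x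
      rw [Finset.sum_add_distrib, Finset.sum_sub_distrib, Finset.sum_sub_distrib, x3, y3,
        sum_fst_single, sum_fst_single]
      change ((if x = e.fst then (1:ℝ) else 0) - (if x = e.snd then 1 else 0)) + _ = _
      ring)
  refine ⟨N, ?_, ?_⟩
  · intro d
    by_cases h : isT par d
    · have a1 : d ≠ e := by rintro rfl; exact he h
      have a2 : d ≠ e.symm := by rintro rfl; exact he ((isT_symm par e).1 h)
      have a3 : d.symm ≠ e.symm := fun h => a1 (SimpleGraph.Dart.symm_involutive.injective h)
      have a4 : d.symm ≠ e := by rintro rfl; simp at a2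
      rw [psi_pos R h, hN1, hN2]
      simp only [a1, a2, a3, a4, x1, y1, if_false]; ring
    · rw [psi_neg R h, hN1, x2 d h, y2 d h]; ring
  · intro d h
    rw [hN2, x2 d h, y2 d h]; ring

theorem exists_layout (R : Rot G) (hp : IsPar G v par) (d0 : G.Dart) (h0 : d0.fst = v) :
    ∃ Λ : Layout G v par, Λ.δ 0 = d0 ∧ Λ.δ Λ.L = d0 ∧ Λ.L = Fintype.card G.Dart ∧
      ∀ k, Λ.δ (k+1) = psi R par (Λ.δ k) := by
  classical
  set ψ := psi R par with hψ
  have hcyc : ψ.IsCycleOn (Finset.univ : Finset G.Dart) := by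
    refine ⟨by simp, ?_⟩
    intro a _ b _
    exact (psi_sameCycle R hp d0 h0 a).symm.trans (psi_sameCycle R hp d0 h0 b)
  have hex : ∀ d, ∃ n, n < Fintype.card G.Dart ∧ (ψ ^ n) d0 = d := by
    intro d
    obtain ⟨n, hn, h⟩ := hcyc.exists_pow_eq (Finset.mem_univ d0) (Finset.mem_univ d)
    exact ⟨n, hn, h⟩
  choose idx hidx1 hidx2 using hex
  have hinj : ∀ a b, a < Fintype.card G.Dart → b < Fintype.card G.Dart →
      (ψ ^ a) d0 = (ψ ^ b) d0 → a = b := by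
    intro a b ha hb h
    have := (hcyc.pow_apply_eq_pow_apply (Finset.mem_univ d0) (m := a) (n := b)).1 h
    have := Nat.ModEq.eq_of_lt_of_lt this ha hb
    exact this
  have hstep : ∀ k, (ψ ^ (k+1)) d0 = ψ ((ψ ^ k) d0) := by
    intro k; rw [pow_succ']; rfl
  have hL : (ψ ^ Fintype.card G.Dart) d0 = d0 :=
    (hcyc.pow_apply_eq (Finset.mem_univ d0)).2 dvd_rfl
  have hidx3 : ∀ k, k < Fintype.card G.Dart → idx ((ψ ^ k) d0) = k :=
    fun k hk => hinj _ _ (hidx1 _) hk (hidx2 _)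
  suffices hnc : ∀ e f, ¬ isT par e → ¬ isT par f → idx e < idx e.symm → idx e < idx f →
      idx f < idx e.symm → idx e < idx f.symm ∧ idx f.symm < idx e.symm from
    ⟨⟨Fintype.card G.Dart, fun k => (ψ ^ k) d0, idx, hidx1, hidx2, hidx3, h0,
      (congrArg (fun d : G.Dart => d.fst) hL).trans h0,
      fun k h => by simp only [hstep]; exact psi_fst_pos R h,
      fun k h => by simp only [hstep]; exact psi_fst_neg R h, hnc⟩, by simp, hL, rfl, hstep⟩
  intro e f he hf h1 h2 h3
  obtain ⟨N, hN1, hN2⟩ := edge_potential R hp e he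
  have hlow : ∀ k, k ≤ idx e → N ((ψ ^ k) d0) = N d0 := by
    intro k
    induction k with
    | zero => intro _; simp
    | succ k ih =>
      intro hk
      have hkl : k < Fintype.card G.Dart := by have := hidx1 e; omega
      rw [hstep, hN1, ih (by omega)]
      have a1 : (ψ ^ k) d0 ≠ e := fun h => by have := hidx3 k hkl; rw [h] at this; omega
      have a2 : (ψ ^ k) d0 ≠ e.symm := fun h => by have := hidx3 k hkl; rw [h] at this; omega
      simp [a1, a2]
  have hmid : ∀ k, idx e < k → k ≤ idx e.symm → N ((ψ ^ k) d0) = N d0 + 1 := by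
    intro k hk
    induction k, hk using Nat.le_induction with
    | base =>
      intro _
      rw [Nat.succ_eq_add_one, hstep, hN1, hlow _ le_rfl, hidx2]
      have : e ≠ e.symm := (SimpleGraph.Dart.symm_ne e).symm
      simp [this]
    | succ k hk ih =>
      intro hk2
      have hkl : k < Fintype.card G.Dart := by have := hidx1 e.symm; omega
      rw [hstep, hN1, ih (by omega)]
      have a1 : (ψ ^ k) d0 ≠ e := fun h => by have := hidx3 k hkl; rw [h] at this; omega
      have a2 : (ψ ^ k) d0 ≠ e.symm := fun h => by have := hidx3 k hkl; rw [h] at this; omega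
      simp [a1, a2]
  have hhigh : ∀ k, idx e.symm < k → k < Fintype.card G.Dart → N ((ψ ^ k) d0) = N d0 := by
    intro k hk
    induction k, hk using Nat.le_induction with
    | base =>
      intro _
      rw [Nat.succ_eq_add_one, hstep, hN1, hmid _ h1 le_rfl, hidx2]
      have : e.symm ≠ e := (SimpleGraph.Dart.symm_ne e)
      simp [this]
    | succ k hk ih =>
      intro hk2
      rw [hstep, hN1, ih (by omega)]
      have a1 : (ψ ^ k) d0 ≠ e := fun h => by have := hidx3 k (by omega); rw [h] at this; omega
      have a2 : (ψ ^ k) d0 ≠ e.symm := fun h => by have := hidx3 k (by omega); rw [h] at this; omega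
      simp [a1, a2]
  have f1 : f ≠ e := by rintro rfl; omega
  have f2 : f ≠ e.symm := by rintro rfl; omega
  have f3 : f.symm ≠ e.symm := fun h => f1 (SimpleGraph.Dart.symm_involutive.injective h)
  have hNf := hN2 f hf
  simp only [f1, f2, if_false, sub_self, add_zero] at hNf
  have hNf1 : N f = N d0 + 1 := by
    have := hmid (idx f) h2 h3.le
    rwa [hidx2] at this
  have hne : idx f.symm ≠ idx e.symm := fun h => f3 (by rw [← hidx2 f.symm, h, hidx2])
  constructor
  · by_contra hcon
    have := hlow (idx f.symm) (by omega)
    rw [hidx2] at this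
    linarith
  · by_contra hcon
    have := hhigh (idx f.symm) (by omega) (hidx1 _)
    rw [hidx2] at this
    linarith

end exist

end PartB

end

section

set_option linter.unusedSectionVars false
set_option linter.unusedVariables false
set_option linter.unusedSimpArgs false

section PartC

variable {V : Type} [Fintype V] [DecidableEq V]

theorem ncard_le_two_of {S P Q : Set V} (h : S ⊆ P ∪ Q) (hP : P.Subsingleton)
    (hQ : Q.Subsingleton) : S.ncard ≤ 2 := by
  have h1 : P.ncard ≤ 1 := Set.ncard_le_one_iff_subsingleton.2 hP
  have h2 : Q.ncard ≤ 1 := Set.ncard_le_one_iff_subsingleton.2 hQ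
  have h3 := Set.ncard_le_ncard h (Set.toFinite _)
  have h4 := Set.ncard_union_le P Q
  omega

theorem dist_adj_le {G : SimpleGraph V} (hc : G.Connected) (v : V) {w w' : V} (h : G.Adj w w') :
    G.dist v w' ≤ G.dist v w + 1 := by
  have h1 := hc.dist_triangle (u := v) (v := w) (w := w')
  rw [SimpleGraph.dist_eq_one_iff_adj.2 h] at h1
  exact h1

theorem Dart_ext' {G : SimpleGraph V} {d e : G.Dart} (h1 : d.fst = e.fst) (h2 : d.snd = e.snd) :
    d = e := by
  apply SimpleGraph.Dart.ext
  exact Prod.ext h1 h2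

namespace Layout

variable {G : SimpleGraph V} {v : V} {par : V → V}

/-- corner labels -/
def τ (Λ : Layout G v par) (k : ℕ) : V := (Λ.δ k).fst

variable (Λ : Layout G v par)

theorem τ_zero : Λ.τ 0 = v := Λ.fst_zero
theorem τ_L : Λ.τ Λ.L = v := Λ.fst_L
theorem τ_idx (d : G.Dart) : Λ.τ (Λ.idx d) = d.fst := by rw [τ, Λ.δ_idx]
theorem τ_idx_succ_tree (d : G.Dart) (h : isT par d) : Λ.τ (Λ.idx d + 1) = d.snd := by
  rw [τ, Λ.step_tree, Λ.δ_idx]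
  rwa [Λ.δ_idx]
theorem τ_idx_succ_non (d : G.Dart) (h : ¬ isT par d) : Λ.τ (Λ.idx d + 1) = d.fst := by
  rw [τ, Λ.step_non, Λ.δ_idx]
  rwa [Λ.δ_idx]
theorem τ_succ_non {k : ℕ} (h : ¬ isT par (Λ.δ k)) : Λ.τ (k + 1) = Λ.τ k := Λ.step_non k h

theorem idx_inj {d e : G.Dart} (h : Λ.idx d = Λ.idx e) : d = e := by
  rw [← Λ.δ_idx d, h, Λ.δ_idx]

theorem idx_symm_ne (d : G.Dart) : Λ.idx d.symm ≠ Λ.idx d := fun h =>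
  SimpleGraph.Dart.symm_ne d (Λ.idx_inj h)

theorem anc_step (hp : IsPar G v par) {x : V} (e : G.Dart) (he1 : e.fst = par x) (he2 : e.snd = x)
    {k : ℕ} (h1 : Λ.δ k ≠ e) (h2 : Λ.δ k ≠ e.symm) :
    Anc par x (Λ.τ (k+1)) ↔ Anc par x (Λ.τ k) := by
  by_cases h : isT par (Λ.δ k)
  · have h3 := hp.anc_tree (x := x) (Λ.δ k) h
      (by
        rintro ⟨a, b⟩
        exact h1 (Dart_ext' (a.trans he1.symm) (b.trans he2.symm)))
      (by
        rintro ⟨a, b⟩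
        exact h2 (Dart_ext' (a.trans he2.symm) (b.trans he1.symm)))
    rw [τ, τ, Λ.step_tree k h]
    exact h3.symm
  · rw [Λ.τ_succ_non h]

theorem not_anc_par (hp : IsPar G v par) {x : V} (hx : x ≠ v) : ¬ Anc par x (par x) := by
  intro h
  have h2 := hp.dist x hx
  rcases hp.anc_dist h with h3 | h3
  · exact hp.ne_par hx h3.symm
  · omega

theorem ne_root_of {e : G.Dart} (hp : IsPar G v par) {x : V} (he1 : e.fst = par x)
    (he2 : e.snd = x) : x ≠ v := by
  rintro rfl
  have := e.adj.ne
  rw [he1, he2, hp.root] at this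
  exact this rfl

theorem idx_lt_symm (hp : IsPar G v par) {x : V} (e : G.Dart) (he1 : e.fst = par x)
    (he2 : e.snd = x) : Λ.idx e < Λ.idx e.symm := by
  have hx := ne_root_of hp he1 he2
  by_contra hcon
  have hlt : Λ.idx e.symm < Λ.idx e := by
    have := Λ.idx_symm_ne e; omega
  have : ∀ j, j ≤ Λ.idx e.symm → ¬ Anc par x (Λ.τ j) := by
    intro j
    induction j with
    | zero =>
      intro _ h
      rw [Λ.τ_zero] at h
      exact hx (hp.anc_root h)
    | succ j ih =>
      intro hj
      have hjL : j < Λ.L := by have := Λ.idx_lt e.symm; omega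
      rw [Λ.anc_step hp e he1 he2]
      · exact ih (by omega)
      · intro h; have := Λ.idx_δ j hjL; rw [h] at this; omega
      · intro h; have := Λ.idx_δ j hjL; rw [h] at this; omega
  apply this _ le_rfl
  rw [Λ.τ_idx]
  change Anc par x e.snd
  rw [he2]
  exact Anc.refl _ _

theorem anc_iff_idx (hp : IsPar G v par) {x : V} (e : G.Dart) (he1 : e.fst = par x)
    (he2 : e.snd = x) {j : ℕ} (hj : j ≤ Λ.L) :
    Anc par x (Λ.τ j) ↔ Λ.idx e < j ∧ j ≤ Λ.idx e.symm := by
  have hx := ne_root_of hp he1 he2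
  have hlt := Λ.idx_lt_symm hp e he1 he2
  have hT : isT par e := Or.inl (by rw [he1, he2])
  induction j with
  | zero =>
    simp only [not_lt_zero, false_and, iff_false]
    intro h
    rw [Λ.τ_zero] at h
    exact hx (hp.anc_root h)
  | succ j ih =>
    have hjL : j < Λ.L := by omega
    have ih' := ih (Nat.le_of_lt hjL)
    by_cases h1 : Λ.δ j = e
    · have hje : j = Λ.idx e := by rw [← h1, Λ.idx_δ j hjL]
      have : Λ.τ (j+1) = x := by rw [hje, Λ.τ_idx_succ_tree e hT, he2]
      rw [this]
      constructor
      · intro _; omega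
      · intro _; exact Anc.refl _ _
    · by_cases h2 : Λ.δ j = e.symm
      · have hje : j = Λ.idx e.symm := by rw [← h2, Λ.idx_δ j hjL]
        have : Λ.τ (j+1) = par x := by
          rw [hje, Λ.τ_idx_succ_tree e.symm ((isT_symm par e).2 hT)]
          exact he1
        rw [this]
        constructor
        · intro h; exact absurd h (not_anc_par hp hx)
        · intro h; omega
      · refine (Λ.anc_step hp e he1 he2 h1 h2).trans (ih'.trans ?_)
        have a1 : j ≠ Λ.idx e := fun h => h1 (by rw [h, Λ.δ_idx])
        have a2 : j ≠ Λ.idx e.symm := fun h => h2 (by rw [h, Λ.δ_idx])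
        omega

/-- convexity of descendants -/
theorem anc_convex (hp : IsPar G v par) {x : V} {i j k : ℕ} (hij : i ≤ j) (hjk : j ≤ k)
    (hk : k ≤ Λ.L) (h1 : Anc par x (Λ.τ i)) (h2 : Anc par x (Λ.τ k)) : Anc par x (Λ.τ j) := by
  by_cases hx : x = v
  · rw [hx]; exact hp.root_anc _
  · have h3 := fun j => Λ.anc_iff_idx hp (x := x) ⟨(par x, x), hp.adj x hx⟩ rfl rfl (j := j)
    rw [h3 _ (by omega)] at h1 h2 ⊢
    omega

theorem exists_corner (hp : IsPar G v par) (w : V) : ∃ k, k ≤ Λ.L ∧ Λ.τ k = w := by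
  by_cases hw : w = v
  · exact ⟨0, by omega, by rw [hw, Λ.τ_zero]⟩
  · let e : G.Dart := ⟨(w, par w), (hp.adj w hw).symm⟩
    exact ⟨Λ.idx e, (Λ.idx_lt e).le, Λ.τ_idx e⟩

def Adm (i j : ℕ) : Prop :=
  i ≤ j ∧ j ≤ Λ.L ∧ ∀ d : G.Dart, ¬ isT par d → i ≤ Λ.idx d → Λ.idx d < j →
    i ≤ Λ.idx d.symm ∧ Λ.idx d.symm < j

def In (i j : ℕ) : Set V := {w | ∃ k, i ≤ k ∧ k ≤ j ∧ Λ.τ k = w}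
def Out (i j : ℕ) : Set V := {w | ∃ k, k ≤ Λ.L ∧ (k ≤ i ∨ j ≤ k) ∧ Λ.τ k = w}

theorem adm_full : Λ.Adm 0 Λ.L := ⟨by omega, le_rfl, fun d _ _ _ => ⟨by omega, Λ.idx_lt _⟩⟩

theorem in_full (hp : IsPar G v par) : Λ.In 0 Λ.L = Set.univ := by
  ext w
  simp only [Set.mem_univ, iff_true]
  obtain ⟨k, h1, h2⟩ := Λ.exists_corner hp w
  exact ⟨k, by omega, h1, h2⟩

theorem root_out (i j : ℕ) : v ∈ Λ.Out i j := ⟨0, by omega, by omega, Λ.τ_zero⟩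

theorem in_union_out (hp : IsPar G v par) {i j : ℕ} (w : V) : w ∈ Λ.In i j ∨ w ∈ Λ.Out i j := by
  obtain ⟨k, h1, h2⟩ := Λ.exists_corner hp w
  by_cases h : i ≤ k ∧ k ≤ j
  · left; exact ⟨k, h.1, h.2, h2⟩
  · right; exact ⟨k, h1, by omega, h2⟩

variable {Λ}

theorem Adm.in_of_adj {i j : ℕ} (ha : Λ.Adm i j) {w w' : V} (hadj : G.Adj w w')
    (hw : w ∉ Λ.Out i j) : w' ∈ Λ.In i j := by
  let d : G.Dart := ⟨(w, w'), hadj⟩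
  have h1 := Λ.idx_lt d
  have h2 : ¬ (Λ.idx d ≤ i ∨ j ≤ Λ.idx d) := fun h => hw ⟨_, h1.le, h, Λ.τ_idx d⟩
  by_cases hT : isT par d
  · exact ⟨Λ.idx d + 1, by omega, by omega, Λ.τ_idx_succ_tree d hT⟩
  · have h3 := ha.2.2 d hT (by omega) (by omega)
    exact ⟨Λ.idx d.symm, h3.1, h3.2.le, Λ.τ_idx d.symm⟩

theorem Adm.out_of_adj {i j : ℕ} (hp : IsPar G v par) (ha : Λ.Adm i j) {w w' : V}
    (hadj : G.Adj w w') (hw : w ∉ Λ.In i j) : w' ∈ Λ.Out i j := by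
  by_contra h
  exact hw (ha.in_of_adj hadj.symm h)

theorem Adm.wall {i j : ℕ} (hp : IsPar G v par) (ha : Λ.Adm i j) {w : V} (h1 : w ∈ Λ.In i j)
    (h2 : w ∈ Λ.Out i j) : Anc par w (Λ.τ i) ∨ Anc par w (Λ.τ j) := by
  obtain ⟨k, hk1, hk2, hk3⟩ := h1
  obtain ⟨l, hl1, hl2, hl3⟩ := h2
  have hj := ha.2.1
  have a1 : Anc par w (Λ.τ k) := by rw [hk3]; exact Anc.refl _ _
  have a2 : Anc par w (Λ.τ l) := by rw [hl3]; exact Anc.refl _ _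
  rcases hl2 with h | h
  · left; exact Λ.anc_convex hp h hk1 (by omega) a2 a1
  · right; exact Λ.anc_convex hp hk2 h hl1 a1 a2

theorem Adm.tree {i j : ℕ} (ha : Λ.Adm i j) (hij : i < j) (hT : isT par (Λ.δ i)) :
    Λ.Adm (i+1) j := by
  refine ⟨hij, ha.2.1, ?_⟩
  intro d hd h1 h2
  have h3 := ha.2.2 d hd (by omega) h2
  refine ⟨?_, h3.2⟩
  by_contra h
  have h4 : Λ.idx d.symm = i := by omega
  rw [← h4, Λ.δ_idx, isT_symm] at hT
  exact hd hT

theorem Adm.mate {i j : ℕ} (ha : Λ.Adm i j) (hij : i < j) (hT : ¬ isT par (Λ.δ i)) :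
    i < Λ.idx (Λ.δ i).symm ∧ Λ.idx (Λ.δ i).symm < j := by
  have h1 : Λ.idx (Λ.δ i) = i := Λ.idx_δ i (by have := ha.2.1; omega)
  have h2 := ha.2.2 (Λ.δ i) hT (by omega) (by omega)
  have h3 := Λ.idx_symm_ne (Λ.δ i)
  omega

theorem adm_edge (e : G.Dart) (he : ¬ isT par e) (h : Λ.idx e < Λ.idx e.symm) :
    Λ.Adm (Λ.idx e + 1) (Λ.idx e.symm) := by
  refine ⟨h, (Λ.idx_lt _).le, ?_⟩
  intro f hf h1 h2
  have := Λ.noncross e f he hf h h1 h2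
  omega

theorem Adm.right {i j : ℕ} (ha : Λ.Adm i j) (e : G.Dart) (he : ¬ isT par e)
    (h0 : Λ.idx e = i)
    (h : Λ.idx e < Λ.idx e.symm) (hj : Λ.idx e.symm < j) :
    Λ.Adm (Λ.idx e.symm + 1) j := by
  refine ⟨hj, ha.2.1, ?_⟩
  intro f hf h1 h2
  have h3 := ha.2.2 f hf (by omega) h2
  refine ⟨?_, h3.2⟩
  by_contra hcon
  have a1 : Λ.idx f.symm ≠ Λ.idx e := by
    intro h
    have := Λ.idx_inj h
    rw [← this] at h1; simp at h1
  have a2 : Λ.idx f.symm ≠ Λ.idx e.symm := by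
    intro h
    have := SimpleGraph.Dart.symm_involutive.injective (Λ.idx_inj h)
    rw [this] at h1; omega
  have := Λ.noncross e f.symm he (by rwa [isT_symm]) h (by omega) (by omega)
  rw [SimpleGraph.Dart.symm_symm] at this
  omega

theorem Adm.left_pair {i j : ℕ} (ha : Λ.Adm i j) (hij : i < j) (hT : ¬ isT par (Λ.δ i)) :
    Λ.Adm (i+1) (Λ.idx (Λ.δ i).symm) := by
  have h1 : Λ.idx (Λ.δ i) = i := Λ.idx_δ i (by have := ha.2.1; omega)
  have h2 := ha.mate hij hT
  have := adm_edge (Λ := Λ) (Λ.δ i) hT (by omega)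
  rwa [h1] at this

theorem Adm.right_pair {i j : ℕ} (ha : Λ.Adm i j) (hij : i < j) (hT : ¬ isT par (Λ.δ i)) :
    Λ.Adm (Λ.idx (Λ.δ i).symm + 1) j := by
  have h1 : Λ.idx (Λ.δ i) = i := Λ.idx_δ i (by have := ha.2.1; omega)
  have h2 := ha.mate hij hT
  exact ha.right (Λ.δ i) hT h1 (by omega) h2.2

/-- covering of the vertex set -/
theorem cover_tree (hp : IsPar G v par) {i j : ℕ} (w : V) : w ∈ Λ.Out i j ∨ w ∈ Λ.In (i+1) j := by
  obtain ⟨k, h1, h2⟩ := Λ.exists_corner hp w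
  by_cases h : i + 1 ≤ k ∧ k ≤ j
  · right; exact ⟨k, h.1, h.2, h2⟩
  · left; exact ⟨k, h1, by omega, h2⟩

theorem cover_non (hp : IsPar G v par) {i j l : ℕ} (hil : i < l) (hlj : l < j) (w : V) :
    w ∈ Λ.Out i j ∨ w ∈ Λ.In (i+1) l ∨ w ∈ Λ.In (l+1) j := by
  obtain ⟨k, h1, h2⟩ := Λ.exists_corner hp w
  by_cases h : i + 1 ≤ k ∧ k ≤ l
  · right; left; exact ⟨k, h.1, h.2, h2⟩
  · by_cases h' : l + 1 ≤ k ∧ k ≤ j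
    · right; right; exact ⟨k, h'.1, h'.2, h2⟩
    · left; exact ⟨k, h1, by omega, h2⟩

/-- Minimality argument -/
theorem minimal_adm (P : ℕ → ℕ → Prop) (hfull : ¬ P 0 Λ.L) (hdiag : ∀ i, Λ.Adm i i → P i i) :
    ∃ i j, Λ.Adm i j ∧ ¬ P i j ∧ i < j ∧
      ((isT par (Λ.δ i) ∧ Λ.Adm (i+1) j ∧ P (i+1) j) ∨
       (¬ isT par (Λ.δ i) ∧ ∃ l, i < l ∧ l < j ∧ l = Λ.idx (Λ.δ i).symm ∧
          Λ.Adm (i+1) l ∧ P (i+1) l ∧ Λ.Adm (l+1) j ∧ P (l+1) j)) := by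
  classical
  have hex : ∃ n, ∃ i j, Λ.Adm i j ∧ ¬ P i j ∧ j - i = n := ⟨_, 0, Λ.L, Λ.adm_full, hfull, rfl⟩
  obtain ⟨i, j, ha, hnP, hn⟩ := Nat.find_spec hex
  have hmin : ∀ i' j', Λ.Adm i' j' → j' - i' < j - i → P i' j' := by
    intro i' j' ha' hlt
    by_contra hP
    exact Nat.find_min hex (hn ▸ hlt) ⟨i', j', ha', hP, rfl⟩
  have hij : i < j := by
    rcases ha.1.lt_or_eq with h | h
    · exact h
    · subst h; exact absurd (hdiag i ha) hnP
  refine ⟨i, j, ha, hnP, hij, ?_⟩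
  by_cases hT : isT par (Λ.δ i)
  · left
    exact ⟨hT, ha.tree hij hT, hmin _ _ (ha.tree hij hT) (by omega)⟩
  · right
    obtain ⟨h1, h2⟩ := ha.mate hij hT
    exact ⟨hT, _, h1, h2, rfl, ha.left_pair hij hT, hmin _ _ (ha.left_pair hij hT) (by omega),
      ha.right_pair hij hT, hmin _ _ (ha.right_pair hij hT) (by omega)⟩

theorem anc_subsingleton (hp : IsPar G v par) (a : V) (t : ℕ) :
    {c | Anc par c a ∧ G.dist v c = t}.Subsingleton := by
  intro x hx y hy
  exact hp.anc_unique hx.1 hy.1 (hx.2.trans hy.2.symm)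

/-- the simple strategy -/
theorem Adm.simple {i j : ℕ} (hc : G.Connected) (hp : IsPar G v par) (ha : Λ.Adm i j) (X : Set V)
    (hX : X = Λ.In i j ∨ X = Λ.Out i j) (hN : (G.neighborSet v ∩ X).ncard ≤ 2) :
    (X \ {v}).ncard ≤ sn G (fun _ => 2) v := by
  have hpos : ∀ c, c ≠ v → 0 < G.dist v c := fun c hcv => hp.dist_pos hcv
  have hsub : Λ.In i j ∩ Λ.Out i j ⊆ X := by
    rcases hX with rfl | rfl
    · exact Set.inter_subset_left
    · exact Set.inter_subset_right
  have hCne : ∀ c ∈ ((Λ.In i j ∩ Λ.Out i j) \ {v}) ∪ (G.neighborSet v ∩ X), c ≠ v := by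
    rintro c (h | h)
    · exact h.2
    · exact h.1.ne'
  apply sn_ge_sub G v (((Λ.In i j ∩ Λ.Out i j) \ {v}) ∪ (G.neighborSet v ∩ X)) (X \ {v})
    (fun w => G.dist v w - 1) (fun w => G.dist v w) (X \ {v})
  · exact Set.subset_union_left
  · intro h; exact hCne v h rfl
  · intro h; exact h.2 rfl
  · intro w w' h1 h2 h3 h4
    by_cases hw : w = v
    · subst hw; right; exact ⟨h3, h4.1⟩
    · left
      have hwX : w ∉ X := fun h => h2 ⟨h, hw⟩
      rcases hX with rfl | rfl
      · exact ⟨⟨h4.1, ha.out_of_adj hp h3 hwX⟩, h4.2⟩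
      · exact ⟨⟨ha.in_of_adj h3 hwX, h4.1⟩, h4.2⟩
  · intro w w' _ _ h; exact dist_adj_le hc v h
  · simp
  · intro c hcC; have := hpos c (hCne c hcC); omega
  · intro t
    by_cases ht : t = 0
    · refine le_trans (Set.ncard_le_ncard ?_ (Set.toFinite _)) hN
      rintro c ⟨h1, h2⟩
      have h3 := hpos c (hCne c h1)
      refine ⟨?_, ?_⟩
      · rw [SimpleGraph.mem_neighborSet, ← SimpleGraph.dist_eq_one_iff_adj]
        omega
      · rcases h1 with h1 | h1
        · exact hsub h1.1
        · exact h1.2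
    · apply ncard_le_two_of (P := {c | Anc par c (Λ.τ i) ∧ G.dist v c = t + 1})
        (Q := {c | Anc par c (Λ.τ j) ∧ G.dist v c = t + 1}) _ (anc_subsingleton hp _ _)
        (anc_subsingleton hp _ _)
      rintro c ⟨h1, h2⟩
      have h3 := hpos c (hCne c h1)
      rcases h1 with h1 | h1
      · rcases ha.wall hp h1.1.1 h1.1.2 with h | h
        · left; exact ⟨h, by omega⟩
        · right; exact ⟨h, by omega⟩
      · have := SimpleGraph.dist_eq_one_iff_adj.2 h1.1
        omega

/-- counting neighbours of the root on the walls -/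
theorem Adm.wall_nbrs {i j : ℕ} (hp : IsPar G v par) (ha : Λ.Adm i j) :
    (G.neighborSet v ∩ (Λ.In i j ∩ Λ.Out i j)).ncard ≤ 2 := by
  apply ncard_le_two_of (P := {c | Anc par c (Λ.τ i) ∧ G.dist v c = 1})
        (Q := {c | Anc par c (Λ.τ j) ∧ G.dist v c = 1}) _ (anc_subsingleton hp _ _)
        (anc_subsingleton hp _ _)
  rintro c ⟨h1, h2, h3⟩
  have h4 := SimpleGraph.dist_eq_one_iff_adj.2 h1
  rcases ha.wall hp h2 h3 with h | h
  · left; exact ⟨h, h4⟩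
  · right; exact ⟨h, h4⟩

end Layout

/-- BFS parents exist -/
theorem exists_pred {G : SimpleGraph V} (hc : G.Connected) (v w : V) (hw : w ≠ v) :
    ∃ p, G.Adj p w ∧ G.dist v p + 1 = G.dist v w := by
  obtain ⟨p, hp⟩ := hc.exists_walk_length_eq_dist w v
  cases p with
  | nil => exact absurd rfl hw
  | cons h q =>
    rename_i u
    refine ⟨u, h.symm, ?_⟩
    rw [SimpleGraph.Walk.length_cons] at hp
    have h1 := SimpleGraph.dist_le q
    have h2 := dist_adj_le hc v h.symm
    rw [SimpleGraph.dist_comm (u := v) (v := u), SimpleGraph.dist_comm (u := v) (v := w)] at *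
    omega

theorem exists_par {G : SimpleGraph V} (hc : G.Connected) (v : V) : ∃ par, IsPar G v par := by
  choose f hf1 hf2 using exists_pred hc v
  refine ⟨fun w => if h : w = v then v else f w h, by simp, ?_, ?_⟩
  · intro w hw; simp only [dif_neg hw]; exact hf1 w hw
  · intro w hw; simp only [dif_neg hw]; exact hf2 w hw

end PartC

end

section

set_option linter.unusedSectionVars false
set_option linter.unusedVariables false
set_option linter.unusedSimpArgs false

section PartD

variable {V : Type} [Fintype V] [DecidableEq V]

theorem IsPar.par_nbr {G : SimpleGraph V} {v : V} {par : V → V} (hc : G.Connected)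
    (hp : IsPar G v par) {w : V} (h : G.Adj v w) : par w = v := by
  have h1 := hp.dist w h.ne'
  rw [SimpleGraph.dist_eq_one_iff_adj.2 h] at h1
  have h2 : G.dist v (par w) = 0 := by omega
  rw [hc.dist_eq_zero_iff] at h2
  exact h2.symm

theorem IsPar.nontree_fst {G : SimpleGraph V} {v : V} {par : V → V} (hc : G.Connected)
    (hp : IsPar G v par) {d : G.Dart} (h : ¬ isT par d) : d.fst ≠ v := by
  intro h1
  apply h
  left
  rw [h1]
  exact hp.par_nbr hc (by rw [← h1]; exact d.adj)

theorem ncard_union_overlap {A B : Set V} {x : V} (hA : x ∈ A) (hB : x ∈ B) :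
    (A ∪ B).ncard + 1 ≤ A.ncard + B.ncard := by
  have h1 := Set.ncard_union_add_ncard_inter A B (Set.toFinite _) (Set.toFinite _)
  have h2 : 0 < (A ∩ B).ncard := (Set.ncard_pos (Set.toFinite _)).2 ⟨x, hA, hB⟩
  omega

theorem sn_deg_three {G : SimpleGraph V} [DecidableRel G.Adj] (hc : G.Connected) (R : Rot G)
    (v : V) (hd : (G.neighborSet v).ncard ≤ 3) (hn : 3 ≤ Fintype.card V) :
    Fintype.card V ≤ 3 * sn G (fun _ => 2) v := by
  obtain ⟨par, hp⟩ := exists_par hc v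
  have hsn := sn_two G v hn
  obtain ⟨b, hb⟩ : ∃ b, G.Adj v b := by
    haveI : Nontrivial V := Fintype.one_lt_card_iff_nontrivial.1 (by omega)
    exact hc.preconnected.exists_adj_of_nontrivial v
  obtain ⟨Λ, -⟩ := exists_layout R hp ⟨(v, b), hb⟩ rfl
  by_cases hfull : (Λ.In 0 Λ.L \ {v}).ncard ≤ sn G (fun _ => 2) v
  · rw [Λ.in_full hp, ← Set.compl_eq_univ_diff, Set.ncard_compl, Set.ncard_singleton,
      Nat.card_eq_fintype_card] at hfull
    omega
  obtain ⟨i, j, ha, hnP, hij, hcase⟩ := Layout.minimal_adm (Λ := Λ)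
    (fun i j => (Λ.In i j \ {v}).ncard ≤ sn G (fun _ => 2) v) hfull
    (by
      intro i _
      have h1 : (Λ.In i i \ {v}) ⊆ {Λ.τ i} := by
        rintro w ⟨⟨k, h1, h2, h3⟩, -⟩
        have : k = i := by omega
        subst this
        exact h3.symm
      have h2 := Set.ncard_le_ncard h1 (Set.toFinite _)
      rw [Set.ncard_singleton] at h2
      omega)
  have h3 : ¬ (G.neighborSet v ∩ Λ.In i j).ncard ≤ 2 := fun h =>
    hnP (ha.simple hc hp _ (Or.inl rfl) h)
  have h4 : G.neighborSet v ∩ Λ.In i j = G.neighborSet v :=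
    Set.eq_of_subset_of_ncard_le Set.inter_subset_left (by omega) (Set.toFinite _)
  have h5 : (Λ.Out i j \ {v}).ncard ≤ sn G (fun _ => 2) v := by
    apply ha.simple hc hp _ (Or.inr rfl)
    refine le_trans (Set.ncard_le_ncard ?_ (Set.toFinite _)) (ha.wall_nbrs hp)
    rintro w ⟨h6, h7⟩
    refine ⟨h6, ?_, h7⟩
    rw [← h4] at h6
    exact h6.2
  rcases hcase with ⟨hT, ha1, hg1⟩ | ⟨hT, l, hil, hlj, hl, ha1, hg1, ha2, hg2⟩
  · have hcov : (Set.univ : Set V) ⊆ ((Λ.Out i j \ {v}) ∪ (Λ.In (i+1) j \ {v})) ∪ {v} := by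
      intro w _
      by_cases hw : w = v
      · right; exact hw
      · left
        rcases Layout.cover_tree hp (Λ := Λ) (i := i) (j := j) w with h | h
        · left; exact ⟨h, hw⟩
        · right; exact ⟨h, hw⟩
    have h6 := Set.ncard_le_ncard hcov (Set.toFinite _)
    have h7 := Set.ncard_union_le ((Λ.Out i j \ {v}) ∪ (Λ.In (i+1) j \ {v})) {v}
    have h8 := Set.ncard_union_le (Λ.Out i j \ {v}) (Λ.In (i+1) j \ {v})
    rw [Set.ncard_univ, Nat.card_eq_fintype_card] at h6
    rw [Set.ncard_singleton] at h7
    omega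
  · have hτ : Λ.τ i ≠ v := hp.nontree_fst hc hT
    have hcov : (Set.univ : Set V) ⊆
        (((Λ.Out i j \ {v}) ∪ (Λ.In (i+1) l \ {v})) ∪ (Λ.In (l+1) j \ {v})) ∪ {v} := by
      intro w _
      by_cases hw : w = v
      · right; exact hw
      · left
        rcases Layout.cover_non hp (Λ := Λ) hil hlj w with h | h | h
        · left; left; exact ⟨h, hw⟩
        · left; right; exact ⟨h, hw⟩
        · right; exact ⟨h, hw⟩
    have h6 := Set.ncard_le_ncard hcov (Set.toFinite _)
    have h7 := Set.ncard_union_le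
      (((Λ.Out i j \ {v}) ∪ (Λ.In (i+1) l \ {v})) ∪ (Λ.In (l+1) j \ {v})) {v}
    have h8 := Set.ncard_union_le ((Λ.Out i j \ {v}) ∪ (Λ.In (i+1) l \ {v})) (Λ.In (l+1) j \ {v})
    have h9 := ncard_union_overlap (A := Λ.Out i j \ {v}) (B := Λ.In (i+1) l \ {v}) (x := Λ.τ i)
      ⟨⟨i, by have := ha.2.1; omega, Or.inl le_rfl, rfl⟩, hτ⟩
      ⟨⟨i+1, le_rfl, hil, Λ.τ_succ_non hT⟩, hτ⟩
    rw [Set.ncard_univ, Nat.card_eq_fintype_card] at h6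
    rw [Set.ncard_singleton] at h7
    omega

end PartD

end

section

set_option linter.unusedSectionVars false
set_option linter.unusedVariables false
set_option linter.unusedSimpArgs false

section PartE

variable {V : Type} [Fintype V] [DecidableEq V]

theorem Layout.corner_bounds {G : SimpleGraph V} {v : V} {par : V → V} (Λ : Layout G v par)
    (hp : IsPar G v par) {x : V} {k : ℕ} (hk : k ≤ Λ.L) (h : Anc par x (Λ.τ k)) :
    (∃ k1, k1 ≤ k ∧ Λ.τ k1 = x) ∧ (∃ k2, k ≤ k2 ∧ k2 ≤ Λ.L ∧ Λ.τ k2 = x) := by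
  by_cases hx : x = v
  · subst hx
    exact ⟨⟨0, by omega, Λ.τ_zero⟩, ⟨Λ.L, hk, le_rfl, Λ.τ_L⟩⟩
  · let e : G.Dart := ⟨(par x, x), hp.adj x hx⟩
    have h1 := (Λ.anc_iff_idx hp e rfl rfl hk).1 h
    refine ⟨⟨Λ.idx e + 1, h1.1, Λ.τ_idx_succ_tree e (Or.inl rfl)⟩,
      ⟨Λ.idx e.symm, h1.2, (Λ.idx_lt _).le, Λ.τ_idx e.symm⟩⟩

/-- All facts needed for the pair lemma. -/
structure PairSetup {G : SimpleGraph V} {v : V} {par : V → V} (Λ : Layout G v par) (a b c u : V)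
    (FC : V → Prop) : Prop where
  hc : G.Connected
  hp : IsPar G v par
  va : G.Adj v a
  vb : G.Adj v b
  vc : G.Adj v c
  vu : G.Adj v u
  nbr : ∀ w, G.Adj v w → w = a ∨ w = b ∨ w = c ∨ w = u
  ab : a ≠ b
  ac : a ≠ c
  au : a ≠ u
  bc : b ≠ c
  bu : b ≠ u
  cu : c ≠ u
  top : ∀ w, w ≠ v → Anc par a w ∨ Anc par b w ∨ Anc par c w ∨ Anc par u w
  U_up : ∀ p w, Anc par u p → G.Adj p w → G.dist v p + 1 = G.dist v w → Anc par u w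
  A_up : ∀ p w, Anc par a p → G.Adj p w → G.dist v p + 1 = G.dist v w →
    Anc par u w ∨ Anc par a w
  C_pred : ∀ p w, Anc par c w → G.Adj p w → G.dist v p + 1 = G.dist v w → p ≠ v → Anc par c p
  B_pred : ∀ p w, Anc par b w → G.Adj p w → G.dist v p + 1 = G.dist v w → p ≠ v →
    Anc par b p ∨ Anc par c p
  F_a : ∀ w, FC w → Anc par a w
  F_tied : ∀ w, FC w → (∃ q, Anc par u q ∧ G.dist v q = G.dist v w ∧ G.Adj w q) ∨ FC (par w)
  tied_F : ∀ w q, Anc par a w → Anc par u q → G.dist v q = G.dist v w → G.Adj w q → FC w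
  F_up : ∀ p w, FC p → G.Adj p w → G.dist v p + 1 = G.dist v w → Anc par a w → FC w
  ord_bc : ∀ i j, i ≤ Λ.L → j ≤ Λ.L → Anc par b (Λ.τ i) → Anc par c (Λ.τ j) → i < j
  ord_cu : ∀ i j, i ≤ Λ.L → j ≤ Λ.L → Anc par c (Λ.τ i) → Anc par u (Λ.τ j) → i < j
  ord_ua : ∀ i j, i ≤ Λ.L → j ≤ Λ.L → Anc par u (Λ.τ i) → Anc par a (Λ.τ j) → i < j
  au_cu : G.Adj a u → G.Adj c u
  degu : (G.neighborSet u).ncard ≤ 4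

namespace PairSetup

variable {G : SimpleGraph V} {v : V} {par : V → V} {Λ : Layout G v par} {a b c u : V}
    {FC : V → Prop}

section basic

theorem ord_bu (S : PairSetup Λ a b c u FC) : ∀ i j, i ≤ Λ.L → j ≤ Λ.L → Anc par b (Λ.τ i) → Anc par u (Λ.τ j) → i < j := by
  intro i j hi hj h1 h2
  obtain ⟨k, hk, hkc⟩ := Λ.exists_corner S.hp c
  have hkc' : Anc par c (Λ.τ k) := by rw [hkc]; exact Anc.refl _ _
  exact (S.ord_bc i k hi hk h1 hkc').trans (S.ord_cu k j hk hj hkc' h2)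

theorem ord_ca (S : PairSetup Λ a b c u FC) : ∀ i j, i ≤ Λ.L → j ≤ Λ.L → Anc par c (Λ.τ i) → Anc par a (Λ.τ j) → i < j := by
  intro i j hi hj h1 h2
  obtain ⟨k, hk, hkc⟩ := Λ.exists_corner S.hp u
  have hkc' : Anc par u (Λ.τ k) := by rw [hkc]; exact Anc.refl _ _
  exact (S.ord_cu i k hi hk h1 hkc').trans (S.ord_ua k j hk hj hkc' h2)

theorem ord_ba (S : PairSetup Λ a b c u FC) : ∀ i j, i ≤ Λ.L → j ≤ Λ.L → Anc par b (Λ.τ i) → Anc par a (Λ.τ j) → i < j := by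
  intro i j hi hj h1 h2
  obtain ⟨k, hk, hkc⟩ := Λ.exists_corner S.hp c
  have hkc' : Anc par c (Λ.τ k) := by rw [hkc]; exact Anc.refl _ _
  exact (S.ord_bc i k hi hk h1 hkc').trans (S.ord_ca k j hk hj hkc' h2)

theorem da (S : PairSetup Λ a b c u FC) : G.dist v a = 1 := SimpleGraph.dist_eq_one_iff_adj.2 S.va
theorem db (S : PairSetup Λ a b c u FC) : G.dist v b = 1 := SimpleGraph.dist_eq_one_iff_adj.2 S.vb
theorem dc (S : PairSetup Λ a b c u FC) : G.dist v c = 1 := SimpleGraph.dist_eq_one_iff_adj.2 S.vc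
theorem du (S : PairSetup Λ a b c u FC) : G.dist v u = 1 := SimpleGraph.dist_eq_one_iff_adj.2 S.vu

theorem excl (S : PairSetup Λ a b c u FC) {x y w : V} (hx : G.dist v x = 1) (hy : G.dist v y = 1) (hxy : x ≠ y)
    (h1 : Anc par x w) (h2 : Anc par y w) : False :=
  hxy (S.hp.anc_unique h1 h2 (hx.trans hy.symm))

theorem ne_v (S : PairSetup Λ a b c u FC) {x w : V} (hx : G.dist v x = 1) (h : Anc par x w) : w ≠ v := by
  rintro rfl
  have := S.hp.anc_root h
  rw [this] at hx; simp at hx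

theorem dist1 (S : PairSetup Λ a b c u FC) {w : V} (h : G.dist v w = 1) : w = a ∨ w = b ∨ w = c ∨ w = u :=
  S.nbr w (SimpleGraph.dist_eq_one_iff_adj.1 h)

theorem anc_one (S : PairSetup Λ a b c u FC) {x w : V} (hx : G.dist v x = 1) (h : Anc par x w) (hw : G.dist v w = 1) : w = x := by
  rcases S.hp.anc_dist h with h1 | h1
  · exact h1.symm
  · omega

theorem anc_ge (S : PairSetup Λ a b c u FC) {x w : V} (h : Anc par x w) : G.dist v x ≤ G.dist v w := by
  rcases S.hp.anc_dist h with h1 | h1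
  · rw [h1]
  · omega

/-- a neighbour of `u` other than `v`, `a`, `b`, `c` is in the class of `u`, at depth two. -/
theorem nbr_u (S : PairSetup Λ a b c u FC) {w : V} (h : G.Adj u w) (h1 : w ≠ v) (h2 : w ≠ a) (h3 : w ≠ b) (h4 : w ≠ c) :
    Anc par u w ∧ G.dist v w = 2 := by
  have h5 := dist_adj_le S.hc v h
  rw [S.du] at h5
  have h6 := S.hp.dist_pos h1
  have h7 : G.dist v w ≠ 1 := by
    intro h8
    rcases S.dist1 h8 with h | h | h | h
    · exact h2 h
    · exact h3 h
    · exact h4 h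
    · subst h; exact G.irrefl ‹_›
  have h8 : G.dist v w = 2 := by omega
  exact ⟨S.U_up u w (Anc.refl _ _) h (by rw [S.du, h8]), h8⟩

/-- class `u` at depth two consists of neighbours of `u` -/
theorem u_two (S : PairSetup Λ a b c u FC) {w : V} (h : Anc par u w) (h2 : G.dist v w = 2) : G.Adj u w := by
  have hw : w ≠ v := S.ne_v S.du h
  have h3 := S.hp.dist w hw
  have h4 : Anc par u (par w) := by
    rcases h.cases with h5 | h5
    · rw [← h5, S.du] at h2; omega
    · exact h5
  have := S.anc_one S.du h4 (by omega)
  rw [← this]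
  exact S.hp.adj w hw

end basic

/-- Type (b,u), option R. -/
theorem optR (S : PairSetup Λ a b c u FC) {i j : ℕ} (ha : Λ.Adm i j) (hi : Anc par b (Λ.τ i))
    (hj : Anc par u (Λ.τ j))
    (hdeg : ((G.neighborSet u ∩ Λ.In i j) \ {v, b, c}).ncard ≤ 2) :
    (Λ.In i j \ {u, v}).ncard ≤ sn G (fun _ => 2) v := by
  classical
  have hiL : i ≤ Λ.L := ha.1.trans ha.2.1
  have haIn : ∀ w, Anc par a w → w ∉ Λ.In i j := by
    rintro w hw ⟨k, h1, h2, rfl⟩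
    have := S.ord_ua j k ha.2.1 (h2.trans ha.2.1) hj hw
    omega
  have hbI : b ∈ Λ.In i j ∧ b ∈ Λ.Out i j := by
    obtain ⟨⟨k1, h1, h2⟩, ⟨k2, h3, h4, h5⟩⟩ := Λ.corner_bounds S.hp hiL hi
    refine ⟨⟨k2, h3, ?_, h5⟩, ⟨k1, by omega, Or.inl h1, h2⟩⟩
    exact (S.ord_bu k2 j h4 ha.2.1 (by rw [h5]; exact Anc.refl _ _) hj).le
  set C : Set V := ((Λ.In i j ∩ Λ.Out i j) \ {u, v}) ∪ {c} ∪ ((G.neighborSet u ∩ Λ.In i j) \ {v})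
    with hC
  have hCv : ∀ w ∈ C, w ≠ v := by
    rintro w ((h | h) | h)
    · intro h'; exact h.2 (by simp [h'])
    · rw [Set.mem_singleton_iff.1 h]; exact S.vc.ne'
    · exact h.2
  have hCu : u ∉ C := by
    rintro ((h | h) | h)
    · exact h.2 (by simp)
    · exact S.cu (Set.mem_singleton_iff.1 h).symm
    · exact G.irrefl h.1.1
  -- the structure of C
  have hCs : ∀ w ∈ C, w = b ∨ w = c ∨ (Anc par b w ∧ Anc par w (Λ.τ i) ∧ 2 ≤ G.dist v w) ∨
      (Anc par u w ∧ G.dist v w = 2 ∧ w ∈ (G.neighborSet u ∩ Λ.In i j) \ {v, b, c}) ∨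
      (Anc par u w ∧ Anc par w (Λ.τ j) ∧ 3 ≤ G.dist v w) := by
    intro w hw
    have hwv := hCv w hw
    have hpos := S.hp.dist_pos hwv
    have hwu : w ≠ u := fun h => hCu (h ▸ hw)
    have hun : ∀ w, w ≠ v → G.Adj u w → w ∈ Λ.In i j → w = b ∨ w = c ∨
        (Anc par u w ∧ G.dist v w = 2 ∧ w ∈ (G.neighborSet u ∩ Λ.In i j) \ {v, b, c}) := by
      intro w hwv h1 h2
      by_cases hb : w = b
      · exact Or.inl hb
      by_cases hcc : w = c
      · exact Or.inr (Or.inl hcc)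
      have h3 := S.nbr_u h1 hwv (fun h => haIn w (h ▸ Anc.refl _ _) h2) hb hcc
      refine Or.inr (Or.inr ⟨h3.1, h3.2, ⟨h1, h2⟩, ?_⟩)
      simp [hwv, hb, hcc]
    rcases hw with (h | h) | h
    · rcases ha.wall S.hp h.1.1 h.1.2 with h1 | h1
      · have h2 : Anc par b w := S.hp.anc_total hi h1 (by rw [S.db]; omega)
        by_cases h3 : G.dist v w = 1
        · left; exact S.anc_one S.db h2 h3
        · right; right; left; exact ⟨h2, h1, by omega⟩
      · have h2 : Anc par u w := S.hp.anc_total hj h1 (by rw [S.du]; omega)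
        by_cases h3 : G.dist v w = 1
        · exact absurd (S.anc_one S.du h2 h3) hwu
        by_cases h4 : G.dist v w = 2
        · rcases hun w hwv (S.u_two h2 h4) h.1.1 with h | h | h
          · exact Or.inl h
          · exact Or.inr (Or.inl h)
          · exact Or.inr (Or.inr (Or.inr (Or.inl h)))
        · right; right; right; right; exact ⟨h2, h1, by omega⟩
    · right; left; exact h
    · rcases hun w hwv h.1.1 h.1.2 with h | h | h
      · exact Or.inl h
      · exact Or.inr (Or.inl h)
      · exact Or.inr (Or.inr (Or.inr (Or.inl h)))
  have hnUb : ∀ w, Anc par b w → ¬ Anc par u w := fun w h1 h2 => S.excl S.db S.du S.bu h1 h2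
  have hnUc : ∀ w, Anc par c w → ¬ Anc par u w := fun w h1 h2 => S.excl S.dc S.du S.cu h1 h2
  have fb : ¬ Anc par u b := hnUb b (Anc.refl _ _)
  have fc : ¬ Anc par u c := hnUc c (Anc.refl _ _)
  apply sn_ge_sub G v C (Λ.In i j \ {u, v})
    (fun w => if Anc par u w then G.dist v w - 1 else if G.dist v w = 1 then 0 else G.dist v w)
    (fun w => G.dist v w + if 2 ≤ G.dist v w ∧ (Anc par b w ∨ Anc par c w) then 1 else 0)
    (Λ.In i j \ {u, v})
  · exact Set.subset_union_left
  · intro h; exact hCv v h rfl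
  · intro h; exact h.2 (by simp)
  · intro w w' h1 h2 h3 h4
    have h4v : w' ≠ v := fun h => h4.2 (by simp [h])
    have h4u : w' ≠ u := fun h => h4.2 (by simp [h])
    by_cases hw : w = v
    · subst hw
      rcases S.nbr w' h3 with h | h | h | h
      · exact absurd h4.1 (haIn w' (h ▸ Anc.refl _ _))
      · left; left; subst h; exact ⟨hbI, h4.2⟩
      · left; right; exact h
      · exact absurd h h4u
    · by_cases hwu : w = u
      · subst hwu
        right; exact ⟨⟨h3, h4.1⟩, h4v⟩
      · have hwX : w ∉ Λ.In i j := fun h => h2 ⟨h, by simp [hw, hwu]⟩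
        left; left
        exact ⟨⟨h4.1, ha.out_of_adj S.hp h3 hwX⟩, h4.2⟩
  · intro w w' h1 h2 h3
    have h4 := dist_adj_le S.hc v h3
    by_cases h5 : 2 ≤ G.dist v w' ∧ (Anc par b w' ∨ Anc par c w')
    · by_cases h6 : G.dist v w' = G.dist v w + 1
      · have hwv : w ≠ v := by rintro rfl; rw [SimpleGraph.dist_self] at h6; omega
        have hbc : Anc par b w ∨ Anc par c w := by
          rcases h5.2 with h | h
          · exact S.B_pred w w' h h3 h6.symm hwv
          · right; exact S.C_pred w w' h h3 h6.symm hwv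
        have h7 : G.dist v w ≠ 1 := by
          intro h7
          apply h1
          rcases hbc with h | h
          · rw [S.anc_one S.db h h7]; left; left
            exact ⟨hbI, by simp [S.bu, S.vb.ne']⟩
          · rw [S.anc_one S.dc h h7]; left; right; rfl
        have h8 := S.hp.dist_pos hwv
        simp only [if_pos h5]
        rw [if_pos ⟨by omega, hbc⟩]
        omega
      · simp only [if_pos h5]; omega
    · simp only [if_neg h5]; omega
  · simp
  · intro w hw
    rcases hCs w hw with h | h | h | h | h
    · subst h; simp [fb, S.db]
    · subst h; simp [fc, S.dc]
    · simp only [hnUb w h.1, if_false, h.1, true_or, and_true, h.2.2, if_true]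
      split_ifs <;> omega
    · simp only [h.1, if_true]; omega
    · simp only [h.1, if_true]; omega
  · intro t
    by_cases ht0 : t = 0
    · apply ncard_le_two_of (P := {b}) (Q := {c}) _ Set.subsingleton_singleton
        Set.subsingleton_singleton
      rintro w ⟨hw, hf⟩
      rcases hCs w hw with h | h | h | h | h
      · left; exact h
      · right; exact h
      · simp only [hnUb w h.1, if_false] at hf
        split_ifs at hf <;> omega
      · simp only [h.1, if_true] at hf; omega
      · simp only [h.1, if_true] at hf; omega
    · by_cases ht1 : t = 1
      · refine le_trans (Set.ncard_le_ncard ?_ (Set.toFinite _)) hdeg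
        rintro w ⟨hw, hf⟩
        rcases hCs w hw with h | h | h | h | h
        · subst h; simp [fb, S.db] at hf; omega
        · subst h; simp [fc, S.dc] at hf; omega
        · simp only [hnUb w h.1, if_false] at hf
          split_ifs at hf <;> omega
        · exact h.2.2
        · simp only [h.1, if_true] at hf; omega
      · apply ncard_le_two_of (P := {x | Anc par x (Λ.τ i) ∧ G.dist v x = t})
          (Q := {x | Anc par x (Λ.τ j) ∧ G.dist v x = t + 1}) _ (Layout.anc_subsingleton S.hp _ _)
          (Layout.anc_subsingleton S.hp _ _)
        rintro w ⟨hw, hf⟩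
        rcases hCs w hw with h | h | h | h | h
        · subst h; simp [fb, S.db] at hf; omega
        · subst h; simp [fc, S.dc] at hf; omega
        · left
          simp only [hnUb w h.1, if_false] at hf
          refine ⟨h.2.1, ?_⟩
          split_ifs at hf <;> omega
        · simp only [h.1, if_true] at hf; omega
        · right
          simp only [h.1, if_true] at hf
          exact ⟨h.2.1, by omega⟩

/-- Type (b,u), option L. -/
theorem optL (S : PairSetup Λ a b c u FC) {i j : ℕ} (ha : Λ.Adm i j) (hi : Anc par b (Λ.τ i))
    (hj : Anc par u (Λ.τ j))
    (hdeg : ¬ ((G.neighborSet u ∩ Λ.In i j) \ {v, b, c}).ncard ≤ 2) :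
    (Λ.Out i j \ {u, v}).ncard ≤ sn G (fun _ => 2) v := by
  classical
  have hiL : i ≤ Λ.L := ha.1.trans ha.2.1
  have haIn : ∀ w, Anc par a w → w ∉ Λ.In i j := by
    rintro w hw ⟨k, h1, h2, rfl⟩
    have := S.ord_ua j k ha.2.1 (h2.trans ha.2.1) hj hw
    omega
  have hcO : ∀ w, Anc par c w → w ∉ Λ.Out i j := by
    rintro w hw ⟨k, h1, h2, rfl⟩
    have h3 := S.ord_bc i k hiL h1 hi hw
    have h4 := S.ord_cu k j h1 ha.2.1 hw hj
    omega
  have hbI : b ∈ Λ.In i j ∧ b ∈ Λ.Out i j := by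
    obtain ⟨⟨k1, h1, h2⟩, ⟨k2, h3, h4, h5⟩⟩ := Λ.corner_bounds S.hp hiL hi
    refine ⟨⟨k2, h3, ?_, h5⟩, ⟨k1, by omega, Or.inl h1, h2⟩⟩
    exact (S.ord_bu k2 j h4 ha.2.1 (by rw [h5]; exact Anc.refl _ _) hj).le
  -- all neighbours of u other than v are inside
  have hNu : ∀ w, G.Adj u w → w ≠ v → w ∈ Λ.In i j := by
    have h1 : ((G.neighborSet u ∩ Λ.In i j) \ {v, b, c}) ⊆ G.neighborSet u \ {v} := by
      rintro w ⟨h1, h2⟩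
      exact ⟨h1.1, fun h => h2 (by simp [Set.mem_singleton_iff.1 h])⟩
    have h2 : (G.neighborSet u \ {v}).ncard + 1 = (G.neighborSet u).ncard :=
      Set.ncard_diff_singleton_add_one S.vu.symm (Set.toFinite _)
    have h3 := S.degu
    have h4 := Set.eq_of_subset_of_ncard_le h1 (by omega) (Set.toFinite _)
    intro w h5 h6
    have : w ∈ G.neighborSet u \ {v} := ⟨h5, h6⟩
    rw [← h4] at this
    exact this.1.2
  set C : Set V := ((Λ.In i j ∩ Λ.Out i j) \ {u, v}) ∪ {a} with hC
  have hCv : ∀ w ∈ C, w ≠ v := by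
    rintro w (h | h)
    · intro h'; exact h.2 (by simp [h'])
    · rw [Set.mem_singleton_iff.1 h]; exact S.va.ne'
  have hCu : u ∉ C := by
    rintro (h | h)
    · exact h.2 (by simp)
    · exact S.au (Set.mem_singleton_iff.1 h).symm
  apply sn_ge_sub G v C (Λ.Out i j \ {u, v})
    (fun w => G.dist v w - 1) (fun w => G.dist v w) (Λ.Out i j \ {u, v})
  · exact Set.subset_union_left
  · intro h; exact hCv v h rfl
  · intro h; exact h.2 (by simp)
  · intro w w' h1 h2 h3 h4
    have h4v : w' ≠ v := fun h => h4.2 (by simp [h])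
    have h4u : w' ≠ u := fun h => h4.2 (by simp [h])
    by_cases hw : w = v
    · subst hw
      rcases S.nbr w' h3 with h | h | h | h
      · right; exact h
      · left; subst h; exact ⟨hbI, h4.2⟩
      · exact absurd h4.1 (hcO w' (h ▸ Anc.refl _ _))
      · exact absurd h h4u
    · by_cases hwu : w = u
      · subst hwu
        left; exact ⟨⟨hNu w' h3 h4v, h4.1⟩, h4.2⟩
      · have hwX : w ∉ Λ.Out i j := fun h => h2 ⟨h, by simp [hw, hwu]⟩
        left
        exact ⟨⟨ha.in_of_adj h3 hwX, h4.1⟩, h4.2⟩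
  · intro w w' _ _ h; exact dist_adj_le S.hc v h
  · simp
  · intro w hw; have := S.hp.dist_pos (hCv w hw); omega
  · intro t
    by_cases ht0 : t = 0
    · apply ncard_le_two_of (P := {a}) (Q := {b}) _ Set.subsingleton_singleton
        Set.subsingleton_singleton
      rintro w ⟨hw, hf⟩
      have := S.hp.dist_pos (hCv w hw)
      rcases S.dist1 (w := w) (by omega) with h | h | h | h
      · left; exact h
      · right; exact h
      · rcases hw with hw | hw
        · exact absurd hw.1.2 (hcO w (h ▸ Anc.refl _ _))
        · left; exact hw
      · exact absurd (h ▸ hw) hCu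
    · apply ncard_le_two_of (P := {x | Anc par x (Λ.τ i) ∧ G.dist v x = t + 1})
          (Q := {x | Anc par x (Λ.τ j) ∧ G.dist v x = t + 1}) _ (Layout.anc_subsingleton S.hp _ _)
          (Layout.anc_subsingleton S.hp _ _)
      rintro w ⟨hw, hf⟩
      have := S.hp.dist_pos (hCv w hw)
      rcases hw with hw | hw
      · rcases ha.wall S.hp hw.1.1 hw.1.2 with h | h
        · left; exact ⟨h, by omega⟩
        · right; exact ⟨h, by omega⟩
      · rw [Set.mem_singleton_iff.1 hw, S.da] at hf; omega

/-- Type (c,a) with both a, c adjacent to u. -/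
theorem optT (S : PairSetup Λ a b c u FC) {i j : ℕ} (ha : Λ.Adm i j) (hi : Anc par c (Λ.τ i))
    (hj : Anc par a (Λ.τ j)) (hau : G.Adj a u) :
    (Λ.In i j \ {u, v}).ncard ≤ sn G (fun _ => 2) v := by
  classical
  have hcu := S.au_cu hau
  have hiL : i ≤ Λ.L := ha.1.trans ha.2.1
  have hbIn : ∀ w, Anc par b w → w ∉ Λ.In i j := by
    rintro w hw ⟨k, h1, h2, rfl⟩
    have := S.ord_bc k i (h2.trans ha.2.1) hiL hw hi
    omega
  have hcI : c ∈ Λ.In i j ∧ c ∈ Λ.Out i j := by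
    obtain ⟨⟨k1, h1, h2⟩, ⟨k2, h3, h4, h5⟩⟩ := Λ.corner_bounds S.hp hiL hi
    refine ⟨⟨k2, h3, ?_, h5⟩, ⟨k1, by omega, Or.inl h1, h2⟩⟩
    exact (S.ord_ca k2 j h4 ha.2.1 (by rw [h5]; exact Anc.refl _ _) hj).le
  have haI : a ∈ Λ.In i j ∧ a ∈ Λ.Out i j := by
    obtain ⟨⟨k1, h1, h2⟩, ⟨k2, h3, h4, h5⟩⟩ := Λ.corner_bounds S.hp ha.2.1 hj
    refine ⟨⟨k1, ?_, h1, h2⟩, ⟨k2, h4, Or.inr h3, h5⟩⟩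
    exact (S.ord_ca i k1 hiL (h1.trans ha.2.1) hi (by rw [h2]; exact Anc.refl _ _)).le
  have huO : u ∉ Λ.Out i j := by
    rintro ⟨k, h1, h2, h3⟩
    have h4 : Anc par u (Λ.τ k) := h3 ▸ Anc.refl _ _
    have h5 := S.ord_cu i k hiL h1 hi h4
    have h6 := S.ord_ua k j h1 ha.2.1 h4 hj
    omega
  have hrest : (((G.neighborSet u \ {v}) \ {a}) \ {c}).ncard ≤ 1 := by
    have h1 : v ∈ G.neighborSet u := S.vu.symm
    have h2 : a ∈ G.neighborSet u \ {v} := ⟨hau.symm, S.va.ne'⟩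
    have h3 : c ∈ (G.neighborSet u \ {v}) \ {a} := ⟨⟨hcu.symm, S.vc.ne'⟩, S.ac.symm⟩
    have e1 := Set.ncard_diff_singleton_add_one h1 (Set.toFinite _)
    have e2 := Set.ncard_diff_singleton_add_one h2 (Set.toFinite _)
    have e3 := Set.ncard_diff_singleton_add_one h3 (Set.toFinite _)
    have := S.degu
    omega
  set C : Set V := ((Λ.In i j ∩ Λ.Out i j) \ {v}) ∪ ((G.neighborSet u ∩ Λ.In i j) \ {v})
    with hC
  have hCv : ∀ w ∈ C, w ≠ v := by
    rintro w (h | h)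
    · exact h.2
    · exact h.2
  have hCu : u ∉ C := by
    rintro (h | h)
    · exact huO h.1.2
    · exact G.irrefl h.1.1
  have hCs : ∀ w ∈ C, (Anc par c w ∧ Anc par w (Λ.τ i)) ∨ (Anc par a w ∧ Anc par w (Λ.τ j)) ∨
      (Anc par u w ∧ G.dist v w = 2 ∧ w ∈ ((G.neighborSet u \ {v}) \ {a}) \ {c}) := by
    intro w hw
    have hwv := hCv w hw
    have hpos := S.hp.dist_pos hwv
    have hwall : w ∈ Λ.In i j → w ∈ Λ.Out i j → (Anc par c w ∧ Anc par w (Λ.τ i)) ∨ (Anc par a w ∧ Anc par w (Λ.τ j)) := by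
      intro h1 h2
      rcases ha.wall S.hp h1 h2 with h1 | h1
      · left; exact ⟨S.hp.anc_total hi h1 (by rw [S.dc]; omega), h1⟩
      · right; exact ⟨S.hp.anc_total hj h1 (by rw [S.da]; omega), h1⟩
    by_cases hwa : w = a
    · subst hwa
      rcases hwall haI.1 haI.2 with h | h
      · exact Or.inl h
      · exact Or.inr (Or.inl h)
    by_cases hwc : w = c
    · subst hwc
      rcases hwall hcI.1 hcI.2 with h | h
      · exact Or.inl h
      · exact Or.inr (Or.inl h)
    rcases hw with h | h
    · rcases hwall h.1.1 h.1.2 with h | h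
      · exact Or.inl h
      · exact Or.inr (Or.inl h)
    · right; right
      have h3 := S.nbr_u h.1.1 hwv hwa (fun h' => hbIn w (h' ▸ Anc.refl _ _) h.1.2) hwc
      exact ⟨h3.1, h3.2, ⟨⟨h.1.1, hwv⟩, hwa⟩, hwc⟩
  have hnac : ∀ w, Anc par a w → ¬ Anc par c w := fun w h1 h2 => S.excl S.da S.dc S.ac h1 h2
  have hnuc : ∀ w, Anc par u w → ¬ Anc par c w := fun w h1 h2 => S.excl S.du S.dc S.cu.symm h1 h2
  apply sn_ge_sub G v C (Λ.In i j \ {u, v})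
    (fun w => if Anc par c w then (if G.dist v w = 1 then 0 else G.dist v w) else G.dist v w - 1)
    (fun w => G.dist v w + if 2 ≤ G.dist v w ∧ Anc par c w then 1 else 0)
    (Λ.In i j \ {u, v})
  · exact Set.subset_union_left
  · intro h; exact hCv v h rfl
  · intro h; exact h.2 (by simp)
  · intro w w' h1 h2 h3 h4
    have h4v : w' ≠ v := fun h => h4.2 (by simp [h])
    have h4u : w' ≠ u := fun h => h4.2 (by simp [h])
    by_cases hw : w = v
    · subst hw
      left
      rcases S.nbr w' h3 with h | h | h | h
      · subst h; exact ⟨haI, h4v⟩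
      · exact absurd h4.1 (hbIn w' (h ▸ Anc.refl _ _))
      · subst h; exact ⟨hcI, h4v⟩
      · exact absurd h h4u
    · by_cases hwu : w = u
      · subst hwu
        right; exact ⟨⟨h3, h4.1⟩, h4v⟩
      · have hwX : w ∉ Λ.In i j := fun h => h2 ⟨h, by simp [hw, hwu]⟩
        left
        exact ⟨⟨h4.1, ha.out_of_adj S.hp h3 hwX⟩, h4v⟩
  · intro w w' h1 h2 h3
    have h4 := dist_adj_le S.hc v h3
    by_cases h5 : 2 ≤ G.dist v w' ∧ Anc par c w'
    · by_cases h6 : G.dist v w' = G.dist v w + 1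
      · have hwv : w ≠ v := by rintro rfl; rw [SimpleGraph.dist_self] at h6; omega
        have hbc : Anc par c w := S.C_pred w w' h5.2 h3 h6.symm hwv
        have h7 : G.dist v w ≠ 1 := by
          intro h7
          apply h1
          rw [S.anc_one S.dc hbc h7]; left
          exact ⟨hcI, S.vc.ne'⟩
        have h8 := S.hp.dist_pos hwv
        simp only [if_pos h5]
        rw [if_pos ⟨by omega, hbc⟩]
        omega
      · simp only [if_pos h5]; omega
    · simp only [if_neg h5]; omega
  · simp
  · intro w hw
    have hpos := S.hp.dist_pos (hCv w hw)
    rcases hCs w hw with h | h | h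
    · simp only [h.1, if_true, and_true]
      split_ifs <;> omega
    · simp only [hnac w h.1, if_false]; omega
    · simp only [hnuc w h.1, if_false]; omega
  · intro t
    by_cases ht0 : t = 0
    · apply ncard_le_two_of (P := {a}) (Q := {c}) _ Set.subsingleton_singleton
        Set.subsingleton_singleton
      rintro w ⟨hw, hf⟩
      have hpos := S.hp.dist_pos (hCv w hw)
      rcases hCs w hw with h | h | h
      · simp only [h.1, if_true] at hf
        right
        split_ifs at hf with h5
        · exact S.anc_one S.dc h.1 h5
        · omega
      · simp only [hnac w h.1, if_false] at hf
        left
        exact S.anc_one S.da h.1 (by omega)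
      · simp only [hnuc w h.1, if_false] at hf; omega
    · by_cases ht1 : t = 1
      · apply ncard_le_two_of (P := {x | Anc par x (Λ.τ j) ∧ G.dist v x = 2})
          (Q := (((G.neighborSet u \ {v}) \ {a}) \ {c})) _ (Layout.anc_subsingleton S.hp _ _)
          (Set.ncard_le_one_iff_subsingleton.1 hrest)
        rintro w ⟨hw, hf⟩
        rcases hCs w hw with h | h | h
        · simp only [h.1, if_true] at hf
          split_ifs at hf <;> omega
        · simp only [hnac w h.1, if_false] at hf
          left
          exact ⟨h.2, by omega⟩
        · right; exact h.2.2
      · apply ncard_le_two_of (P := {x | Anc par x (Λ.τ i) ∧ G.dist v x = t})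
          (Q := {x | Anc par x (Λ.τ j) ∧ G.dist v x = t + 1}) _ (Layout.anc_subsingleton S.hp _ _)
          (Layout.anc_subsingleton S.hp _ _)
        rintro w ⟨hw, hf⟩
        rcases hCs w hw with h | h | h
        · left
          simp only [h.1, if_true] at hf
          refine ⟨h.2, ?_⟩
          split_ifs at hf <;> omega
        · right
          simp only [hnac w h.1, if_false] at hf
          exact ⟨h.2, by omega⟩
        · simp only [hnuc w h.1, if_false] at hf; omega

end PairSetup

end PartE

end

section

set_option linter.unusedSectionVars false
set_option linter.unusedVariables false
set_option linter.unusedSimpArgs false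

section PartE2

variable {V : Type} [Fintype V] [DecidableEq V]

namespace PairSetup

variable {G : SimpleGraph V} {v : V} {par : V → V} {Λ : Layout G v par} {a b c u : V}
    {FC : V → Prop}

/-- Type (c,a), with a tied vertex on the right wall. -/
theorem optF (S : PairSetup Λ a b c u FC) {i j : ℕ} (ha : Λ.Adm i j) (hi : Anc par c (Λ.τ i))
    (hj : Anc par a (Λ.τ j)) (hau : ¬ G.Adj a u) (hF : ∃ x, FC x ∧ Anc par x (Λ.τ j)) :
    (Λ.In i j \ {u, v}).ncard ≤ 2 * sn G (fun _ => 2) v := by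
  classical
  have hiL : i ≤ Λ.L := ha.1.trans ha.2.1
  have hjL := ha.2.1
  -- lowest FC ancestor
  obtain ⟨x, ⟨hFx, hxj⟩, q, hq, hdq, hxq⟩ : ∃ x, (FC x ∧ Anc par x (Λ.τ j)) ∧
      ∃ q, Anc par u q ∧ G.dist v q = G.dist v x ∧ G.Adj x q := by
    obtain ⟨x, hx, hmin⟩ := Set.exists_min_image {x | FC x ∧ Anc par x (Λ.τ j)} (G.dist v)
      (Set.toFinite _) hF
    refine ⟨x, hx, ?_⟩
    rcases S.F_tied x hx.1 with h | h
    · exact h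
    · exfalso
      have hxv : x ≠ v := S.ne_v S.da (S.F_a x hx.1)
      have h1 : Anc par (par x) (Λ.τ j) := Anc.trans ⟨1, rfl⟩ hx.2
      have h2 := hmin (par x) ⟨h, h1⟩
      have h3 := S.hp.dist x hxv
      omega
  have hax : Anc par a x := S.F_a x hFx
  have hxv : x ≠ v := S.ne_v S.da hax
  have hqv : q ≠ v := S.ne_v S.du hq
  obtain ⟨m, hm⟩ : ∃ m, m = G.dist v x := ⟨_, rfl⟩
  have hm2 : 2 ≤ m := by
    have h1 := S.hp.dist_pos hxv
    by_contra h
    have h2 : x = a := S.anc_one S.da hax (by omega)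
    have h3 : q = u := S.anc_one S.du hq (by omega)
    rw [h2, h3] at hxq
    exact hau hxq
  let e : G.Dart := ⟨(q, x), hxq.symm⟩
  have heT : ¬ isT par e := by
    rintro (h | h)
    · have h1 : par x = q := h
      have := S.hp.dist x hxv; rw [h1] at this; omega
    · have h1 : par q = x := h
      have := S.hp.dist q hqv; rw [h1] at this; omega
  obtain ⟨p, hp⟩ : ∃ p, p = Λ.idx e := ⟨_, rfl⟩
  obtain ⟨r, hr⟩ : ∃ r, r = Λ.idx e.symm := ⟨_, rfl⟩
  have hpL : p ≤ Λ.L := hp ▸ (Λ.idx_lt _).le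
  have hrL : r ≤ Λ.L := hr ▸ (Λ.idx_lt _).le
  have hτp : Λ.τ p = q := by rw [hp, Λ.τ_idx]
  have hτp1 : Λ.τ (p+1) = q := by rw [hp, Λ.τ_idx_succ_non e heT]
  have hτr : Λ.τ r = x := by rw [hr, Λ.τ_idx]; rfl
  have hτr1 : Λ.τ (r+1) = x := by
    rw [hr, Λ.τ_idx_succ_non e.symm (fun h => heT ((isT_symm par e).1 h))]; rfl
  have hup : Anc par u (Λ.τ p) := hτp ▸ hq
  have har : Anc par a (Λ.τ r) := hτr ▸ hax
  have hip : i < p := S.ord_cu i p hiL hpL hi hup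
  have hpr : p < r := S.ord_ua p r hpL hrL hup har
  have hpj : p < j := S.ord_ua p j hpL hjL hup hj
  have hrj : r < j := by
    have := ha.2.2 e heT (by omega) (by omega)
    omega
  set X : Set V := {w | ∃ k, ((i ≤ k ∧ k ≤ p) ∨ (r + 1 ≤ k ∧ k ≤ j)) ∧ Λ.τ k = w} with hX
  set Y : Set V := {w | ∃ k, k ≤ Λ.L ∧ (k ≤ i ∨ (p + 1 ≤ k ∧ k ≤ r) ∨ j ≤ k) ∧ Λ.τ k = w} with hY
  have hbd : ∀ w w', w' ∉ Y → G.Adj w' w → w ∈ X := by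
    intro w w' hw' hadj
    let d : G.Dart := ⟨(w', w), hadj⟩
    have h1 := Λ.idx_lt d
    have h2 : ¬ (Λ.idx d ≤ i ∨ (p + 1 ≤ Λ.idx d ∧ Λ.idx d ≤ r) ∨ j ≤ Λ.idx d) :=
      fun h => hw' ⟨_, h1.le, h, Λ.τ_idx d⟩
    have hde : d ≠ e := by
      intro h
      apply hw'
      have : w' = q := congrArg (fun d : G.Dart => d.fst) h
      exact ⟨p + 1, by omega, by omega, by rw [hτp1, this]⟩
    have hdp : Λ.idx d ≠ p := fun h => hde (Λ.idx_inj (h.trans hp))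
    by_cases hT : isT par d
    · exact ⟨Λ.idx d + 1, by omega, Λ.τ_idx_succ_tree d hT⟩
    · have h3 := ha.2.2 d hT (by omega) (by omega)
      have h4 : Λ.idx d.symm ≠ r := by
        intro h
        have h' := Λ.idx_inj (h.trans hr)
        exact hde (by rw [← d.symm_symm, h', e.symm_symm])
      have h5 : Λ.idx d.symm ≠ p := by
        intro h
        have h' := Λ.idx_inj (h.trans hp)
        have h6 : d = e.symm := by rw [← d.symm_symm, h']
        have h7 : Λ.idx d = r := by rw [h6, hr]
        omega
      have h6 : ¬ (p < Λ.idx d.symm ∧ Λ.idx d.symm < r) := by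
        rintro ⟨h6, h7⟩
        have h8 := Λ.noncross e d.symm heT (fun h => hT ((isT_symm par d).1 h)) (by omega)
          (by omega) (by omega)
        rw [d.symm_symm] at h8
        omega
      exact ⟨Λ.idx d.symm, by omega, Λ.τ_idx d.symm⟩
  have hwall : ∀ w, w ≠ v → w ∈ X → w ∈ Y → (Anc par c w ∧ Anc par w (Λ.τ i)) ∨
      (Anc par u w ∧ Anc par w q) ∨ (Anc par a w ∧ Anc par w (Λ.τ j) ∧ m ≤ G.dist v w) := by
    rintro w hwv ⟨k, hk, hkw⟩ ⟨l, hlL, hl, hlw⟩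
    have hpos := S.hp.dist_pos hwv
    have ak : Anc par w (Λ.τ k) := hkw ▸ Anc.refl _ _
    have al : Anc par w (Λ.τ l) := hlw ▸ Anc.refl _ _
    have F1 : Anc par w (Λ.τ i) → Anc par c w ∧ Anc par w (Λ.τ i) := fun h =>
      ⟨S.hp.anc_total hi h (by rw [S.dc]; omega), h⟩
    have F2 : Anc par w (Λ.τ p) → Anc par u w ∧ Anc par w q := fun h =>
      ⟨S.hp.anc_total hup h (by rw [S.du]; omega), hτp ▸ h⟩
    rcases hk with hk | hk
    · rcases hl with hl | hl | hl
      · left; exact F1 (Λ.anc_convex S.hp hl hk.1 (by omega) al ak)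
      · right; left
        exact F2 (Λ.anc_convex S.hp hk.2 (by omega) hlL ak al)
      · right; left
        exact F2 (Λ.anc_convex S.hp hk.2 (by omega) hlL ak al)
    · have hxw : Anc par x w := by
        rw [← hkw]
        exact Λ.anc_convex S.hp hk.1 hk.2 hjL (hτr1 ▸ Anc.refl _ _) hxj
      have hmw : m ≤ G.dist v w := hm ▸ S.anc_ge hxw
      rcases hl with hl | hl | hl
      · left; exact F1 (Λ.anc_convex S.hp hl (by omega) (by omega) al ak)
      · right; right
        have : Anc par w (Λ.τ r) := Λ.anc_convex S.hp hl.2 (by omega) (by omega) al ak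
        rw [hτr] at this
        exact ⟨hax.trans hxw, this.trans hxj, hmw⟩
      · right; right
        exact ⟨hax.trans hxw, Λ.anc_convex S.hp hk.2 hl hlL ak al, hmw⟩
  have hbX : b ∉ X := by
    rintro ⟨k, hk, h⟩
    have := S.ord_bc k i (by omega) hiL (h ▸ Anc.refl _ _) hi
    omega
  have haX : a ∉ X := by
    rintro ⟨k, hk, h⟩
    rcases hk with hk | hk
    · have := S.ord_ua p k hpL (by omega) hup (h ▸ Anc.refl _ _)
      omega
    · have hxw : Anc par x a := by
        rw [← h]
        exact Λ.anc_convex S.hp hk.1 hk.2 hjL (hτr1 ▸ Anc.refl _ _) hxj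
      have := S.anc_ge hxw
      rw [S.da] at this; omega
  set C : Set V := ((X ∩ Y) \ {v}) ∪ {c, u} with hC
  have hCv : ∀ w ∈ C, w ≠ v := by
    rintro w (h | h | h)
    · exact h.2
    · rw [h]; exact S.vc.ne'
    · rw [Set.mem_singleton_iff.1 h]; exact S.vu.ne'
  have hCs : ∀ w ∈ C, (Anc par c w ∧ Anc par w (Λ.τ i)) ∨
      (Anc par u w ∧ Anc par w q) ∨ (Anc par a w ∧ Anc par w (Λ.τ j) ∧ m ≤ G.dist v w) := by
    rintro w (h | h | h)
    · exact hwall w h.2 h.1.1 h.1.2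
    · left; rw [h]; exact ⟨Anc.refl _ _, hi⟩
    · right; left; rw [Set.mem_singleton_iff.1 h]; exact ⟨Anc.refl _ _, hq⟩
  have hnac : ∀ w, Anc par a w → ¬ Anc par c w := fun w h1 h2 => S.excl S.da S.dc S.ac h1 h2
  have hnuc : ∀ w, Anc par u w → ¬ Anc par c w := fun w h1 h2 => S.excl S.du S.dc S.cu.symm h1 h2
  have main : (X \ {v}).ncard ≤ sn G (fun _ => 2) v := by
    apply sn_ge_sub G v C (X \ {v})
      (fun w => if Anc par c w ∧ m ≤ G.dist v w then G.dist v w else G.dist v w - 1)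
      (fun w => G.dist v w + if 2 ≤ G.dist v w ∧ Anc par c w then 1 else 0)
      (X \ {v})
    · exact Set.subset_union_left
    · intro h; exact hCv v h rfl
    · intro h; exact h.2 rfl
    · intro w w' h1 h2 h3 h4
      by_cases hw : w = v
      · subst hw
        right
        rcases S.nbr w' h3 with h | h | h | h
        · exact absurd h4.1 (h ▸ haX)
        · exact absurd h4.1 (h ▸ hbX)
        · left; exact h
        · right; exact h
      · left
        refine ⟨⟨h4.1, ?_⟩, h4.2⟩
        by_contra h5
        exact h2 ⟨hbd w w' h5 h3.symm, hw⟩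
    · intro w w' h1 h2 h3
      have h4 := dist_adj_le S.hc v h3
      by_cases h5 : 2 ≤ G.dist v w' ∧ Anc par c w'
      · by_cases h6 : G.dist v w' = G.dist v w + 1
        · have hwv : w ≠ v := by rintro rfl; rw [SimpleGraph.dist_self] at h6; omega
          have hbc : Anc par c w := S.C_pred w w' h5.2 h3 h6.symm hwv
          have h7 : G.dist v w ≠ 1 := by
            intro h7
            apply h1
            rw [S.anc_one S.dc hbc h7]; right; left; rfl
          have h8 := S.hp.dist_pos hwv
          simp only [if_pos h5]
          rw [if_pos ⟨by omega, hbc⟩]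
          omega
        · simp only [if_pos h5]; omega
      · simp only [if_neg h5]; omega
    · simp
    · intro w hw
      have hpos := S.hp.dist_pos (hCv w hw)
      by_cases h1 : Anc par c w ∧ m ≤ G.dist v w
      · simp only [if_pos h1]
        rw [if_pos ⟨by omega, h1.1⟩]; omega
      · simp only [if_neg h1]; omega
    · intro t
      rcases lt_trichotomy (t + 1) m with ht | ht | ht
      · apply ncard_le_two_of (P := {x | Anc par x (Λ.τ i) ∧ G.dist v x = t + 1})
          (Q := {x | Anc par x q ∧ G.dist v x = t + 1}) _ (Layout.anc_subsingleton S.hp _ _)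
          (Layout.anc_subsingleton S.hp _ _)
        rintro w ⟨hw, hf⟩
        have hpos := S.hp.dist_pos (hCv w hw)
        have hd : G.dist v w = t + 1 := by
          split_ifs at hf <;> omega
        rcases hCs w hw with h | h | h
        · left; exact ⟨h.2, hd⟩
        · right; exact ⟨h.2, hd⟩
        · omega
      · apply ncard_le_two_of (P := {x | Anc par x (Λ.τ j) ∧ G.dist v x = t + 1})
          (Q := {x | Anc par x q ∧ G.dist v x = t + 1}) _ (Layout.anc_subsingleton S.hp _ _)
          (Layout.anc_subsingleton S.hp _ _)
        rintro w ⟨hw, hf⟩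
        have hpos := S.hp.dist_pos (hCv w hw)
        rcases hCs w hw with h | h | h
        · simp only [h.1, true_and] at hf
          split_ifs at hf <;> omega
        · simp only [hnuc w h.1, false_and, if_false] at hf
          right; exact ⟨h.2, by omega⟩
        · simp only [hnac w h.1, false_and, if_false] at hf
          left; exact ⟨h.2.1, by omega⟩
      · apply ncard_le_two_of (P := {x | Anc par x (Λ.τ i) ∧ G.dist v x = t})
          (Q := {x | Anc par x (Λ.τ j) ∧ G.dist v x = t + 1}) _ (Layout.anc_subsingleton S.hp _ _)
          (Layout.anc_subsingleton S.hp _ _)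
        rintro w ⟨hw, hf⟩
        have hpos := S.hp.dist_pos (hCv w hw)
        rcases hCs w hw with h | h | h
        · simp only [h.1, true_and] at hf
          left; refine ⟨h.2, ?_⟩
          split_ifs at hf <;> omega
        · simp only [hnuc w h.1, false_and, if_false] at hf
          have := S.anc_ge h.2
          omega
        · simp only [hnac w h.1, false_and, if_false] at hf
          right; exact ⟨h.2.1, by omega⟩
  have hadm : Λ.Adm (p + 1) r := by
    rw [hp, hr]; exact Λ.adm_edge e heT (by omega)
  have main2 : (Λ.In (p+1) r \ {v}).ncard ≤ sn G (fun _ => 2) v := by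
    apply hadm.simple S.hc S.hp _ (Or.inl rfl)
    apply ncard_le_two_of (P := {u}) (Q := {a}) _ Set.subsingleton_singleton
        Set.subsingleton_singleton
    rintro w ⟨hw, k, hk1, hk2, hk3⟩
    rcases S.nbr w hw with h | h | h | h
    · right; exact h
    · have := S.ord_bu k p (by omega) hpL (by rw [hk3, h]; exact Anc.refl _ _) hup
      omega
    · have := S.ord_cu k p (by omega) hpL (by rw [hk3, h]; exact Anc.refl _ _) hup
      omega
    · left; exact h
  have hsub : Λ.In i j \ {u, v} ⊆ (X \ {v}) ∪ (Λ.In (p+1) r \ {v}) := by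
    rintro w ⟨⟨k, h1, h2, h3⟩, h4⟩
    have hwv : w ≠ v := fun h => h4 (by simp [h])
    by_cases h5 : p + 1 ≤ k ∧ k ≤ r
    · right; exact ⟨⟨k, h5.1, h5.2, h3⟩, hwv⟩
    · left; exact ⟨⟨k, by omega, h3⟩, hwv⟩
  calc _ ≤ ((X \ {v}) ∪ (Λ.In (p+1) r \ {v})).ncard := Set.ncard_le_ncard hsub (Set.toFinite _)
    _ ≤ _ := Set.ncard_union_le _ _
    _ ≤ _ := by omega

theorem F_down (S : PairSetup Λ a b c u FC) {y : V} (hy : FC y) : ∀ w, Anc par y w → FC w := by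
  intro w
  refine S.hp.induct (P := fun w => Anc par y w → FC w) ?_ ?_ w
  · intro h; rw [← S.hp.anc_root h]; exact hy
  · intro w hw ih h
    rcases h.cases with h1 | h1
    · rw [← h1]; exact hy
    · exact S.F_up (par w) w (ih h1) (S.hp.adj w hw) (S.hp.dist w hw) ((S.F_a y hy).trans h)

theorem optN_min (S : PairSetup Λ a b c u FC) {i j : ℕ} (ha : Λ.Adm i j) (hi : Anc par c (Λ.τ i))
    (hj : Anc par a (Λ.τ j)) (hF : ∀ x, FC x → ¬ Anc par x (Λ.τ j))
    (hmin : ∀ i' j', i < i' → j' ≤ j → Λ.Adm i' j' → Anc par c (Λ.τ i') → Anc par a (Λ.τ j') →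
      (∀ x, FC x → ¬ Anc par x (Λ.τ j')) → False) :
    (Λ.Out i j \ {v}).ncard ≤ sn G (fun _ => 2) u := by
  classical
  have hiL : i ≤ Λ.L := ha.1.trans ha.2.1
  have hbIn : ∀ w, Anc par b w → w ∉ Λ.In i j := by
    rintro w hw ⟨k, h1, h2, rfl⟩
    have := S.ord_bc k i (h2.trans ha.2.1) hiL hw hi
    omega
  have hcI : c ∈ Λ.In i j ∧ c ∈ Λ.Out i j := by
    obtain ⟨⟨k1, h1, h2⟩, ⟨k2, h3, h4, h5⟩⟩ := Λ.corner_bounds S.hp hiL hi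
    refine ⟨⟨k2, h3, ?_, h5⟩, ⟨k1, by omega, Or.inl h1, h2⟩⟩
    exact (S.ord_ca k2 j h4 ha.2.1 (by rw [h5]; exact Anc.refl _ _) hj).le
  have haI : a ∈ Λ.In i j ∧ a ∈ Λ.Out i j := by
    obtain ⟨⟨k1, h1, h2⟩, ⟨k2, h3, h4, h5⟩⟩ := Λ.corner_bounds S.hp ha.2.1 hj
    refine ⟨⟨k1, ?_, h1, h2⟩, ⟨k2, h4, Or.inr h3, h5⟩⟩
    exact (S.ord_ca i k1 hiL (h1.trans ha.2.1) hi (by rw [h2]; exact Anc.refl _ _)).le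
  have huO : u ∉ Λ.Out i j := by
    rintro ⟨k, h1, h2, h3⟩
    have h4 : Anc par u (Λ.τ k) := h3 ▸ Anc.refl _ _
    have h5 := S.ord_cu i k hiL h1 hi h4
    have h6 := S.ord_ua k j h1 ha.2.1 h4 hj
    omega
  set C : Set V := ((Λ.In i j ∩ Λ.Out i j) \ {v}) ∪ {b} with hC
  have hCv : ∀ w ∈ C, w ≠ v := by
    rintro w (h | h)
    · exact h.2
    · rw [Set.mem_singleton_iff.1 h]; exact S.vb.ne'
  have hnac : ∀ w, Anc par a w → ¬ Anc par c w := fun w h1 h2 => S.excl S.da S.dc S.ac h1 h2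
  have hnau : ∀ w, Anc par a w → ¬ Anc par u w := fun w h1 h2 => S.excl S.da S.du S.au h1 h2
  have hncu : ∀ w, Anc par c w → ¬ Anc par u w := fun w h1 h2 => S.excl S.dc S.du S.cu h1 h2
  have hbc : ¬ Anc par c b := fun h => S.excl S.dc S.db S.bc.symm h (Anc.refl _ _)
  have hbu : ¬ Anc par u b := fun h => S.excl S.du S.db S.bu.symm h (Anc.refl _ _)
  have hFb : ¬ FC b := fun h => S.excl S.da S.db S.ab (S.F_a b h) (Anc.refl _ _)
  have hCs : ∀ w ∈ C, w = b ∨ (Anc par c w ∧ Anc par w (Λ.τ i)) ∨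
      (Anc par a w ∧ Anc par w (Λ.τ j) ∧ ¬ FC w) := by
    rintro w (h | h)
    · right
      have hpos := S.hp.dist_pos h.2
      rcases ha.wall S.hp h.1.1 h.1.2 with h1 | h1
      · left; exact ⟨S.hp.anc_total hi h1 (by rw [S.dc]; omega), h1⟩
      · right; exact ⟨S.hp.anc_total hj h1 (by rw [S.da]; omega), h1, fun h2 => hF w h2 h1⟩
    · left; exact h
  set hh : V → ℕ := fun w => if w = v then 1 else if Anc par u w then G.dist v w - 1 else
      if Anc par c w ∨ FC w then G.dist v w else G.dist v w + 1 with hhh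
  have hle : ∀ w, w ≠ v → hh w ≤ G.dist v w + 1 := by
    intro w hw
    simp only [hhh, if_neg hw]
    split_ifs <;> omega
  apply sn_ge_sub G u C (Λ.Out i j \ {v})
    (fun w => if w = b then 0 else if Anc par c w then G.dist v w - 1 else G.dist v w) hh
    (Λ.Out i j \ {v})
  · exact Set.subset_union_left
  · rintro (h | h)
    · exact huO h.1.2
    · exact S.bu (Set.mem_singleton_iff.1 h).symm
  · intro h; exact huO h.1
  · intro w w' h1 h2 h3 h4
    have h4v : w' ≠ v := h4.2
    by_cases hw : w = v
    · subst hw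
      rcases S.nbr w' h3 with h | h | h | h
      · left; subst h; exact ⟨haI, h4v⟩
      · right; exact h
      · left; subst h; exact ⟨hcI, h4v⟩
      · exact absurd h4.1 (h ▸ huO)
    · have hwX : w ∉ Λ.Out i j := fun h => h2 ⟨h, hw⟩
      left
      exact ⟨⟨ha.in_of_adj h3 hwX, h4.1⟩, h4v⟩
  · intro w w' h1 h2 h3
    have h4 := dist_adj_le S.hc v h3
    have h4' := dist_adj_le S.hc v h3.symm
    by_cases hw'v : w' = v
    · simp [hhh, hw'v]
    by_cases hwv : w = v
    · subst hwv
      have h5 : hh w = 1 := by simp [hhh]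
      have h6 := hle w' hw'v
      have h7 := SimpleGraph.dist_eq_one_iff_adj.2 h3
      omega
    have hwX : w ∉ Λ.Out i j := fun h => h2 ⟨h, hwv⟩
    have hwI : w ∈ Λ.In i j := (Λ.in_union_out S.hp w).resolve_right hwX
    have hw'I : w' ∈ Λ.In i j := ha.in_of_adj h3 hwX
    have hpos := S.hp.dist_pos hwv
    have hpos' := S.hp.dist_pos hw'v
    have h6 := hle w' hw'v
    by_cases hdle : G.dist v w' < G.dist v w
    · have : G.dist v w - 1 ≤ hh w := by
        simp only [hhh, if_neg hwv]; split_ifs <;> omega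
      omega
    have hA' : ¬ Anc par u w' → ¬ Anc par c w' → Anc par a w' := by
      intro h7 h8
      rcases S.top w' hw'v with h | h | h | h
      · exact h
      · exact absurd hw'I (hbIn w' h)
      · exact absurd h h8
      · exact absurd h h7
    by_cases hu' : Anc par u w'
    · have e1 : hh w' = G.dist v w' - 1 := by simp only [hhh, if_neg hw'v, if_pos hu']
      have : G.dist v w - 1 ≤ hh w := by
        simp only [hhh, if_neg hwv]; split_ifs <;> omega
      omega
    by_cases hu : Anc par u w
    · have e1 : hh w = G.dist v w - 1 := by simp only [hhh, if_neg hwv, if_pos hu]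
      have hd : G.dist v w' = G.dist v w := by
        by_contra hd
        exact hu' (S.U_up w w' hu h3 (by omega))
      have e2 : Anc par c w' ∨ FC w' := by
        by_cases h7 : Anc par c w'
        · exact Or.inl h7
        · right; exact S.tied_F w' w (hA' hu' h7) hu hd.symm h3.symm
      have e3 : hh w' = G.dist v w' := by simp only [hhh, if_neg hw'v, if_neg hu', if_pos e2]
      omega
    by_cases hcf : Anc par c w ∨ FC w
    · have e1 : hh w = G.dist v w := by simp only [hhh, if_neg hwv, if_neg hu, if_pos hcf]
      by_cases hcf' : Anc par c w' ∨ FC w'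
      · have e3 : hh w' = G.dist v w' := by simp only [hhh, if_neg hw'v, if_neg hu', if_pos hcf']
        omega
      · by_cases hd : G.dist v w' = G.dist v w + 1
        · exfalso
          have hc' : ¬ Anc par c w' := fun h => hcf' (Or.inl h)
          have hf' : ¬ FC w' := fun h => hcf' (Or.inr h)
          have ha' := hA' hu' hc'
          rcases hcf with hcw | hfw
          · let e : G.Dart := ⟨(w, w'), h3⟩
            have heT : ¬ isT par e := by
              rintro (h | h)
              · have h1 : par w' = w := h
                exact hc' (Anc.step (h1 ▸ hcw))
              · have h1 : par w = w' := h
                have := S.hp.dist w hwv; rw [h1] at this; omega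
            have h10 := Λ.idx_lt e
            have h11 : ¬ (Λ.idx e ≤ i ∨ j ≤ Λ.idx e) := fun h => hwX ⟨_, h10.le, h, Λ.τ_idx e⟩
            have h12 := ha.2.2 e heT (by omega) (by omega)
            have h13 : Λ.idx e < Λ.idx e.symm := by
              apply S.ord_ca _ _ h10.le (Λ.idx_lt _).le
              · rw [Λ.τ_idx]; exact hcw
              · rw [Λ.τ_idx]; exact ha'
            apply hmin (Λ.idx e + 1) (Λ.idx e.symm) (by omega) (by omega) (Λ.adm_edge e heT h13)
            · rw [Λ.τ_idx_succ_non e heT]; exact hcw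
            · rw [Λ.τ_idx]; exact ha'
            · intro x hx
              rw [Λ.τ_idx]
              intro h; exact hf' (S.F_down hx w' h)
          · exact hf' (S.F_up w w' hfw h3 hd.symm ha')
        · omega
    · have e1 : hh w = G.dist v w + 1 := by simp only [hhh, if_neg hwv, if_neg hu, if_neg hcf]
      omega
  · simp [hhh, S.vu.ne', Anc.refl, S.du]
  · intro w hw
    have hwv := hCv w hw
    have hpos := S.hp.dist_pos hwv
    rcases hCs w hw with h | h | h
    · subst h; simp [hhh, hwv, hbu, hbc, hFb]
    · simp only [hhh, if_neg hwv, if_neg (hncu w h.1), h.1, true_or, if_true]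
      split_ifs <;> omega
    · simp only [hhh, if_neg hwv, if_neg (hnau w h.1), hnac w h.1, h.2.2, or_self, if_false]
      split_ifs <;> omega
  · intro t
    by_cases ht0 : t = 0
    · apply ncard_le_two_of (P := {b}) (Q := {c}) _ Set.subsingleton_singleton
        Set.subsingleton_singleton
      rintro w ⟨hw, hf⟩
      have hpos := S.hp.dist_pos (hCv w hw)
      by_cases hwb : w = b
      · left; exact hwb
      right
      rw [if_neg hwb] at hf
      split_ifs at hf with h
      · exact S.anc_one S.dc h (by omega)
      · omega
    · apply ncard_le_two_of (P := {x | Anc par x (Λ.τ i) ∧ G.dist v x = t + 1})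
          (Q := {x | Anc par x (Λ.τ j) ∧ G.dist v x = t}) _ (Layout.anc_subsingleton S.hp _ _)
          (Layout.anc_subsingleton S.hp _ _)
      rintro w ⟨hw, hf⟩
      have hpos := S.hp.dist_pos (hCv w hw)
      rcases hCs w hw with h | h | h
      · rw [if_pos h] at hf; omega
      · have : w ≠ b := fun h' => hbc (h' ▸ h.1)
        rw [if_neg this, if_pos h.1] at hf
        left; exact ⟨h.2, by omega⟩
      · have : w ≠ b := fun h' => S.excl S.da S.db S.ab h.1 (h' ▸ Anc.refl _ _)
        rw [if_neg this, if_neg (hnac w h.1)] at hf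
        right; exact ⟨h.2.1, hf⟩

theorem optN (S : PairSetup Λ a b c u FC) {i j : ℕ} (ha : Λ.Adm i j) (hi : Anc par c (Λ.τ i))
    (hj : Anc par a (Λ.τ j)) (hF : ∀ x, FC x → ¬ Anc par x (Λ.τ j)) :
    (Λ.Out i j \ {u, v}).ncard ≤ sn G (fun _ => 2) u := by
  have key : ∀ n i' j', j' - i' ≤ n → i ≤ i' → j' ≤ j → Λ.Adm i' j' → Anc par c (Λ.τ i') →
      Anc par a (Λ.τ j') → (∀ x, FC x → ¬ Anc par x (Λ.τ j')) →
      (Λ.Out i j \ {u, v}).ncard ≤ sn G (fun _ => 2) u := by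
    intro n
    induction n with
    | zero =>
      intro i' j' h1 h2 h3 h4 h5 h6 h7
      have := S.ord_ca i' j' (h4.1.trans h4.2.1) h4.2.1 h5 h6
      omega
    | succ n ih =>
      intro i' j' h1 h2 h3 h4 h5 h6 h7
      by_cases hex : ∃ i'' j'', i' < i'' ∧ j'' ≤ j' ∧ Λ.Adm i'' j'' ∧ Anc par c (Λ.τ i'') ∧
          Anc par a (Λ.τ j'') ∧ (∀ x, FC x → ¬ Anc par x (Λ.τ j''))
      · obtain ⟨i'', j'', g1, g2, g3, g4, g5, g6⟩ := hex
        have := S.ord_ca i' j' (h4.1.trans h4.2.1) h4.2.1 h5 h6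
        exact ih i'' j'' (by omega) (by omega) (by omega) g3 g4 g5 g6
      · have h8 := S.optN_min h4 h5 h6 h7 (fun i'' j'' g1 g2 g3 g4 g5 g6 =>
          hex ⟨i'', j'', g1, g2, g3, g4, g5, g6⟩)
        refine le_trans (Set.ncard_le_ncard ?_ (Set.toFinite _)) h8
        rintro w ⟨⟨k, g1, g2, g3⟩, g4⟩
        refine ⟨⟨k, g1, by omega, g3⟩, fun h => g4 (by simp [Set.mem_singleton_iff.1 h])⟩
  exact key _ i j le_rfl le_rfl le_rfl ha hi hj hF

theorem pair_good (S : PairSetup Λ a b c u FC) {i j : ℕ} (ha : Λ.Adm i j) :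
    (Λ.In i j \ {u, v}).ncard ≤ 2 * sn G (fun _ => 2) v ∨
    (Λ.Out i j \ {u, v}).ncard ≤ max (sn G (fun _ => 2) v) (sn G (fun _ => 2) u) := by
  have hiL : i ≤ Λ.L := ha.1.trans ha.2.1
  have hjL := ha.2.1
  have hsub : ∀ X : Set V, (X \ {u, v}).ncard ≤ (X \ {v}).ncard := by
    intro X
    apply Set.ncard_le_ncard _ (Set.toFinite _)
    rintro w ⟨h1, h2⟩
    exact ⟨h1, fun h => h2 (by simp [Set.mem_singleton_iff.1 h])⟩
  by_cases hN1 : (G.neighborSet v ∩ Λ.In i j).ncard ≤ 2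
  · left
    have h1 := ha.simple S.hc S.hp _ (Or.inl rfl) hN1
    have h2 := hsub (Λ.In i j)
    omega
  by_cases hN2 : (G.neighborSet v ∩ Λ.Out i j).ncard ≤ 2
  · right
    have h1 := ha.simple S.hc S.hp _ (Or.inr rfl) hN2
    exact le_max_of_le_left ((hsub _).trans h1)
  have hNcard : (G.neighborSet v).ncard ≤ 4 := by
    have h1 : G.neighborSet v ⊆ {a, b, c, u} := fun w hw => by
      rcases S.nbr w hw with h | h | h | h <;> simp [h]
    refine (Set.ncard_le_ncard h1 (Set.toFinite _)).trans ?_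
    refine (Set.ncard_insert_le _ _).trans (Nat.succ_le_succ ?_)
    refine (Set.ncard_insert_le _ _).trans (Nat.succ_le_succ ?_)
    refine (Set.ncard_insert_le _ _).trans (Nat.succ_le_succ ?_)
    simp
  have hI := Set.ncard_union_add_ncard_inter (G.neighborSet v ∩ Λ.In i j) (G.neighborSet v ∩ Λ.Out i j)
    (Set.toFinite _) (Set.toFinite _)
  have hU : ((G.neighborSet v ∩ Λ.In i j) ∪ (G.neighborSet v ∩ Λ.Out i j)).ncard ≤ 4 := by
    refine (Set.ncard_le_ncard ?_ (Set.toFinite _)).trans hNcard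
    rintro w (h | h)
    · exact h.1
    · exact h.1
  have h2 : 1 < ((G.neighborSet v ∩ Λ.In i j) ∩ (G.neighborSet v ∩ Λ.Out i j)).ncard := by omega
  obtain ⟨x, hx, y, hy, hxy⟩ := (Set.one_lt_ncard (Set.toFinite _)).1 h2
  have dx := SimpleGraph.dist_eq_one_iff_adj.2 hx.1.1
  have dy := SimpleGraph.dist_eq_one_iff_adj.2 hy.1.1
  have hW : ∃ x y, x ≠ y ∧ G.Adj v x ∧ G.Adj v y ∧ Anc par x (Λ.τ i) ∧ Anc par y (Λ.τ j) := by
    rcases ha.wall S.hp hx.1.2 hx.2.2 with h | h <;> rcases ha.wall S.hp hy.1.2 hy.2.2 with h' | h'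
    · exact absurd (S.hp.anc_unique h h' (dx.trans dy.symm)) hxy
    · exact ⟨x, y, hxy, hx.1.1, hy.1.1, h, h'⟩
    · exact ⟨y, x, hxy.symm, hy.1.1, hx.1.1, h', h⟩
    · exact absurd (S.hp.anc_unique h h' (dx.trans dy.symm)) hxy
  clear hx hy hxy dx dy h2 x y
  obtain ⟨x, y, hxy, hvx, hvy, hx, hy⟩ := hW
  have two : ∀ (X : Set V) (s t : V), (∀ w, G.Adj v w → w ∈ X → w = s ∨ w = t) →
      (G.neighborSet v ∩ X).ncard ≤ 2 := by
    intro X s t h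
    apply ncard_le_two_of (P := {s}) (Q := {t}) _ Set.subsingleton_singleton
        Set.subsingleton_singleton
    rintro w ⟨h1, h2⟩
    exact h w h1 h2
  have hij := ha.1
  have R : ∀ w, Anc par w w := Anc.refl par
  rcases S.nbr x hvx with rfl | rfl | rfl | rfl <;> rcases S.nbr y hvy with rfl | rfl | rfl | rfl
  · exact absurd rfl hxy
  · have := S.ord_ba j i hjL hiL hy hx; omega
  · have := S.ord_ca j i hjL hiL hy hx; omega
  · have := S.ord_ua j i hjL hiL hy hx; omega
  · -- (b,a)
    exfalso; apply hN2
    apply two _ x y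
    rintro w hw ⟨k, h1, h2, rfl⟩
    rcases S.nbr _ hw with h | h | h | h
    · right; exact h
    · left; exact h
    · have e1 := S.ord_bc i k hiL h1 hx (h ▸ R _)
      have e2 := S.ord_ca k j h1 hjL (h ▸ R _) hy
      omega
    · have e1 := S.ord_bu i k hiL h1 hx (h ▸ R _)
      have e2 := S.ord_ua k j h1 hjL (h ▸ R _) hy
      omega
  · exact absurd rfl hxy
  · -- (b,c)
    exfalso; apply hN1
    apply two _ x y
    rintro w hw ⟨k, h1, h2, rfl⟩
    rcases S.nbr _ hw with h | h | h | h
    · have e2 := S.ord_ca j k hjL (by omega) hy (h ▸ R _)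
      omega
    · left; exact h
    · right; exact h
    · have e2 := S.ord_cu j k hjL (by omega) hy (h ▸ R _)
      omega
  · -- (b,u)
    by_cases hdeg : ((G.neighborSet y ∩ Λ.In i j) \ {v, x, c}).ncard ≤ 2
    · left
      have := S.optR ha hx hy hdeg
      omega
    · right
      exact le_max_of_le_left (S.optL ha hx hy hdeg)
  · -- (c,a)
    by_cases hau : G.Adj y u
    · left
      have := S.optT ha hx hy hau
      omega
    · by_cases hF : ∃ z, FC z ∧ Anc par z (Λ.τ j)
      · left; exact S.optF ha hx hy hau hF
      · right
        push Not at hF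
        exact le_max_of_le_right (S.optN ha hx hy hF)
  · have := S.ord_bc j i hjL hiL hy hx; omega
  · exact absurd rfl hxy
  · -- (c,u)
    exfalso; apply hN1
    apply two _ x y
    rintro w hw ⟨k, h1, h2, rfl⟩
    rcases S.nbr _ hw with h | h | h | h
    · have e2 := S.ord_ua j k hjL (by omega) hy (h ▸ R _)
      omega
    · have e2 := S.ord_bc k i (by omega) hiL (h ▸ R _) hx
      omega
    · left; exact h
    · right; exact h
  · -- (u,a)
    exfalso; apply hN1
    apply two _ x y
    rintro w hw ⟨k, h1, h2, rfl⟩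
    rcases S.nbr _ hw with h | h | h | h
    · right; exact h
    · have e2 := S.ord_bu k i (by omega) hiL (h ▸ R _) hx
      omega
    · have e2 := S.ord_cu k i (by omega) hiL (h ▸ R _) hx
      omega
    · left; exact h
  · have := S.ord_bu j i hjL hiL hy hx; omega
  · have := S.ord_cu j i hjL hiL hy hx; omega
  · exact absurd rfl hxy

theorem pair_lemma (S : PairSetup Λ a b c u FC) (hn : 3 ≤ Fintype.card V) :
    Fintype.card V ≤ 4 * sn G (fun _ => 2) v +
      max (sn G (fun _ => 2) v) (sn G (fun _ => 2) u) + 2 := by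
  have htwo := sn_two G v hn
  have hcount : (Set.univ \ {u, v} : Set V).ncard + 2 = Fintype.card V := by
    have h1 := Set.ncard_sdiff_add_ncard_of_subset (Set.subset_univ ({u, v} : Set V))
      (Set.toFinite _)
    rw [Set.ncard_pair S.vu.ne', Set.ncard_univ, Nat.card_eq_fintype_card] at h1
    exact h1
  by_cases hfull : (Λ.In 0 Λ.L \ {u, v}).ncard ≤ 2 * sn G (fun _ => 2) v
  · rw [Λ.in_full S.hp] at hfull
    omega
  · obtain ⟨i, j, ha, hnP, hij, hcase⟩ := Λ.minimal_adm
      (fun i j => (Λ.In i j \ {u, v}).ncard ≤ 2 * sn G (fun _ => 2) v) hfull (by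
        intro i hi
        have h1 : Λ.In i i \ {u, v} ⊆ {Λ.τ i} := by
          rintro w ⟨⟨k, h1, h2, h3⟩, _⟩
          have : k = i := by omega
          rw [← h3, this]; rfl
        have h2 := Set.ncard_le_ncard h1 (Set.toFinite _)
        rw [Set.ncard_singleton] at h2
        omega)
    have hout := (S.pair_good ha).resolve_left hnP
    rcases hcase with ⟨_, _, h1⟩ | ⟨_, l, h1, h2, _, _, h3, _, h4⟩
    · have hs : (Set.univ \ {u, v} : Set V) ⊆ (Λ.Out i j \ {u, v}) ∪ (Λ.In (i+1) j \ {u, v}) := by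
        rintro w ⟨_, hw⟩
        rcases Λ.cover_tree S.hp (i := i) (j := j) w with h | h
        · left; exact ⟨h, hw⟩
        · right; exact ⟨h, hw⟩
      have := (Set.ncard_le_ncard hs (Set.toFinite _)).trans (Set.ncard_union_le _ _)
      omega
    · have hs : (Set.univ \ {u, v} : Set V) ⊆ (Λ.Out i j \ {u, v}) ∪ ((Λ.In (i+1) l \ {u, v}) ∪
          (Λ.In (l+1) j \ {u, v})) := by
        rintro w ⟨_, hw⟩
        rcases Λ.cover_non S.hp h1 h2 w with h | h | h
        · left; exact ⟨h, hw⟩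
        · right; left; exact ⟨h, hw⟩
        · right; right; exact ⟨h, hw⟩
      have e1 := (Set.ncard_le_ncard hs (Set.toFinite _)).trans (Set.ncard_union_le _ _)
      have e2 := Set.ncard_union_le (Λ.In (i+1) l \ {u, v}) (Λ.In (l+1) j \ {u, v})
      omega

end PairSetup

end PartE2

end

section

set_option linter.unusedSectionVars false
set_option linter.unusedVariables false
set_option linter.unusedSimpArgs false

section PartE3

variable {V : Type} [Fintype V] [DecidableEq V]

/-- orbit of length four -/
theorem orbit_four {G : SimpleGraph V} [DecidableRel G.Adj] (R : Rot G) (d : G.Dart)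
    (h4 : (G.neighborSet d.fst).ncard = 4) :
    R.σ (R.σ (R.σ (R.σ d))) = d ∧ R.σ d ≠ d ∧ R.σ (R.σ d) ≠ d ∧ R.σ (R.σ (R.σ d)) ≠ d ∧
    ∀ e : G.Dart, e.fst = d.fst → e = d ∨ e = R.σ d ∨ e = R.σ (R.σ d) ∨ e = R.σ (R.σ (R.σ d)) := by
  classical
  set p := Function.minimalPeriod R.σ d with hp
  have hper : 0 < p := by
    apply Function.minimalPeriod_pos_of_mem_periodicPts
    rw [Function.mem_periodicPts]
    refine ⟨orderOf R.σ, orderOf_pos _, ?_⟩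
    rw [Function.IsPeriodicPt, Function.IsFixedPt, ← Equiv.Perm.coe_pow, pow_orderOf_eq_one]; rfl
  have hS : (Finset.univ.filter fun e : G.Dart => e.fst = d.fst) =
      (Finset.range p).image (fun k => (R.σ)^[k] d) := by
    ext e
    simp only [Finset.mem_filter, Finset.mem_univ, true_and, Finset.mem_image, Finset.mem_range]
    constructor
    · intro h
      obtain ⟨k, _, hk⟩ := (R.cyc d e h.symm).exists_pow_eq'
      refine ⟨k % p, Nat.mod_lt _ hper, ?_⟩
      rw [Function.iterate_mod_minimalPeriod_eq, ← hk, Equiv.Perm.coe_pow]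
    · rintro ⟨k, _, rfl⟩
      clear * -
      induction k with
      | zero => rfl
      | succ k ih => rw [Function.iterate_succ_apply', R.fst, ih]
  have hcard : (Finset.univ.filter fun e : G.Dart => e.fst = d.fst).card = 4 := by
    rw [G.dart_fst_fiber_card_eq_degree d.fst, ← h4, ← SimpleGraph.card_neighborSet_eq_degree,
      ← Nat.card_coe_set_eq, Nat.card_eq_fintype_card]
  have hinj : Set.InjOn (fun k => (R.σ)^[k] d) (Finset.range p) := by
    intro x hx y hy hxy
    exact Function.iterate_injOn_Iio_minimalPeriod (by simpa using hx) (by simpa using hy) hxy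
  have hp4 : p = 4 := by
    rw [hS, Finset.card_image_of_injOn hinj, Finset.card_range] at hcard
    exact hcard
  have hne : ∀ k, 0 < k → k < 4 → (R.σ)^[k] d ≠ d := by
    intro k h1 h2 h
    have := hinj (x₁ := k) (x₂ := 0) (by simp; omega) (by simp; omega) (by simpa using h)
    omega
  refine ⟨?_, hne 1 (by omega) (by omega), hne 2 (by omega) (by omega), hne 3 (by omega) (by omega), ?_⟩
  · have := Function.iterate_minimalPeriod (f := R.σ) (x := d)
    rw [← hp, hp4] at this
    exact this
  · intro e he
    have : e ∈ (Finset.range p).image (fun k => (R.σ)^[k] d) := by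
      rw [← hS]; simp [he]
    simp only [Finset.mem_image, Finset.mem_range] at this
    obtain ⟨k, hk, rfl⟩ := this
    have : k = 0 ∨ k = 1 ∨ k = 2 ∨ k = 3 := by omega
    rcases this with rfl | rfl | rfl | rfl
    · exact Or.inl rfl
    · exact Or.inr (Or.inl rfl)
    · exact Or.inr (Or.inr (Or.inl rfl))
    · exact Or.inr (Or.inr (Or.inr rfl))

/-- BFS step -/
def Prd (G : SimpleGraph V) (v : V) (p w : V) : Prop := G.Adj p w ∧ G.dist v p + 1 = G.dist v w

def Rch (G : SimpleGraph V) (v : V) : V → V → Prop := Relation.ReflTransGen (Prd G v)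

theorem Rch.dist_le {G : SimpleGraph V} {v x w : V} (h : Rch G v x w) :
    G.dist v x ≤ G.dist v w := by
  induction h with
  | refl => exact le_rfl
  | tail _ h ih => have := h.2; omega

def Acl (G : SimpleGraph V) (v a u w : V) : Prop := ¬ Rch G v u w ∧ Rch G v a w
def Bcl (G : SimpleGraph V) (v a b u w : V) : Prop :=
  ¬ Rch G v u w ∧ ¬ Rch G v a w ∧ Rch G v b w
def Ccl (G : SimpleGraph V) (v a b u w : V) : Prop :=
  w ≠ v ∧ ¬ Rch G v u w ∧ ¬ Rch G v a w ∧ ¬ Rch G v b w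
def Tied (G : SimpleGraph V) (v u f : V) : Prop :=
  ∃ q, Rch G v u q ∧ G.dist v q = G.dist v f ∧ G.Adj f q
def Fcl (G : SimpleGraph V) (v a u w : V) : Prop :=
  Acl G v a u w ∧ ∃ f, Acl G v a u f ∧ Tied G v u f ∧ Rch G v f w

theorem exists_good_par {G : SimpleGraph V} (hc : G.Connected) (v a b u : V) :
    ∃ par, IsPar G v par ∧ ∀ w, w ≠ v →
      ((∃ q, Prd G v q w ∧ Rch G v u q) → Rch G v u (par w)) ∧
      ((∃ q, Prd G v q w ∧ Fcl G v a u q) → Rch G v u (par w) ∨ Fcl G v a u (par w)) ∧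
      ((∃ q, Prd G v q w ∧ Acl G v a u q) → Rch G v u (par w) ∨ Acl G v a u (par w)) ∧
      ((∃ q, Prd G v q w ∧ Bcl G v a b u q) → Rch G v u (par w) ∨ Acl G v a u (par w) ∨
        Bcl G v a b u (par w)) := by
  have key : ∀ w, w ≠ v → ∃ p, Prd G v p w ∧
      ((∃ q, Prd G v q w ∧ Rch G v u q) → Rch G v u p) ∧
      ((∃ q, Prd G v q w ∧ Fcl G v a u q) → Rch G v u p ∨ Fcl G v a u p) ∧
      ((∃ q, Prd G v q w ∧ Acl G v a u q) → Rch G v u p ∨ Acl G v a u p) ∧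
      ((∃ q, Prd G v q w ∧ Bcl G v a b u q) → Rch G v u p ∨ Acl G v a u p ∨
        Bcl G v a b u p) := by
    intro w hw
    by_cases h1 : ∃ q, Prd G v q w ∧ Rch G v u q
    · obtain ⟨q, h, h'⟩ := h1
      exact ⟨q, h, fun _ => h', fun _ => Or.inl h', fun _ => Or.inl h', fun _ => Or.inl h'⟩
    by_cases h2 : ∃ q, Prd G v q w ∧ Fcl G v a u q
    · obtain ⟨q, h, h'⟩ := h2
      exact ⟨q, h, fun h => absurd h h1, fun _ => Or.inr h', fun _ => Or.inr h'.1,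
        fun _ => Or.inr (Or.inl h'.1)⟩
    by_cases h3 : ∃ q, Prd G v q w ∧ Acl G v a u q
    · obtain ⟨q, h, h'⟩ := h3
      exact ⟨q, h, fun h => absurd h h1, fun h => absurd h h2, fun _ => Or.inr h',
        fun _ => Or.inr (Or.inl h')⟩
    by_cases h4 : ∃ q, Prd G v q w ∧ Bcl G v a b u q
    · obtain ⟨q, h, h'⟩ := h4
      exact ⟨q, h, fun h => absurd h h1, fun h => absurd h h2, fun h => absurd h h3,
        fun _ => Or.inr (Or.inr h')⟩
    obtain ⟨p, hp1, hp2⟩ := exists_pred hc v w hw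
    exact ⟨p, ⟨hp1, hp2⟩, fun h => absurd h h1, fun h => absurd h h2, fun h => absurd h h3,
      fun h => absurd h h4⟩
  choose! f hf using key
  classical
  refine ⟨fun w => if w = v then v else f w, ⟨by simp, ?_, ?_⟩, ?_⟩
  · intro w hw
    simp only [if_neg hw]; exact (hf w hw).1.1
  · intro w hw
    simp only [if_neg hw]; exact (hf w hw).1.2
  · intro w hw
    simp only [if_neg hw]; exact (hf w hw).2

theorem Rch.last {G : SimpleGraph V} {v x w : V} (h : Rch G v x w) (hne : x ≠ w) :
    ∃ p, Prd G v p w ∧ Rch G v x p := by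
  rcases Relation.ReflTransGen.cases_tail h with h | ⟨p, h1, h2⟩
  · exact absurd h.symm hne
  · exact ⟨p, h2, h1⟩

theorem Rch.up {G : SimpleGraph V} {v x p w : V} (h : Rch G v x p) (h' : Prd G v p w) :
    Rch G v x w := Relation.ReflTransGen.tail h h'

theorem pair_core {G : SimpleGraph V} [DecidableRel G.Adj] (hc : G.Connected) (R : Rot G) (v u : V)
    (hvu : G.Adj v u) (h4 : (G.neighborSet v).ncard = 4) (hu4 : (G.neighborSet u).ncard ≤ 4)
    (hac : G.Adj (R.σ ⟨(v, u), hvu⟩).snd u → G.Adj (R.σ⁻¹ ⟨(v, u), hvu⟩).snd u) :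
    Fintype.card V ≤ 4 * sn G (fun _ => 2) v +
      max (sn G (fun _ => 2) v) (sn G (fun _ => 2) u) + 2 := by
  classical
  have hn : 3 ≤ Fintype.card V := by
    have := Set.ncard_le_card (G.neighborSet v)
    rw [Nat.card_eq_fintype_card] at this
    omega
  obtain ⟨du, hdu⟩ : ∃ du : G.Dart, du = ⟨(v, u), hvu⟩ := ⟨_, rfl⟩
  rw [← hdu] at hac
  have du1 : du.fst = v := by rw [hdu]
  have du2 : du.snd = u := by rw [hdu]
  obtain ⟨o1, o2, o3, o4, o5⟩ := orbit_four R du (by rw [du1]; exact h4)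
  have hinv : R.σ⁻¹ du = R.σ (R.σ (R.σ du)) := by
    rw [Equiv.Perm.inv_eq_iff_eq]; exact o1.symm
  rw [hinv] at hac
  obtain ⟨da, hda⟩ : ∃ d, d = R.σ du := ⟨_, rfl⟩
  obtain ⟨db, hdb⟩ : ∃ d, d = R.σ da := ⟨_, rfl⟩
  obtain ⟨dc, hdc⟩ : ∃ d, d = R.σ db := ⟨_, rfl⟩
  rw [← hda] at hac o1 o2 o3 o4 o5
  rw [← hdb] at hac o1 o3 o4 o5
  rw [← hdc] at hac o1 o4 o5
  have da1 : da.fst = v := by rw [hda, R.fst, du1]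
  have db1 : db.fst = v := by rw [hdb, R.fst, da1]
  have dc1 : dc.fst = v := by rw [hdc, R.fst, db1]
  have hab : da ≠ db := fun h => o2 (by rw [hda, hdb] at h; exact (R.σ.injective h).symm)
  have hbc : db ≠ dc := fun h => hab (by rw [hdb, hdc] at h; exact (R.σ.injective h))
  have hac' : da ≠ dc := fun h => o3 (by rw [hda, hdc] at h; exact (R.σ.injective h).symm)
  obtain ⟨a, haa⟩ : ∃ a, a = da.snd := ⟨_, rfl⟩
  obtain ⟨b, hbb⟩ : ∃ b, b = db.snd := ⟨_, rfl⟩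
  obtain ⟨c, hcc⟩ : ∃ c, c = dc.snd := ⟨_, rfl⟩
  have va : G.Adj v a := by rw [haa, ← da1]; exact da.adj
  have vb : G.Adj v b := by rw [hbb, ← db1]; exact db.adj
  have vc : G.Adj v c := by rw [hcc, ← dc1]; exact dc.adj
  have nbr : ∀ w, G.Adj v w → w = a ∨ w = b ∨ w = c ∨ w = u := by
    intro w hw
    rcases o5 ⟨(v, w), hw⟩ du1.symm with h | h | h | h
    · right; right; right; rw [← du2, ← h]
    · left; rw [haa, ← h]
    · right; left; rw [hbb, ← h]
    · right; right; left; rw [hcc, ← h]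
  have ab : a ≠ b := fun h => hab (Dart_ext' (da1.trans db1.symm) (by rw [← haa, ← hbb, h]))
  have ac : a ≠ c := fun h => hac' (Dart_ext' (da1.trans dc1.symm) (by rw [← haa, ← hcc, h]))
  have bc : b ≠ c := fun h => hbc (Dart_ext' (db1.trans dc1.symm) (by rw [← hbb, ← hcc, h]))
  have au : a ≠ u := fun h => o2 (Dart_ext' (da1.trans du1.symm) (by rw [← haa, du2, h]))
  have bu : b ≠ u := fun h => o3 (Dart_ext' (db1.trans du1.symm) (by rw [← hbb, du2, h]))
  have cu : c ≠ u := fun h => o4 (Dart_ext' (dc1.trans du1.symm) (by rw [← hcc, du2, h]))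
  rw [← haa, ← hcc] at hac
  obtain ⟨par, hp, hpar⟩ := exists_good_par hc v a b u
  obtain ⟨Λ, hΛ0, hΛL, -, hΛs⟩ := exists_layout R hp db db1
  have dist1 : ∀ x, G.Adj v x → G.dist v x = 1 := fun x hx => SimpleGraph.dist_eq_one_iff_adj.2 hx
  have rne : ∀ x w, G.Adj v x → Rch G v x w → w ≠ v := by
    rintro x w hx h rfl
    have := h.dist_le
    rw [dist1 x hx, SimpleGraph.dist_self] at this; omega
  have prdpar : ∀ w, w ≠ v → Prd G v (par w) w := fun w hw => ⟨hp.adj w hw, hp.dist w hw⟩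
  -- classes are subtrees
  have U1 : ∀ w, Rch G v u w → Anc par u w := by
    intro w
    refine hp.induct (P := fun w => Rch G v u w → Anc par u w) ?_ ?_ w
    · intro h; exact absurd rfl (rne u v hvu h)
    · intro w hw ih h
      by_cases h1 : u = w
      · rw [h1]; exact Anc.refl _ _
      · exact (ih ((hpar w hw).1 (h.last h1))).step
  have A1 : ∀ w, Acl G v a u w → Anc par a w := by
    intro w
    refine hp.induct (P := fun w => Acl G v a u w → Anc par a w) ?_ ?_ w
    · intro h; exact absurd rfl (rne a v va h.2)
    · intro w hw ih h
      by_cases h1 : a = w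
      · rw [h1]; exact Anc.refl _ _
      · obtain ⟨p, h2, h3⟩ := h.2.last h1
        rcases (hpar w hw).2.2.1 ⟨p, h2, fun h4 => h.1 (h4.up h2), h3⟩ with h4 | h4
        · exact absurd (h4.up (prdpar w hw)) h.1
        · exact (ih h4).step
  have B1 : ∀ w, Bcl G v a b u w → Anc par b w := by
    intro w
    refine hp.induct (P := fun w => Bcl G v a b u w → Anc par b w) ?_ ?_ w
    · intro h; exact absurd rfl (rne b v vb h.2.2)
    · intro w hw ih h
      by_cases h1 : b = w
      · rw [h1]; exact Anc.refl _ _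
      · obtain ⟨p, h2, h3⟩ := h.2.2.last h1
        rcases (hpar w hw).2.2.2 ⟨p, h2, fun h4 => h.1 (h4.up h2), fun h4 => h.2.1 (h4.up h2), h3⟩
          with h4 | h4 | h4
        · exact absurd (h4.up (prdpar w hw)) h.1
        · exact absurd (h4.2.up (prdpar w hw)) h.2.1
        · exact (ih h4).step
  have C1 : ∀ w, Ccl G v a b u w → Anc par c w := by
    intro w
    refine hp.induct (P := fun w => Ccl G v a b u w → Anc par c w) ?_ ?_ w
    · intro h; exact absurd rfl h.1
    · intro w hw ih h
      by_cases h1 : par w = v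
      · have h2 := hp.adj w hw
        rw [h1] at h2
        rcases nbr w h2 with h3 | h3 | h3 | h3
        · exact absurd (h3 ▸ Relation.ReflTransGen.refl) h.2.2.1
        · exact absurd (h3 ▸ Relation.ReflTransGen.refl) h.2.2.2
        · rw [h3]; exact Anc.refl _ _
        · exact absurd (h3 ▸ Relation.ReflTransGen.refl) h.2.1
      · exact (ih ⟨h1, fun h4 => h.2.1 (h4.up (prdpar w hw)),
          fun h4 => h.2.2.1 (h4.up (prdpar w hw)), fun h4 => h.2.2.2 (h4.up (prdpar w hw))⟩).step
  have part : ∀ w, w ≠ v → Rch G v u w ∨ Acl G v a u w ∨ Bcl G v a b u w ∨ Ccl G v a b u w := by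
    intro w hw
    unfold Acl Bcl Ccl
    by_cases h1 : Rch G v u w <;> by_cases h2 : Rch G v a w <;> by_cases h3 : Rch G v b w <;> tauto
  have excl : ∀ {x y w : V}, G.Adj v x → G.Adj v y → x ≠ y → Anc par x w → Anc par y w → False := by
    intro x y w hx hy hxy h1 h2
    exact hxy (hp.anc_unique h1 h2 ((dist1 x hx).trans (dist1 y hy).symm))
  have ancne : ∀ {x w : V}, G.Adj v x → Anc par x w → w ≠ v := by
    rintro x w hx h rfl
    rw [hp.anc_root h] at hx; exact G.irrefl hx
  have U2 : ∀ w, Anc par u w ↔ Rch G v u w := by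
    intro w
    refine ⟨fun h => ?_, U1 w⟩
    rcases part w (ancne hvu h) with h1 | h1 | h1 | h1
    · exact h1
    · exact (excl hvu va au.symm h (A1 w h1)).elim
    · exact (excl hvu vb bu.symm h (B1 w h1)).elim
    · exact (excl hvu vc cu.symm h (C1 w h1)).elim
  have A2 : ∀ w, Anc par a w ↔ Acl G v a u w := by
    intro w
    refine ⟨fun h => ?_, A1 w⟩
    rcases part w (ancne va h) with h1 | h1 | h1 | h1
    · exact (excl va hvu au h (U1 w h1)).elim
    · exact h1
    · exact (excl va vb ab h (B1 w h1)).elim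
    · exact (excl va vc ac h (C1 w h1)).elim
  have B2 : ∀ w, Anc par b w ↔ Bcl G v a b u w := by
    intro w
    refine ⟨fun h => ?_, B1 w⟩
    rcases part w (ancne vb h) with h1 | h1 | h1 | h1
    · exact (excl vb hvu bu h (U1 w h1)).elim
    · exact (excl vb va ab.symm h (A1 w h1)).elim
    · exact h1
    · exact (excl vb vc bc h (C1 w h1)).elim
  have C2 : ∀ w, Anc par c w ↔ Ccl G v a b u w := by
    intro w
    refine ⟨fun h => ?_, C1 w⟩
    rcases part w (ancne vc h) with h1 | h1 | h1 | h1
    · exact (excl vc hvu cu h (U1 w h1)).elim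
    · exact (excl vc va ac.symm h (A1 w h1)).elim
    · exact (excl vc vb bc.symm h (B1 w h1)).elim
    · exact h1
  have Fpar : ∀ w, Fcl G v a u w → (∃ q, Anc par u q ∧ G.dist v q = G.dist v w ∧ G.Adj w q) ∨
      Fcl G v a u (par w) := by
    rintro w ⟨hA, f, hf, hT, hfw⟩
    have hwv : w ≠ v := rne a w va hA.2
    by_cases h1 : f = w
    · left
      obtain ⟨q, h2, h3, h4⟩ := hT
      exact ⟨q, (U2 q).2 h2, h1 ▸ h3, h1 ▸ h4⟩
    · right
      obtain ⟨p, h2, h3⟩ := hfw.last h1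
      have hAp : Acl G v a u p := ⟨fun h => hA.1 (h.up h2), Relation.ReflTransGen.trans hf.2 h3⟩
      rcases (hpar w hwv).2.1 ⟨p, h2, hAp, f, hf, hT, h3⟩ with h4 | h4
      · exact absurd (h4.up (prdpar w hwv)) hA.1
      · exact h4
  -- order
  have ord : ∀ (d d' : G.Dart), d.fst = v → d' = R.σ d → d' ≠ db → ∀ i j, i ≤ Λ.L → j ≤ Λ.L →
      Anc par d.snd (Λ.τ i) → Anc par d'.snd (Λ.τ j) → i < j := by
    intro d d' hd hd' hne i j hi hj h1 h2
    have hd'1 : d'.fst = v := by rw [hd', R.fst, hd]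
    have p1 : par d.snd = v := hp.par_nbr hc (by rw [← hd]; exact d.adj)
    have p2 : par d'.snd = v := hp.par_nbr hc (by rw [← hd'1]; exact d'.adj)
    have e1 := (Λ.anc_iff_idx hp d (by rw [p1, hd]) rfl hi).1 h1
    have e2 := (Λ.anc_iff_idx hp d' (by rw [p2, hd'1]) rfl hj).1 h2
    have hT : isT par d.symm := (isT_symm par d).2 (Or.inl (by rw [p1, hd]))
    have e3 : Λ.δ (Λ.idx d.symm + 1) = d' := by
      rw [hΛs, Λ.δ_idx, psi_pos R hT, SimpleGraph.Dart.symm_symm, hd']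
    have e4 : Λ.idx d.symm + 1 < Λ.L := by
      have := Λ.idx_lt d.symm
      by_contra h
      have h5 : Λ.idx d.symm + 1 = Λ.L := by omega
      rw [h5, hΛL] at e3
      exact hne e3.symm
    have e5 := Λ.idx_δ _ e4
    rw [e3] at e5
    omega
  have S : PairSetup Λ a b c u (Fcl G v a u) := {
    hc := hc
    hp := hp
    va := va
    vb := vb
    vc := vc
    vu := hvu
    nbr := nbr
    ab := ab
    ac := ac
    au := au
    bc := bc
    bu := bu
    cu := cu
    top := by
      intro w hw
      rw [U2, A2, B2, C2]
      rcases part w hw with h | h | h | h <;> tauto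
    U_up := by
      intro p w h1 h2 h3
      rw [U2] at h1 ⊢
      exact h1.up ⟨h2, h3⟩
    A_up := by
      intro p w h1 h2 h3
      rw [A2] at h1 ⊢
      rw [U2]
      by_cases h : Rch G v u w
      · exact Or.inl h
      · exact Or.inr ⟨h, h1.2.up ⟨h2, h3⟩⟩
    C_pred := by
      intro p w h1 h2 h3 h4
      rw [C2] at h1 ⊢
      exact ⟨h4, fun h => h1.2.1 (h.up ⟨h2, h3⟩), fun h => h1.2.2.1 (h.up ⟨h2, h3⟩),
        fun h => h1.2.2.2 (h.up ⟨h2, h3⟩)⟩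
    B_pred := by
      intro p w h1 h2 h3 h4
      rw [B2] at h1 ⊢
      rw [C2]
      have g1 : ¬ Rch G v u p := fun h => h1.1 (h.up ⟨h2, h3⟩)
      have g2 : ¬ Rch G v a p := fun h => h1.2.1 (h.up ⟨h2, h3⟩)
      by_cases h : Rch G v b p
      · exact Or.inl ⟨g1, g2, h⟩
      · exact Or.inr ⟨h4, g1, g2, h⟩
    F_a := fun w h => (A2 w).2 h.1
    F_tied := Fpar
    tied_F := by
      intro w q h1 h2 h3 h4
      rw [A2] at h1
      rw [U2] at h2
      exact ⟨h1, w, h1, ⟨q, h2, h3, h4⟩, Relation.ReflTransGen.refl⟩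
    F_up := by
      intro p w h1 h2 h3 h4
      rw [A2] at h4
      obtain ⟨_, f, hf, hT, hr⟩ := h1
      exact ⟨h4, f, hf, hT, hr.up ⟨h2, h3⟩⟩
    ord_bc := by rw [hbb, hcc]; exact ord db dc db1 hdc hbc.symm
    ord_cu := by rw [hcc, ← du2]; exact ord dc du dc1 o1.symm o3.symm
    ord_ua := by rw [haa, ← du2]; exact ord du da du1 hda hab
    au_cu := hac
    degu := hu4 }
  exact S.pair_lemma hn

theorem pair_final {G : SimpleGraph V} [DecidableRel G.Adj] (hc : G.Connected) (R : Rot G) (v u : V)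
    (hvu : G.Adj v u) (h4 : (G.neighborSet v).ncard = 4) (hu4 : (G.neighborSet u).ncard ≤ 4) :
    Fintype.card V ≤ 4 * sn G (fun _ => 2) v +
      max (sn G (fun _ => 2) v) (sn G (fun _ => 2) u) + 2 := by
  by_cases h : G.Adj (R.σ ⟨(v, u), hvu⟩).snd u → G.Adj (R.σ⁻¹ ⟨(v, u), hvu⟩).snd u
  · exact pair_core hc R v u hvu h4 hu4 h
  · apply pair_core hc R.mirror v u hvu h4 hu4
    intro h1
    push Not at h
    exact absurd h1 h.2

end PartE3

end

section

set_option linter.unusedSectionVars false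
set_option linter.unusedVariables false
set_option linter.unusedSimpArgs false

section PartF

variable {V : Type} [Fintype V] [DecidableEq V]

/-- signed count of darts in `[i, j)`. -/
def Layout.gcount {G : SimpleGraph V} {v : V} {par : V → V} (Λ : Layout G v par) (i j : ℕ) : ℤ :=
  ∑ k ∈ Finset.Ico i j, if isT par (Λ.δ k) then 1 else -1

theorem Layout.gcount_step {G : SimpleGraph V} {v : V} {par : V → V} (Λ : Layout G v par) {i j : ℕ}
    (h : i < j) : Λ.gcount i j = (if isT par (Λ.δ i) then 1 else -1) + Λ.gcount (i+1) j := by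
  unfold gcount
  rw [Finset.sum_eq_sum_Ico_succ_bot h]

theorem Layout.gcount_split {G : SimpleGraph V} {v : V} {par : V → V} (Λ : Layout G v par)
    {i l j : ℕ} (h : i ≤ l) (h' : l ≤ j) : Λ.gcount i j = Λ.gcount i l + Λ.gcount l j := by
  unfold gcount
  rw [Finset.sum_Ico_consecutive _ h h']

theorem Layout.bip_main {G : SimpleGraph V} {v : V} {par : V → V} (Λ : Layout G v par)
    (col : V → Bool) (hcol : ∀ x y, G.Adj x y → col x ≠ col y) :
    ∀ n i j, j - i ≤ n → Λ.Adm i j → 0 ≤ Λ.gcount i j ∧ (Λ.gcount i j = 0 → i = j) ∧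
      (Λ.gcount i j = 1 → i < j ∧ (Λ.δ i).snd = Λ.τ j) ∧
      (Even (Λ.gcount i j) ↔ col (Λ.τ i) = col (Λ.τ j)) := by
  intro n
  induction n with
  | zero =>
    intro i j h ha
    have := ha.1
    have hij : i = j := by omega
    subst hij
    have : Λ.gcount i i = 0 := by simp [gcount]
    rw [this]; simp
  | succ n ih =>
    intro i j h ha
    by_cases hij : i = j
    · subst hij
      have : Λ.gcount i i = 0 := by simp [gcount]
      rw [this]; simp
    have hlt : i < j := lt_of_le_of_ne ha.1 hij
    have hadj := hcol _ _ (Λ.δ i).adj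
    have hτi : Λ.τ i = (Λ.δ i).fst := rfl
    rw [Λ.gcount_step hlt]
    by_cases hT : isT par (Λ.δ i)
    · obtain ⟨h1, h2, h3, h4⟩ := ih (i+1) j (by omega) (ha.tree hlt hT)
      rw [if_pos hT]
      have hτ : Λ.τ (i+1) = (Λ.δ i).snd := Λ.step_tree i hT
      refine ⟨by omega, by omega, ?_, ?_⟩
      · intro h5
        have := h2 (by omega)
        exact ⟨hlt, by rw [← hτ, this]⟩
      · rw [add_comm, Int.even_add_one, h4, hτ, hτi]
        revert hadj
        generalize col (Λ.δ i).snd = p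
        generalize col (Λ.δ i).fst = q
        generalize col (Λ.τ j) = r
        cases p <;> cases q <;> cases r <;> simp
    · have hm := ha.mate hlt hT
      obtain ⟨l, hl⟩ : ∃ l, l = Λ.idx (Λ.δ i).symm := ⟨_, rfl⟩
      rw [← hl] at hm
      have hadm1 := ha.left_pair hlt hT
      have hadm2 := ha.right_pair hlt hT
      rw [← hl] at hadm1 hadm2
      obtain ⟨g1, g2, g3, g4⟩ := ih (i+1) l (by omega) hadm1
      obtain ⟨k1, k2, k3, k4⟩ := ih (l+1) j (by omega) hadm2
      have hτ1 : Λ.τ (i+1) = (Λ.δ i).fst := Λ.step_non i hT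
      have hτl : Λ.τ l = (Λ.δ i).snd := by rw [hl, Λ.τ_idx]; rfl
      have hδl : Λ.δ l = (Λ.δ i).symm := by rw [hl, Λ.δ_idx]
      have hTl : ¬ isT par (Λ.δ l) := by rw [hδl, isT_symm]; exact hT
      have hτl1 : Λ.τ (l+1) = (Λ.δ i).snd := by rw [Λ.τ_succ_non hTl, hτl]
      have hodd : ¬ Even (Λ.gcount (i+1) l) := by
        rw [g4, hτ1, hτl]; exact hadj
      have hne1 : Λ.gcount (i+1) l ≠ 1 := by
        intro h5
        obtain ⟨h6, h7⟩ := g3 h5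
        have h8 : Λ.δ (i+1) = Λ.δ i := Dart_ext' hτ1 (by rw [h7, hτl])
        have h9 := Λ.idx_δ (i+1) (by have := ha.2.1; omega)
        rw [h8, Λ.idx_δ i (by have := ha.2.1; omega)] at h9
        omega
      have h3 : 3 ≤ Λ.gcount (i+1) l := by
        have := Int.not_even_iff.1 hodd
        omega
      have e1 : Λ.gcount (i+1) j = Λ.gcount (i+1) l + (-1 + Λ.gcount (l+1) j) := by
        rw [Λ.gcount_split (l := l) (by omega) (by omega), Λ.gcount_step hm.2, if_neg hTl]
      rw [if_neg hT, e1]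
      refine ⟨by omega, by omega, ?_, ?_⟩
      · intro h5
        have := k2 (by omega)
        exact ⟨hlt, by rw [← hτl1, this]⟩
      · have e2 : Even (-1 + (Λ.gcount (i+1) l + (-1 + Λ.gcount (l+1) j))) ↔
            ¬ Even (Λ.gcount (l+1) j) := by
          rw [Int.even_iff, Int.even_iff]
          rw [Int.even_iff] at hodd
          omega
        rw [e2, k4, hτl1, hτi]
        revert hadj
        generalize col (Λ.δ i).snd = p
        generalize col (Λ.δ i).fst = q
        generalize col (Λ.τ j) = r
        cases p <;> cases q <;> cases r <;> simp

theorem bip_conn {G : SimpleGraph V} [DecidableRel G.Adj] (hc : G.Connected) (R : Rot G)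
    (col : V → Bool) (hcol : ∀ x y, G.Adj x y → col x ≠ col y) :
    Fintype.card G.Dart ≤ 4 * Fintype.card V := by
  classical
  rcases isEmpty_or_nonempty G.Dart with he | ⟨⟨d0⟩⟩
  · simp
  obtain ⟨par, hp⟩ := exists_par hc d0.fst
  obtain ⟨Λ, -, -, hL, -⟩ := exists_layout R hp d0 rfl
  have h1 := (Λ.bip_main col hcol _ 0 Λ.L le_rfl Λ.adm_full).1
  have h2 : Λ.gcount 0 Λ.L = ∑ d : G.Dart, if isT par d then (1:ℤ) else -1 := by
    unfold Layout.gcount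
    apply Finset.sum_bij' (fun k _ => Λ.δ k) (fun d _ => Λ.idx d)
    · intro k hk; simp
    · intro d _; simp [Λ.idx_lt]
    · intro k hk; exact Λ.idx_δ k (Finset.mem_Ico.1 hk).2
    · intro d _; exact Λ.δ_idx d
    · intro k hk; rfl
  rw [h2] at h1
  have h3 : ∑ d : G.Dart, (if isT par d then (1:ℤ) else -1) =
      2 * ((Finset.univ.filter fun d : G.Dart => isT par d).card : ℤ) - Fintype.card G.Dart := by
    have : ∀ d : G.Dart, (if isT par d then (1:ℤ) else -1) = 2 * (if isT par d then 1 else 0) - 1 := by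
      intro d; split_ifs <;> norm_num
    rw [Finset.sum_congr rfl (fun d _ => this d), Finset.sum_sub_distrib, ← Finset.mul_sum,
      Finset.sum_boole]
    simp [Finset.card_univ]
  have h4 : (Finset.univ.filter fun d : G.Dart => isT par d).card ≤ 2 * Fintype.card V := by
    have hinj : ∀ d ∈ (Finset.univ.filter fun d : G.Dart => isT par d),
        (if par d.snd = d.fst then (d.snd, true) else (d.fst, false)) ∈
          (Finset.univ : Finset (V × Bool)) := fun _ _ => Finset.mem_univ _
    have := Finset.card_le_card_of_injOn _ hinj (by
      intro d hd e he hde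
      simp only [Finset.coe_filter, Finset.mem_univ, true_and, Set.mem_ofPred_eq] at hd he
      dsimp only at hde
      by_cases h1 : par d.snd = d.fst <;> by_cases h2 : par e.snd = e.fst
      · rw [if_pos h1, if_pos h2] at hde
        have h3 : d.snd = e.snd := (Prod.mk.inj hde).1
        exact Dart_ext' (by rw [← h1, ← h2, h3]) h3
      · rw [if_pos h1, if_neg h2] at hde
        simpa using congrArg Prod.snd hde
      · rw [if_neg h1, if_pos h2] at hde
        simpa using congrArg Prod.snd hde
      · rw [if_neg h1, if_neg h2] at hde
        have h3 : d.fst = e.fst := (Prod.mk.inj hde).1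
        have h4 := hd.resolve_left h1
        have h5 := he.resolve_left h2
        exact Dart_ext' h3 (by rw [← h4, ← h5, h3]))
    rw [Finset.card_univ, Fintype.card_prod, Fintype.card_bool] at this
    omega
  rw [h3] at h1
  omega

theorem IsPlanar.of_hom {V W : Type} {G : SimpleGraph V} {H : SimpleGraph W} (f : W → V)
    (hf : Function.Injective f) (hadj : ∀ x y, H.Adj x y → G.Adj (f x) (f y)) (h : IsPlanar G) :
    IsPlanar H := by
  obtain ⟨E⟩ := h
  refine ⟨⟨fun w => E.pos (f w), fun x y => E.arc (f x) (f y), E.pos_inj.comp hf,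
    fun x y h => E.arc_cont (hadj x y h), fun x y h => E.arc_injOn (hadj x y h),
    fun x y h => E.arc_zero (hadj x y h), fun x y h => E.arc_one (hadj x y h),
    fun x y h => E.arc_symm (hadj x y h), fun x y h w => E.arc_avoid (hadj x y h) (f w), ?_⟩⟩
  intro x y x' y' h h' hne
  apply E.arc_meet (hadj x y h) (hadj x' y' h')
  intro heq
  apply hne
  have := congrArg id heq
  rw [← Sym2.map_mk, ← Sym2.map_mk] at heq
  exact Sym2.map.injective hf heq

def HasRot : Prop := ∀ (W : Type) [Fintype W] [DecidableEq W] (H : SimpleGraph W)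
  [DecidableRel H.Adj], IsPlanar H → Nonempty (Rot H)

theorem bip_bound (hrot : HasRot) {W : Type} [Fintype W] [DecidableEq W] (H : SimpleGraph W)
    [DecidableRel H.Adj] (hpl : IsPlanar H) (col : W → Bool)
    (hcol : ∀ x y, H.Adj x y → col x ≠ col y) :
    ∑ w, H.degree w ≤ 4 * Fintype.card W := by
  classical
  have key : ∀ K : H.ConnectedComponent, ∑ w with H.connectedComponentMk w = K, H.degree w ≤
      4 * (Finset.univ.filter fun w => H.connectedComponentMk w = K).card := by
    intro K
    have hpK : IsPlanar K.toSimpleGraph := hpl.of_hom (fun w => w.1) Subtype.val_injective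
      (fun x y h => h)
    obtain ⟨R⟩ := hrot _ K.toSimpleGraph hpK
    have h1 := bip_conn K.connected_toSimpleGraph R (fun w => col w.1) (fun x y h => hcol _ _ h)
    rw [SimpleGraph.dart_card_eq_sum_degrees] at h1
    have h2 : ∀ w : K, K.toSimpleGraph.degree w = H.degree w.1 := by
      intro w
      rw [← SimpleGraph.card_neighborSet_eq_degree, ← SimpleGraph.card_neighborSet_eq_degree]
      apply Fintype.card_congr
      refine ⟨fun x => ⟨x.1.1, x.2⟩, fun x => ⟨⟨x.1, ?_⟩, x.2⟩, fun x => rfl, fun x => rfl⟩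
      have h3 : H.Adj w.1 x.1 := x.2
      have h4 : H.connectedComponentMk w.1 = K := w.2
      show H.connectedComponentMk x.1 = K
      exact (SimpleGraph.ConnectedComponent.sound h3.reachable).symm.trans h4
    rw [Finset.sum_congr rfl (fun w _ => h2 w)] at h1
    have h3 : ∑ w with H.connectedComponentMk w = K, H.degree w = ∑ w : K, H.degree w.1 := by
      symm
      apply Finset.sum_bij (fun w _ => w.1)
      · intro w _; simp only [Finset.mem_filter, Finset.mem_univ, true_and]; exact w.2
      · intro w _ w' _ h; exact Subtype.ext h
      · intro w hw
        simp only [Finset.mem_filter, Finset.mem_univ, true_and] at hw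
        exact ⟨⟨w, hw⟩, Finset.mem_univ _, rfl⟩
      · intro w _; rfl
    have h4 : Fintype.card K = (Finset.univ.filter fun w => H.connectedComponentMk w = K).card := by
      rw [← Fintype.card_subtype]
      exact Fintype.card_congr (Equiv.refl _)
    rw [h3, ← h4]
    exact h1
  rw [← Finset.sum_fiberwise (g := fun w => H.connectedComponentMk w)]
  refine (Finset.sum_le_sum (fun K _ => key K)).trans ?_
  have h9 := Finset.card_eq_sum_card_fiberwise (f := fun w => H.connectedComponentMk w)
    (s := Finset.univ) (t := Finset.univ) (fun w _ => Finset.mem_coe.2 (Finset.mem_univ _))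
  rw [Finset.card_univ] at h9
  rw [← Finset.mul_sum, h9]

end PartF

end

section

set_option linter.unusedSectionVars false
set_option linter.unusedVariables false
set_option linter.unusedSimpArgs false

section PartH

variable {V : Type} [Fintype V] [DecidableEq V]

theorem bip_card (hrot : HasRot) (G : SimpleGraph V) [DecidableRel G.Adj] (hpl : IsPlanar G)
    (B N : Finset V) (hBN : Disjoint B N) (h4 : ∀ b ∈ B, G.degree b = 4)
    (hN : ∀ b ∈ B, ∀ x, G.Adj b x → x ∈ N) : B.card ≤ N.card := by
  classical
  let W := {v : V // v ∈ B ∨ v ∈ N}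
  let H : SimpleGraph W :=
    { Adj := fun x y => G.Adj x.1 y.1 ∧ (decide (x.1 ∈ B) ≠ decide (y.1 ∈ B))
      symm := ⟨fun x y h => ⟨h.1.symm, h.2.symm⟩⟩
      loopless := ⟨fun x h => h.2 rfl⟩ }
  have hH : ∀ x y : W, H.Adj x y ↔ G.Adj x.1 y.1 ∧ (decide (x.1 ∈ B) ≠ decide (y.1 ∈ B)) :=
    fun x y => Iff.rfl
  have hb := bip_bound hrot H (hpl.of_hom (fun w => w.1) Subtype.val_injective
    (fun x y h => h.1)) (fun w => decide (w.1 ∈ B)) (fun x y h => h.2)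
  let S : Finset W := Finset.univ.filter fun w => w.1 ∈ B
  let T : Finset W := Finset.univ.filter fun w => w.1 ∉ B
  have hbip : H.IsBipartiteWith (S : Set W) (T : Set W) := by
    refine ⟨?_, ?_⟩
    · rw [Finset.disjoint_coe]
      exact Finset.disjoint_filter_filter_not _ _ _
    · intro x y h
      have := h.2
      simp only [S, T, Finset.coe_filter, Finset.mem_univ, true_and, Set.mem_ofPred_eq]
      by_cases h1 : x.1 ∈ B <;> by_cases h2 : y.1 ∈ B <;> simp_all
  have hsum := SimpleGraph.isBipartiteWith_sum_degrees_eq hbip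
  have hall : ∑ w, H.degree w = ∑ w ∈ S, H.degree w + ∑ w ∈ T, H.degree w :=
    (Finset.sum_filter_add_sum_filter_not _ _ _).symm
  have hdeg : ∀ w ∈ S, H.degree w = 4 := by
    intro w hw
    have hwB : w.1 ∈ B := (Finset.mem_filter.1 hw).2
    rw [← h4 w.1 hwB, ← SimpleGraph.card_neighborSet_eq_degree,
      ← SimpleGraph.card_neighborSet_eq_degree]
    apply Fintype.card_congr
    refine ⟨fun x => ⟨x.1.1, x.2.1⟩, fun x => ⟨⟨x.1, Or.inr (hN w.1 hwB x.1 x.2)⟩, ?_⟩,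
      fun x => rfl, fun x => rfl⟩
    refine ⟨x.2, ?_⟩
    have : x.1 ∉ B := fun h => Finset.disjoint_left.1 hBN h (hN w.1 hwB x.1 x.2)
    simp [hwB, this]
  have hS : S.card = B.card := by
    apply Finset.card_bij (fun w _ => w.1)
    · intro w hw; exact (Finset.mem_filter.1 hw).2
    · intro w _ w' _ h; exact Subtype.ext h
    · intro b hb; exact ⟨⟨b, Or.inl hb⟩, by simp [S, hb], rfl⟩
  have hW : Fintype.card W = B.card + N.card := by
    rw [Fintype.card_subtype, ← Finset.card_union_of_disjoint hBN]
    congr 1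
    ext; simp
  rw [hall, ← hsum, Finset.sum_congr rfl hdeg, Finset.sum_const, smul_eq_mul, hS, hW] at hb
  omega

theorem charge_arith (n s d : ℕ) (N B : Prop) [Decidable N] [Decidable B] (hn5 : 5 ≤ n)
    (h1 : 1 ≤ d) (h2 : d ≤ 2 → n ≤ s + 1) (h3 : d ≤ 3 → n ≤ 3 * s)
    (h4 : N → 19 ≤ n ∧ (d ≤ 4 → 5 * n ≤ 9 * s + 14)) (h5 : B ↔ d = 4 ∧ 9 * s < n)
    (h6 : B → ¬ N) : (n:ℤ) * ((if N then 1 else 0) - (if B then 1 else 0)) ≤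
      9 * s + 2 * n * d - 9 * n := by
  have hcases : d = 1 ∨ d = 2 ∨ d = 3 ∨ d = 4 ∨ 5 ≤ d := by omega
  by_cases hB : B
  · have hN := h6 hB
    rw [if_neg hN, if_pos hB]
    have := (h5.1 hB).1
    subst this
    push_cast
    omega
  have hB' : d = 4 → n ≤ 9 * s := by
    intro h; by_contra h'
    exact hB (h5.2 ⟨h, by omega⟩)
  rw [if_neg hB]
  have h0 : ∀ k : ℕ, d = k → (2 * (n:ℤ) * (d:ℤ)) = 2 * n * k := fun k hk => by rw [hk]
  by_cases hN : N
  · rw [if_pos hN]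
    obtain ⟨h7, h8⟩ := h4 hN
    rcases hcases with h | h | h | h | h
    all_goals first | (rw [h0 _ h]; push_cast; omega) | skip
    have h7 : (n:ℤ) * 5 ≤ n * d := by exact_mod_cast Nat.mul_le_mul le_rfl h
    have h9 : (0:ℤ) ≤ s := by positivity
    linarith
  · rw [if_neg hN]
    rcases hcases with h | h | h | h | h
    all_goals first | (rw [h0 _ h]; push_cast; omega) | skip
    have h7 : (n:ℤ) * 5 ≤ n * d := by exact_mod_cast Nat.mul_le_mul le_rfl h
    have h9 : (0:ℤ) ≤ s := by positivity
    have h10 : (0:ℤ) ≤ n := by positivity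
    linarith

theorem main_of_rot (hrot : HasRot) (G : SimpleGraph V)
    (hconn : G.Connected) (hplanar : IsPlanar G)
    (n m : ℕ) (hn : n = Fintype.card V) (hm : m = Nat.card G.edgeSet)
    (hn2 : 2 ≤ n) (ε : ℝ) (hε : ε ∈ Set.Ioc (0 : ℝ) 1)
    (hdeg : (2 * m : ℝ) / n = 9 / 2 - ε) :
    survivingRate G (fun _ => 2) ≥ 2 / 9 * ε := by
  classical
  obtain ⟨R⟩ := hrot V G hplanar
  have hsum : ∑ v, G.degree v = 2 * m := by
    rw [SimpleGraph.sum_degrees_eq_twice_card_edges, hm, Nat.card_eq_fintype_card,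
      SimpleGraph.edgeFinset_card]
  have hnpos : (0:ℝ) < n := by exact_mod_cast (by omega : 0 < n)
  have h2m : (2 * m : ℝ) = (9/2 - ε) * n := by
    rw [← hdeg]; field_simp
  have hn5 : 5 ≤ n := by
    have h1 : ∑ v, G.degree v ≤ ∑ v : V, (n - 1) := by
      apply Finset.sum_le_sum
      intro v _
      have := G.degree_lt_card_verts v
      omega
    rw [hsum, Finset.sum_const, Finset.card_univ, smul_eq_mul, ← hn] at h1
    have h2 : (7:ℝ) / 2 * n ≤ 2 * m := by rw [h2m]; nlinarith [hε.2]
    have h3 : 7 * n ≤ 2 * (2 * m) := by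
      have : (7:ℝ) * n ≤ 2 * (2 * m) := by linarith
      exact_mod_cast this
    by_contra h
    have : n * (n-1) ≤ n * 3 := Nat.mul_le_mul le_rfl (by omega)
    omega
  obtain ⟨s, hs⟩ : ∃ s : V → ℕ, s = fun v => sn G (fun _ => 2) v := ⟨_, rfl⟩
  have hnc : ∀ v, (G.neighborSet v).ncard = G.degree v := by
    intro v
    rw [← Nat.card_coe_set_eq, Nat.card_eq_fintype_card, SimpleGraph.card_neighborSet_eq_degree]
  have hs2 : ∀ v, G.degree v ≤ 2 → n ≤ s v + 1 := by
    intro v h; rw [hn, hs]; exact sn_deg_two _ _ (by rw [hnc]; exact h)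
  have hs3 : ∀ v, G.degree v ≤ 3 → n ≤ 3 * s v := by
    intro v h; rw [hn, hs]; exact sn_deg_three hconn R v (by rw [hnc]; exact h) (by omega)
  have hst : ∀ v, 2 ≤ s v := by
    intro v; rw [hs]; exact sn_two G v (by omega)
  have hs4 : ∀ v u, G.Adj v u → G.degree v = 4 → G.degree u ≤ 4 →
      n ≤ 4 * s v + max (s v) (s u) + 2 := by
    intro v u hvu h4 hu
    rw [hn, hs]; exact pair_final hconn R v u hvu (by rw [hnc]; exact h4) (by rw [hnc]; exact hu)
  have hd1 : ∀ v, 1 ≤ G.degree v := by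
    intro v
    have : Nontrivial V := Fintype.one_lt_card_iff_nontrivial.1 (by omega)
    exact hconn.preconnected.degree_pos_of_nontrivial v
  let B : Finset V := Finset.univ.filter fun v => G.degree v = 4 ∧ 9 * s v < n
  let N : Finset V := Finset.univ.filter fun v => ∃ b ∈ B, G.Adj b v
  have hB : ∀ v, v ∈ B ↔ G.degree v = 4 ∧ 9 * s v < n := fun v => by simp [B]
  have hN : ∀ v, v ∈ N ↔ ∃ b ∈ B, G.Adj b v := fun v => by simp [N]
  have hNs : ∀ v ∈ N, 19 ≤ n ∧ (G.degree v ≤ 4 → 5 * n ≤ 9 * s v + 14) := by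
    intro v hv
    obtain ⟨b, hb, hbv⟩ := (hN v).1 hv
    obtain ⟨hb4, hb9⟩ := (hB b).1 hb
    have := hst b
    refine ⟨by omega, fun h => ?_⟩
    have := hs4 b v hbv hb4 h
    omega
  have hdis : Disjoint B N := by
    rw [Finset.disjoint_left]
    intro v hv hv'
    have h1 := (hB v).1 hv
    have h2 := hNs v hv'
    have := h2.2 (by omega)
    omega
  have hcard := bip_card hrot G hplanar B N hdis (fun b hb => ((hB b).1 hb).1)
    (fun b hb x hx => (hN x).2 ⟨b, hb, hx⟩)
  have hc : ∀ v, (n:ℤ) * ((if v ∈ N then 1 else 0) - (if v ∈ B then 1 else 0)) ≤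
      9 * s v + 2 * n * G.degree v - 9 * n := by
    intro v
    have h1 := hd1 v
    have h2 := hs2 v
    have h3 := hs3 v
    have h4 := hNs v
    have h5 := hB v
    have h6 : v ∈ B → v ∉ N := fun h => Finset.disjoint_left.1 hdis h
    exact charge_arith n (s v) (G.degree v) (v ∈ N) (v ∈ B) hn5 h1 h2 h3 h4 h5 h6
  have hS := Finset.sum_le_sum (fun v (_ : v ∈ Finset.univ) => hc v)
  rw [← Finset.mul_sum, Finset.sum_sub_distrib, Finset.sum_boole, Finset.sum_boole,
    Finset.sum_sub_distrib, Finset.sum_add_distrib, ← Finset.mul_sum, ← Finset.mul_sum,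
    Finset.sum_const, Finset.card_univ, ← hn] at hS
  have e1 : (Finset.univ.filter fun v => v ∈ N) = N := by ext; simp
  have e2 : (Finset.univ.filter fun v => v ∈ B) = B := by ext; simp
  rw [e1, e2, ← Nat.cast_sum, ← Nat.cast_sum, hsum] at hS
  have h0 : (0:ℤ) ≤ (n:ℤ) * ((N.card:ℤ) - B.card) :=
    mul_nonneg (by positivity) (by have : (B.card:ℤ) ≤ N.card := by exact_mod_cast hcard
                                   linarith)
  have hS2 : (0:ℤ) ≤ 9 * ((∑ v, s v : ℕ):ℤ) + 2 * n * ((2 * m : ℕ):ℤ) - n • (9 * (n:ℤ)) :=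
    h0.trans hS
  have hS3 : (0:ℝ) ≤ 9 * ((∑ v, s v : ℕ):ℝ) + 2 * n * ((2 * m : ℕ):ℝ) - n * (9 * (n:ℝ)) := by
    rw [nsmul_eq_mul] at hS2
    exact_mod_cast hS2
  rw [survivingRate, ← hn, ge_iff_le, le_div_iff₀ (by positivity)]
  have e3 : ∑ v, (sn G (fun _ => 2) v : ℝ) = ((∑ v, s v : ℕ):ℝ) := by
    rw [Nat.cast_sum, hs]
  rw [e3]
  have e4 : ((2 * m : ℕ):ℝ) = (9/2 - ε) * n := by rw [← h2m]; push_cast; ring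
  rw [e4] at hS3
  nlinarith

end PartH

end

section

set_option linter.unusedSectionVars false
set_option linter.unusedVariables false
set_option linter.unusedSimpArgs false

section PartG1

open Complex

theorem exists_log_lift {X : Type} [TopologicalSpace X] [SimplyConnectedSpace X]
    [LocallyPathConnectedSpace X] (g : X → ℂ) (hg : Continuous g) (h0 : ∀ x, g x ≠ 0) :
    ∃ L : X → ℂ, Continuous L ∧ ∀ x, exp (L x) = g x := by
  have x₀ : X := Classical.choice inferInstance
  rcases isCoveringMapOn_exp.existsUnique_continuousMap_lifts
    ⟨g, hg⟩ (exp_log (h0 x₀)) (fun x => h0 x) with ⟨f, ⟨-, hf⟩, -⟩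
  exact ⟨f, f.continuous, fun x => congrFun hf x⟩

def IsLift (f : ℝ → ℂ) (a b : ℝ) (L : ℝ → ℂ) : Prop :=
  ContinuousOn L (Set.Icc a b) ∧ ∀ t ∈ Set.Icc a b, exp (L t) = f t

open Classical in
/-- normalised variation of the argument of `f` along `[a, b]`. -/
noncomputable def dArg (f : ℝ → ℂ) (a b : ℝ) : ℝ :=
  if h : ∃ L, IsLift f a b L then (h.choose b - h.choose a).im / (2 * Real.pi) else 0

theorem IsLift.const {f : ℝ → ℂ} {a b : ℝ} {L M : ℝ → ℂ} (hab : a ≤ b) (hL : IsLift f a b L)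
    (hM : IsLift f a b M) : (L b - L a).im = (M b - M a).im := by
  have hcov : ContinuousOn (fun t => L t - M t) (Set.Icc a b) := hL.1.sub hM.1
  have hinteger : ∀ t ∈ Set.Icc a b, ∃ n : ℤ, L t - M t = n * (2 * Real.pi * I) := by
    intro t ht
    have : exp (L t) = exp (M t) := by rw [hL.2 t ht, hM.2 t ht]
    obtain ⟨n, hn⟩ := exp_eq_exp_iff_exists_int.1 this
    exact ⟨n, by rw [hn]; ring⟩
  have hc2 : ContinuousOn (fun t => (L t - M t).im / (2 * Real.pi)) (Set.Icc a b) :=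
    (continuous_im.comp_continuousOn hcov).div_const _
  have hpi : (2 * Real.pi) ≠ 0 := by positivity
  have hinteger2 : ∀ t ∈ Set.Icc a b, ∃ n : ℤ, (L t - M t).im / (2 * Real.pi) = n := by
    intro t ht
    obtain ⟨n, hn⟩ := hinteger t ht
    refine ⟨n, ?_⟩
    rw [hn]
    have : ((n:ℂ) * (2 * Real.pi * I)).im = n * (2 * Real.pi) := by
      simp
    rw [this]; field_simp
  have himg : ((fun t => (L t - M t).im / (2 * Real.pi)) '' Set.Icc a b) ⊆ Set.range ((↑) : ℤ → ℝ) := by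
    rintro _ ⟨t, ht, rfl⟩
    obtain ⟨n, hn⟩ := hinteger2 t ht
    exact ⟨n, hn.symm⟩
  have hpre : IsPreconnected ((fun t => (L t - M t).im / (2 * Real.pi)) '' Set.Icc a b) :=
    isPreconnected_Icc.image _ hc2
  have hsub : ((fun t => (L t - M t).im / (2 * Real.pi)) '' Set.Icc a b).Subsingleton := by
    have hoc := hpre.ordConnected
    rintro x hx y hy
    by_contra hne
    wlog hlt : x < y generalizing x y
    · exact this hy hx (Ne.symm hne) (lt_of_le_of_ne (not_lt.1 hlt) (Ne.symm hne))
    obtain ⟨z, hz⟩ := exists_irrational_btwn hlt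
    obtain ⟨n, hn⟩ := himg (hoc.out hx hy ⟨hz.2.1.le, hz.2.2.le⟩)
    exact hz.1.ne_int n hn.symm
  have := hsub ⟨b, Set.right_mem_Icc.2 hab, rfl⟩ ⟨a, Set.left_mem_Icc.2 hab, rfl⟩
  simp only at this
  have h2 := (div_left_inj' hpi).1 this
  simp only [sub_im] at h2 ⊢
  linarith

theorem dArg_eq {f : ℝ → ℂ} {a b : ℝ} {L : ℝ → ℂ} (hab : a ≤ b) (hL : IsLift f a b L) :
    dArg f a b = (L b - L a).im / (2 * Real.pi) := by
  have h : ∃ L, IsLift f a b L := ⟨L, hL⟩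
  rw [dArg, dif_pos h, h.choose_spec.const hab hL]

theorem exists_isLift {f : ℝ → ℂ} {a b : ℝ} (hab : a ≤ b) (hf : ContinuousOn f (Set.Icc a b))
    (h0 : ∀ t ∈ Set.Icc a b, f t ≠ 0) : ∃ L, IsLift f a b L := by
  obtain ⟨L, hL, hL2⟩ := exists_log_lift (X := ℝ) (Set.IccExtend hab (Set.Icc a b |>.domRestrict f))
    ((continuousOn_iff_continuous_domRestrict.1 hf).Icc_extend' ) (fun x => h0 _ (Subtype.mem _))
  refine ⟨L, hL.continuousOn, fun t ht => ?_⟩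
  rw [hL2, Set.IccExtend_of_mem _ _ ht]
  rfl

theorem IsLift.mono {f : ℝ → ℂ} {a b c d : ℝ} {L : ℝ → ℂ} (hL : IsLift f a b L) (h1 : a ≤ c)
    (h2 : d ≤ b) : IsLift f c d L :=
  ⟨hL.1.mono (Set.Icc_subset_Icc h1 h2), fun t ht => hL.2 t (Set.Icc_subset_Icc h1 h2 ht)⟩

theorem dArg_congr {f g : ℝ → ℂ} {a b : ℝ} (h : ∀ t ∈ Set.Icc a b, f t = g t) :
    dArg f a b = dArg g a b := by
  have : IsLift f a b = IsLift g a b := by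
    funext L
    unfold IsLift
    apply propext
    constructor
    · rintro ⟨h1, h2⟩; exact ⟨h1, fun t ht => by rw [h2 t ht, h t ht]⟩
    · rintro ⟨h1, h2⟩; exact ⟨h1, fun t ht => by rw [h2 t ht, h t ht]⟩
  unfold dArg
  rw [this]

theorem dArg_add {f : ℝ → ℂ} {a b c : ℝ} (hab : a ≤ b) (hbc : b ≤ c)
    (hf : ContinuousOn f (Set.Icc a c)) (h0 : ∀ t ∈ Set.Icc a c, f t ≠ 0) :
    dArg f a c = dArg f a b + dArg f b c := by
  obtain ⟨L, hL⟩ := exists_isLift (hab.trans hbc) hf h0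
  rw [dArg_eq (hab.trans hbc) hL, dArg_eq hab (hL.mono le_rfl hbc), dArg_eq hbc (hL.mono hab le_rfl)]
  simp only [sub_im]; ring

/-- reversal, possibly with a shift and a nonzero constant factor. -/
theorem dArg_rev {f g : ℝ → ℂ} {a b s : ℝ} {c : ℂ} (hc : c ≠ 0) (hab : a ≤ b)
    (hf : ContinuousOn f (Set.Icc a b)) (h0 : ∀ t ∈ Set.Icc a b, f t ≠ 0)
    (hg : ∀ t ∈ Set.Icc (s - b) (s - a), g t = c * f (s - t)) :
    dArg g (s - b) (s - a) = - dArg f a b := by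
  obtain ⟨L, hL⟩ := exists_isLift hab hf h0
  have h1 : ∀ t ∈ Set.Icc (s - b) (s - a), s - t ∈ Set.Icc a b := fun t ht =>
    ⟨by linarith [ht.2], by linarith [ht.1]⟩
  have hM : IsLift g (s - b) (s - a) (fun t => log c + L (s - t)) := by
    refine ⟨continuousOn_const.add (hL.1.comp (by fun_prop) h1), fun t ht => ?_⟩
    rw [exp_add, exp_log hc, hL.2 _ (h1 t ht), hg t ht]
  rw [dArg_eq hab hL, dArg_eq (by linarith) hM]
  simp only [sub_sub_cancel, sub_im, add_im]
  ring

theorem dArg_const_mul {f g : ℝ → ℂ} {a b : ℝ} {c : ℂ} (hc : c ≠ 0) (hab : a ≤ b)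
    (hf : ContinuousOn f (Set.Icc a b)) (h0 : ∀ t ∈ Set.Icc a b, f t ≠ 0)
    (hg : ∀ t ∈ Set.Icc a b, g t = c * f t) : dArg g a b = dArg f a b := by
  obtain ⟨L, hL⟩ := exists_isLift hab hf h0
  have hM : IsLift g a b (fun t => log c + L t) := by
    refine ⟨continuousOn_const.add hL.1, fun t ht => ?_⟩
    rw [exp_add, exp_log hc, hL.2 _ ht, hg t ht]
  rw [dArg_eq hab hL, dArg_eq hab hM]
  simp only [sub_im, add_im]
  ring

theorem dArg_slit {f : ℝ → ℂ} {a b : ℝ} (hab : a ≤ b) (hf : ContinuousOn f (Set.Icc a b))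
    (h0 : ∀ t ∈ Set.Icc a b, f t ∈ slitPlane) :
    dArg f a b = (arg (f b) - arg (f a)) / (2 * Real.pi) := by
  have hL : IsLift f a b (fun t => log (f t)) :=
    ⟨hf.clog h0, fun t ht => exp_log (slitPlane_ne_zero (h0 t ht))⟩
  rw [dArg_eq hab hL]
  simp [log_im]

theorem exists_lift2 (F : ℝ × ℝ → ℂ) (hF : Continuous F) (h0 : ∀ x, F x ≠ 0) :
    ∃ L : ℝ × ℝ → ℂ, Continuous L ∧ ∀ x, exp (L x) = F x :=
  exists_log_lift F hF h0

/-- square lemma. -/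
theorem dArg_square {f γ : ℝ → ℂ} {a b c d : ℝ} (hab : a ≤ b) (hcd : c ≤ d)
    (hf : ContinuousOn f (Set.Icc a b)) (hγ : ContinuousOn γ (Set.Icc c d))
    (h0 : ∀ t ∈ Set.Icc a b, ∀ s ∈ Set.Icc c d, f t ≠ γ s) :
    dArg (fun t => f t - γ d) a b - dArg (fun t => f t - γ c) a b =
      dArg (fun s => f b - γ s) c d - dArg (fun s => f a - γ s) c d := by
  have hf' := (continuousOn_iff_continuous_domRestrict.1 hf).Icc_extend' (h := hab)
  have hγ' := (continuousOn_iff_continuous_domRestrict.1 hγ).Icc_extend' (h := hcd)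
  obtain ⟨L, hL, hL2⟩ := exists_lift2 (fun x => Set.IccExtend hab (Set.Icc a b |>.domRestrict f) x.1 -
    Set.IccExtend hcd (Set.Icc c d |>.domRestrict γ) x.2)
    ((hf'.comp continuous_fst).sub (hγ'.comp continuous_snd))
    (fun x => sub_ne_zero.2 (h0 _ (Subtype.mem _) _ (Subtype.mem _)))
  have e : ∀ t ∈ Set.Icc a b, ∀ s ∈ Set.Icc c d, exp (L (t, s)) = f t - γ s := by
    intro t ht s hs
    rw [hL2]
    simp only
    rw [Set.IccExtend_of_mem _ _ ht, Set.IccExtend_of_mem _ _ hs]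
    rfl
  have ha := Set.left_mem_Icc.2 hab
  have hb := Set.right_mem_Icc.2 hab
  have hc := Set.left_mem_Icc.2 hcd
  have hd := Set.right_mem_Icc.2 hcd
  rw [dArg_eq (L := fun t => L (t, d)) hab ⟨by fun_prop, fun t ht => e t ht d hd⟩,
    dArg_eq (L := fun t => L (t, c)) hab ⟨by fun_prop, fun t ht => e t ht c hc⟩,
    dArg_eq (L := fun s => L (b, s)) hcd ⟨by fun_prop, fun s hs => e b hb s hs⟩,
    dArg_eq (L := fun s => L (a, s)) hcd ⟨by fun_prop, fun s hs => e a ha s hs⟩]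
  simp only [sub_im]
  ring

end PartG1

end

section

set_option linter.unusedSectionVars false
set_option linter.unusedVariables false
set_option linter.unusedSimpArgs false

section PartG2

open Complex

theorem pv_identity {e : ℝ → ℂ} (hc : Continuous e)
    (hinj : ∀ s ∈ Set.Icc (0:ℝ) 1, ∀ t ∈ Set.Icc (0:ℝ) 1, e s = e t → s = t) {c0 c1 : ℂ}
    (h0 : ∀ s ∈ Set.Icc (0:ℝ) (1/6), e (s + 1/6) - e s = c0)
    (h1 : ∀ s ∈ Set.Icc (2/3:ℝ) (5/6), e (s + 1/6) - e s = c1) :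
    dArg (fun s => e 0 - e s) (1/6) (5/6) - dArg (fun s => e 1 - e s) (1/6) (5/6) =
      dArg (fun t => e t - e (1/6)) (1/3) 1 + dArg (fun t => e (1 - t) - e (5/6)) (1/3) 1 := by
  obtain ⟨A, hA, hA2⟩ := exists_lift2 (fun x => e (max (max 0 (min x.1 (5/6)) + 1/6) (min x.2 1)) -
    e (max 0 (min x.1 (5/6)))) (by fun_prop) (by
      intro x hx
      have h3 := hinj _ ⟨?_, ?_⟩ _ ⟨?_, ?_⟩ (sub_eq_zero.1 hx)
      · have : max 0 (min x.1 (5/6)) + 1/6 ≤ max 0 (min x.1 (5/6)) := by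
          conv_rhs => rw [← h3]
          exact le_max_left _ _
        linarith
      · exact le_max_of_le_left (by have := le_max_left 0 (min x.1 (5/6)); linarith)
      · apply max_le _ (min_le_right _ _)
        have : max 0 (min x.1 (5/6)) ≤ 5/6 := max_le (by norm_num) (min_le_right _ _)
        linarith
      · exact le_max_left _ _
      · exact max_le (by norm_num) ((min_le_right _ _).trans (by norm_num)))
  have hA3 : ∀ s t, 0 ≤ s → s + 1/6 ≤ t → t ≤ 1 → exp (A (s, t)) = e t - e s := by
    intro s t hs hst ht
    rw [hA2]
    simp only
    rw [min_eq_left (by linarith : s ≤ 5/6), max_eq_right hs, min_eq_left ht, max_eq_right hst]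
  have hneg : ∀ s t, 0 ≤ s → s + 1/6 ≤ t → t ≤ 1 → exp (A (s, t) + Real.pi * I) = e s - e t := by
    intro s t hs hst ht
    rw [exp_add, hA3 s t hs hst ht, exp_pi_mul_I]; ring
  have hdiag : ∀ (a b : ℝ) (c : ℂ), a ≤ b → 0 ≤ a → b ≤ 5/6 →
      (∀ s ∈ Set.Icc a b, e (s + 1/6) - e s = c) →
      (A (b, b + 1/6)).im = (A (a, a + 1/6)).im := by
    intro a b c hab ha hb hcs
    have l1 : IsLift (fun _ => c) a b (fun s => A (s, s + 1/6)) :=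
      ⟨by fun_prop, fun s hs => by
        rw [hA3 s (s+1/6) (ha.trans hs.1) le_rfl (by linarith [hs.2])]
        exact hcs s hs⟩
    have hc0 : c ≠ 0 := by
      have : exp (A (a, a + 1/6)) = c := l1.2 a (Set.left_mem_Icc.2 hab)
      rw [← this]; exact exp_ne_zero _
    have l2 : IsLift (fun _ => c) a b (fun s => log c) :=
      ⟨continuousOn_const, fun s hs => exp_log hc0⟩
    have := l1.const hab l2
    simp only [sub_im, sub_self, zero_im] at this
    linarith
  have d1 := hdiag 0 (1/6) c0 (by norm_num) le_rfl (by norm_num) h0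
  have d2 := hdiag (2/3) (5/6) c1 (by norm_num) (by norm_num) le_rfl h1
  rw [dArg_eq (L := fun s => A (0, s) + Real.pi * I) (by norm_num)
      ⟨by fun_prop, fun s hs => hneg 0 s le_rfl (by linarith [hs.1]) (by linarith [hs.2])⟩,
    dArg_eq (L := fun s => A (s, 1)) (by norm_num)
      ⟨by fun_prop, fun s hs => hA3 s 1 (by linarith [hs.1]) (by linarith [hs.2]) le_rfl⟩,
    dArg_eq (L := fun t => A (1/6, t)) (by norm_num)
      ⟨by fun_prop, fun t ht => hA3 (1/6) t (by norm_num) (by linarith [ht.1]) (by linarith [ht.2])⟩,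
    dArg_eq (L := fun t => A (1 - t, 5/6) + Real.pi * I) (by norm_num)
      ⟨by fun_prop, fun t ht => hneg (1 - t) (5/6) (by linarith [ht.2]) (by linarith [ht.1])
        (by norm_num)⟩]
  norm_num at d1 d2
  norm_num
  rw [← add_div, ← sub_div]
  congr 1
  linarith

variable {V : Type} [Fintype V] [DecidableEq V]

structure Arms (G : SimpleGraph V) where
  pos : V → ℂ
  h : G.Dart → ℝ → ℂ
  u : G.Dart → ℂ
  r : ℝ
  r_pos : 0 < r
  norm_u : ∀ d, ‖u d‖ = 3 * r
  h_cont : ∀ d, Continuous (h d)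
  h_mid : ∀ d, h d (1/2) = h d.symm (1/2)
  h_lin : ∀ d, ∀ t ∈ Set.Icc (0:ℝ) (1/3), h d t = pos d.fst + t * u d
  h_inj : ∀ d d', ∀ t ∈ Set.Icc (0:ℝ) (1/2), ∀ t' ∈ Set.Icc (0:ℝ) (1/2), h d t = h d' t' →
    t = t' ∧ (d = d' ∨ (t = 0 ∧ d.fst = d'.fst) ∨ (t = 1/2 ∧ d' = d.symm))
  h_far : ∀ d, ∀ t ∈ Set.Icc (0:ℝ) (1/2), ∀ w, (1/3 ≤ t ∨ w ≠ d.fst) → r ≤ ‖h d t - pos w‖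

namespace Arms

variable {G : SimpleGraph V} (M : Arms G)

noncomputable def e (d : G.Dart) (t : ℝ) : ℂ := if t ≤ 1/2 then M.h d t else M.h d.symm (1 - t)

theorem e_cont (d : G.Dart) : Continuous (M.e d) := by
  unfold e
  apply Continuous.if_le (M.h_cont d) ((M.h_cont _).comp (by fun_prop)) continuous_id continuous_const
  rintro t rfl
  rw [M.h_mid]; norm_num

theorem e_of_le {d : G.Dart} {t : ℝ} (ht : t ≤ 1/2) : M.e d t = M.h d t := if_pos ht

theorem e_of_ge {d : G.Dart} {t : ℝ} (ht : 1/2 ≤ t) : M.e d t = M.h d.symm (1 - t) := by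
  rcases eq_or_lt_of_le ht with h | h
  · subst h; rw [M.e_of_le le_rfl, M.h_mid]; norm_num
  · exact if_neg (not_le.2 h)

theorem e_symm (d : G.Dart) (t : ℝ) : M.e d.symm t = M.e d (1 - t) := by
  rcases le_total t (1/2) with h | h
  · rw [M.e_of_le h, M.e_of_ge (by linarith)]; congr 1; ring
  · rw [M.e_of_ge h, M.e_of_le (by linarith), SimpleGraph.Dart.symm_symm]

theorem e_zero (d : G.Dart) : M.e d 0 = M.pos d.fst := by
  rw [M.e_of_le (by norm_num), M.h_lin d 0 (by norm_num)]; simp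

theorem e_one (d : G.Dart) : M.e d 1 = M.pos d.snd := by
  have := M.e_symm d 0
  rw [M.e_zero, sub_zero] at this
  exact this.symm

theorem e_lin (d : G.Dart) {t : ℝ} (ht : t ∈ Set.Icc (0:ℝ) (1/3)) :
    M.e d t = M.pos d.fst + t * M.u d := by
  rw [M.e_of_le (by linarith [ht.2]), M.h_lin d t ht]

theorem fst_ne_snd (d : G.Dart) : d.fst ≠ d.snd := d.adj.ne

theorem symm_ne' (d : G.Dart) : d.symm ≠ d := d.symm_ne

theorem e_inj (d : G.Dart) : ∀ s ∈ Set.Icc (0:ℝ) 1, ∀ t ∈ Set.Icc (0:ℝ) 1,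
    M.e d s = M.e d t → s = t := by
  have key : ∀ s ∈ Set.Icc (0:ℝ) 1, ∀ t ∈ Set.Icc (0:ℝ) 1, s ≤ 1/2 → 1/2 ≤ t →
      M.e d s = M.e d t → s = t := by
    intro s hs t ht h1 h2 h
    rw [M.e_of_le h1, M.e_of_ge h2] at h
    obtain ⟨h3, h4⟩ := M.h_inj _ _ s ⟨hs.1, h1⟩ (1-t) ⟨by linarith [ht.2], by linarith⟩ h
    rcases h4 with h4 | h4 | h4
    · exact absurd h4.symm d.symm_ne
    · exact absurd h4.2 d.adj.ne
    · linarith [h4.1]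
  intro s hs t ht h
  rcases le_total s (1/2) with h1 | h1 <;> rcases le_total t (1/2) with h2 | h2
  · rw [M.e_of_le h1, M.e_of_le h2] at h
    exact (M.h_inj _ _ s ⟨hs.1, h1⟩ t ⟨ht.1, h2⟩ h).1
  · exact key s hs t ht h1 h2 h
  · exact (key t ht s hs h2 h1 h.symm).symm
  · rw [M.e_of_ge h1, M.e_of_ge h2] at h
    have := (M.h_inj _ _ (1-s) ⟨by linarith [hs.2], by linarith⟩ (1-t)
      ⟨by linarith [ht.2], by linarith⟩ h).1
    linarith

theorem h_ne_e {d d' : G.Dart} (h1 : d' ≠ d) (h2 : d' ≠ d.symm) {t s : ℝ}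
    (ht : t ∈ Set.Icc (0:ℝ) (1/2)) (hs : s ∈ Set.Ioo (0:ℝ) 1) : M.h d' t ≠ M.e d s := by
  intro h
  rcases le_total s (1/2) with h3 | h3
  · rw [M.e_of_le h3] at h
    obtain ⟨h4, h5⟩ := M.h_inj _ _ t ht s ⟨hs.1.le, h3⟩ h
    rcases h5 with h5 | h5 | h5
    · exact h1 h5
    · linarith [h5.1, hs.1]
    · apply h2; rw [h5.2, SimpleGraph.Dart.symm_symm]
  · rw [M.e_of_ge h3] at h
    obtain ⟨h4, h5⟩ := M.h_inj _ _ t ht (1-s) ⟨by linarith [hs.2], by linarith⟩ h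
    rcases h5 with h5 | h5 | h5
    · exact h2 h5
    · linarith [h5.1, hs.2]
    · apply h1; rw [← SimpleGraph.Dart.symm_symm d', ← h5.2, SimpleGraph.Dart.symm_symm]

theorem e_far (d : G.Dart) {t : ℝ} (ht : t ∈ Set.Icc (1/3:ℝ) 1) :
    M.r ≤ ‖M.e d t - M.pos d.fst‖ := by
  rcases le_total t (1/2) with h | h
  · rw [M.e_of_le h]
    exact M.h_far d t ⟨by linarith [ht.1], h⟩ _ (Or.inl ht.1)
  · rw [M.e_of_ge h]
    exact M.h_far _ (1-t) ⟨by linarith [ht.2], by linarith⟩ _ (Or.inr d.adj.ne)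

variable [DecidableRel G.Adj]

noncomputable def PV (d : G.Dart) : ℝ := dArg (fun t => M.e d t - M.e d (1/6)) (1/3) 1

/-- the two-sided mean of the potential at the point of parameter `1/6` on `d`. -/
noncomputable def N0 (z : G.Dart → ℝ) (d : G.Dart) : ℝ :=
  ∑ d' with d' ≠ d ∧ d' ≠ d.symm, z d' * dArg (fun t => M.h d' t - M.e d (1/6)) 0 (1/2) +
    z d * M.PV d

theorem telescope {z : G.Dart → ℝ} (hz : ∀ d, z d.symm = - z d)
    (hcons : ∀ x, ∑ d with d.fst = x, z d = 0) (T : ℂ → ℝ) (S : Finset G.Dart)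
    (hS : ∀ d ∈ S, d.symm ∈ S) :
    ∑ d ∈ S, z d * (T (M.h d (1/2)) - T (M.pos d.fst)) = ∑ d ∈ Sᶜ, z d * T (M.pos d.fst) := by
  have h1 : ∑ d ∈ S, z d * T (M.h d (1/2)) = - ∑ d ∈ S, z d * T (M.h d (1/2)) := by
    conv_lhs => rw [Finset.sum_bij' (t := S) (g := fun d => z d.symm * T (M.h d.symm (1/2)))
      (fun d _ => d.symm) (fun d _ => d.symm) hS hS (fun d _ => d.symm_symm)
      (fun d _ => d.symm_symm) (fun d _ => by rw [d.symm_symm])]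
    rw [← Finset.sum_neg_distrib]
    apply Finset.sum_congr rfl
    intro d _
    rw [hz, ← M.h_mid]; ring
  have h2 : ∑ d, z d * T (M.pos d.fst) = 0 := by
    rw [← Finset.sum_fiberwise (g := fun d : G.Dart => d.fst)]
    apply Finset.sum_eq_zero
    intro x _
    have : ∑ d with d.fst = x, z d * T (M.pos d.fst) = ∑ d with d.fst = x, z d * T (M.pos x) := by
      apply Finset.sum_congr rfl
      intro d hd
      rw [(Finset.mem_filter.1 hd).2]
    rw [this, ← Finset.sum_mul, hcons, zero_mul]
  rw [← Finset.sum_add_sum_compl S] at h2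
  simp only [mul_sub, Finset.sum_sub_distrib]
  linarith

theorem N0_symm {z : G.Dart → ℝ} (hz : ∀ d, z d.symm = - z d)
    (hcons : ∀ x, ∑ d with d.fst = x, z d = 0) (d : G.Dart) : M.N0 z d.symm = M.N0 z d := by
  have hS : (Finset.univ.filter fun d' : G.Dart => d' ≠ d.symm ∧ d' ≠ d.symm.symm) =
      Finset.univ.filter fun d' : G.Dart => d' ≠ d ∧ d' ≠ d.symm := by
    ext d'; simp only [Finset.mem_filter, Finset.mem_univ, true_and, d.symm_symm]; tauto
  unfold N0
  rw [hS]
  set S := Finset.univ.filter fun d' : G.Dart => d' ≠ d ∧ d' ≠ d.symm with hSdef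
  have he : M.e d.symm (1/6) = M.e d (5/6) := by rw [M.e_symm]; norm_num
  rw [he]
  have hsq : ∀ d' ∈ S, dArg (fun t => M.h d' t - M.e d (5/6)) 0 (1/2) -
      dArg (fun t => M.h d' t - M.e d (1/6)) 0 (1/2) =
      dArg (fun s => M.h d' (1/2) - M.e d s) (1/6) (5/6) -
      dArg (fun s => M.pos d'.fst - M.e d s) (1/6) (5/6) := by
    intro d' hd'
    have h1 := (Finset.mem_filter.1 hd').2
    rw [dArg_square (f := M.h d') (γ := M.e d) (by norm_num) (by norm_num)
      (M.h_cont _).continuousOn (M.e_cont _).continuousOn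
      (fun t ht s hs => M.h_ne_e h1.1 h1.2 ht ⟨by linarith [hs.1], by linarith [hs.2]⟩),
      M.h_lin d' 0 (by norm_num)]
    simp
  have htel := M.telescope hz hcons (fun q => dArg (fun s => q - M.e d s) (1/6) (5/6)) S (by
    intro d' hd'
    simp only [hSdef, Finset.mem_filter, Finset.mem_univ, true_and] at hd' ⊢
    refine ⟨fun h => hd'.2 ?_, fun h => hd'.1 ?_⟩
    · rw [← h, d'.symm_symm]
    · rw [← d'.symm_symm, h, d.symm_symm])
  have hcompl : Sᶜ = {d, d.symm} := by
    ext d'; simp only [hSdef, Finset.mem_compl, Finset.mem_filter, Finset.mem_univ, true_and,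
      Finset.mem_insert, Finset.mem_singleton]; tauto
  rw [hcompl, Finset.sum_pair d.symm_ne.symm, hz] at htel
  have hpv := pv_identity (M.e_cont d) (M.e_inj d) (c0 := M.u d / 6) (c1 := - M.u d.symm / 6)
    (by
      intro s hs
      rw [M.e_lin d ⟨by linarith [hs.1], by linarith [hs.2]⟩,
        M.e_lin d ⟨by linarith [hs.1], by linarith [hs.2]⟩]
      push_cast; ring)
    (by
      intro s hs
      have e1 : M.e d (s + 1/6) = M.e d.symm (1 - (s + 1/6)) := by rw [M.e_symm]; congr 1; ring
      have e2 : M.e d s = M.e d.symm (1 - s) := by rw [M.e_symm]; congr 1; ring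
      rw [e1, e2, M.e_lin d.symm ⟨by linarith [hs.2], by linarith [hs.1]⟩,
        M.e_lin d.symm ⟨by linarith [hs.2], by linarith [hs.1]⟩]
      push_cast; ring)
  have hPVs : M.PV d.symm = dArg (fun t => M.e d (1 - t) - M.e d (5/6)) (1/3) 1 := by
    unfold PV
    rw [he]
    apply dArg_congr
    intro t _
    rw [M.e_symm]
  rw [← hPVs, M.e_zero, M.e_one] at hpv
  change _ = M.PV d + _ at hpv
  have hsum : ∑ d' ∈ S, z d' * dArg (fun t => M.h d' t - M.e d (5/6)) 0 (1/2) -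
      ∑ d' ∈ S, z d' * dArg (fun t => M.h d' t - M.e d (1/6)) 0 (1/2) =
      ∑ d' ∈ S, z d' * (dArg (fun s => M.h d' (1/2) - M.e d s) (1/6) (5/6) -
      dArg (fun s => M.pos d'.fst - M.e d s) (1/6) (5/6)) := by
    rw [← Finset.sum_sub_distrib]
    apply Finset.sum_congr rfl
    intro d' hd'
    rw [← hsq d' hd']; ring
  rw [htel] at hsum
  have hss : d.symm.fst = d.snd := rfl
  rw [hss] at hsum
  rw [hz]
  have : z d * (dArg (fun s => M.pos d.fst - M.e d s) (1 / 6) (5 / 6) -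
    dArg (fun s => M.pos d.snd - M.e d s) (1 / 6) (5 / 6)) = z d * (M.PV d + M.PV d.symm) := by
    rw [hpv]
  linarith

end Arms

end PartG2

end

section

set_option linter.unusedSectionVars false
set_option linter.unusedVariables false
set_option linter.unusedSimpArgs false

section PartG3

open Complex

theorem exp_sgn_im (x : ℝ) : (exp (x * I)).im = Real.sin x := by
  rw [exp_ofReal_mul_I_im]

theorem near_slit {θ ς : ℝ} (hθ : θ ∈ Set.Ioo 0 (2 * Real.pi)) (hς : ς = 1 ∨ ς = -1) {τ : ℝ}
    (hτ : 0 ≤ τ) : (τ : ℂ) - exp ((ς * θ : ℝ) * I) ∈ slitPlane := by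
  rw [mem_slitPlane_iff]
  by_cases hs : Real.sin θ = 0
  · left
    have hp : θ = Real.pi := by
      have h1 : Real.sin (θ - Real.pi) = 0 := by rw [Real.sin_sub_pi, hs, neg_zero]
      have := (Real.sin_eq_zero_iff_of_lt_of_lt (by linarith [hθ.1]) (by linarith [hθ.2])).1 h1
      linarith
    have : Real.cos (ς * θ) = -1 := by
      rcases hς with rfl | rfl <;> simp [hp]
    rw [sub_re, exp_ofReal_mul_I_re, this, ofReal_re]
    linarith
  · right
    rw [sub_im, exp_ofReal_mul_I_im, ofReal_im]
    rcases hς with rfl | rfl <;> simpa using hs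

theorem near_arg {θ ς : ℝ} (hθ : θ ∈ Set.Ioo 0 (2 * Real.pi)) (hς : ς = 1 ∨ ς = -1) :
    arg (-exp ((ς * θ : ℝ) * I)) = ς * (θ - Real.pi) := by
  have h1 : -exp ((ς * θ : ℝ) * I) = exp ((ς * (θ - Real.pi) : ℝ) * I) := by
    have e1 : ((ς * (θ - Real.pi) : ℝ) : ℂ) * I = ((ς * θ : ℝ) : ℂ) * I - ς * (Real.pi * I) := by
      push_cast; ring
    have e2 : exp (ς * (Real.pi * I)) = -1 := by
      rcases hς with rfl | rfl
      · simp [exp_pi_mul_I]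
      · simp [exp_neg, exp_pi_mul_I]
    rw [e1, exp_sub, e2, div_neg, div_one]
  rw [h1, ← log_im, log_exp]
  · simp
  · simp only [mul_im, ofReal_re, I_im, mul_one, ofReal_im, I_re, mul_zero, add_zero]
    rcases hς with rfl | rfl <;> linarith [hθ.1, hθ.2]
  · simp only [mul_im, ofReal_re, I_im, mul_one, ofReal_im, I_re, mul_zero, add_zero]
    rcases hς with rfl | rfl <;> linarith [hθ.1, hθ.2]

theorem two_sub_slit (x : ℝ) : 2 - exp ((x : ℂ) * I) ∈ slitPlane := by
  rw [mem_slitPlane_iff]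
  left
  rw [sub_re, exp_ofReal_mul_I_re]
  have := Real.cos_le_one x
  norm_num
  linarith

variable {V : Type} [Fintype V] [DecidableEq V]

namespace Arms

variable {G : SimpleGraph V} (M : Arms G)

theorem u_ne (d : G.Dart) : M.u d ≠ 0 := by
  intro h
  have := M.norm_u d
  rw [h, norm_zero] at this
  linarith [M.r_pos]

/-- points of the circle of radius `r / 2`. -/
noncomputable def circ (d : G.Dart) (x : ℝ) : ℂ := M.pos d.fst + M.u d / 6 * exp ((x : ℂ) * I)

theorem circ_cont (d : G.Dart) : Continuous (M.circ d) := by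
  unfold circ; fun_prop

theorem circ_norm (d : G.Dart) (x : ℝ) : ‖M.circ d x - M.pos d.fst‖ = M.r / 2 := by
  unfold circ
  rw [add_sub_cancel_left, norm_mul, norm_exp_ofReal_mul_I, norm_div, M.norm_u]
  norm_num
  ring

theorem circ_zero (d : G.Dart) : M.circ d 0 = M.e d (1/6) := by
  rw [M.e_lin d (by norm_num)]
  unfold circ
  push_cast
  simp
  ring

theorem e_sub_circ (d : G.Dart) {t : ℝ} (ht : t ∈ Set.Icc (0:ℝ) (1/3)) (x : ℝ) :
    M.e d t - M.circ d x = M.u d / 6 * (((6 * t : ℝ) : ℂ) - exp ((x : ℂ) * I)) := by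
  rw [M.e_lin d ht, circ]; push_cast; ring

theorem e_far_circ (d : G.Dart) {t : ℝ} (ht : t ∈ Set.Icc (1/3:ℝ) 1) (x : ℝ) :
    M.e d t ≠ M.circ d x := by
  intro h
  have := M.e_far d ht
  rw [h, M.circ_norm] at this
  linarith [M.r_pos]

theorem e_ne_circ (d : G.Dart) {θ ς : ℝ} (hθ : θ ∈ Set.Ioo 0 (2 * Real.pi)) (hς : ς = 1 ∨ ς = -1)
    {t : ℝ} (ht : t ∈ Set.Icc (0:ℝ) 1) : M.e d t - M.circ d (ς * θ) ≠ 0 := by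
  rcases le_total t (1/3) with h | h
  · rw [M.e_sub_circ d ⟨ht.1, h⟩]
    exact mul_ne_zero (div_ne_zero (M.u_ne d) (by norm_num))
      (slitPlane_ne_zero (near_slit hθ hς (by linarith [ht.1])))
  · exact sub_ne_zero.2 (M.e_far_circ d ⟨h, ht.2⟩ _)

theorem star (d : G.Dart) {θ ς : ℝ} (hθ : θ ∈ Set.Ioo 0 (2 * Real.pi)) (hς : ς = 1 ∨ ς = -1) :
    dArg (fun t => M.e d t - M.circ d (ς * θ)) 0 1 - M.PV d + ς * θ / (2 * Real.pi) -
      dArg (fun s => M.pos d.snd - M.circ d (ς * s)) 0 θ = ς / 2 := by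
  have hu6 : M.u d / 6 ≠ 0 := div_ne_zero (M.u_ne d) (by norm_num)
  have hθ0 : (0:ℝ) ≤ θ := hθ.1.le
  have hpi := Real.pi_pos
  have e1 := dArg_add (f := fun t => M.e d t - M.circ d (ς * θ)) (a := 0) (b := 1/3) (c := 1)
    (by norm_num) (by norm_num) ((M.e_cont d).sub continuous_const).continuousOn
    (fun t ht => M.e_ne_circ d hθ hς ht)
  have e2 : dArg (fun t => M.e d t - M.circ d (ς * θ)) 0 (1/3) =
      dArg (fun t => ((6 * t : ℝ) : ℂ) - exp ((ς * θ : ℝ) * I)) 0 (1/3) :=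
    dArg_const_mul hu6 (by norm_num) (by fun_prop)
      (fun t ht => slitPlane_ne_zero (near_slit hθ hς (by linarith [ht.1])))
      (fun t ht => M.e_sub_circ d ht _)
  have e3 : dArg (fun t => ((6 * t : ℝ) : ℂ) - exp ((ς * θ : ℝ) * I)) 0 (1/3) =
      (arg (2 - exp ((ς * θ : ℝ) * I)) - ς * (θ - Real.pi)) / (2 * Real.pi) := by
    rw [dArg_slit (by norm_num) (by fun_prop) (fun t ht => near_slit hθ hς (by linarith [ht.1])),
      ← near_arg hθ hς]
    norm_num
  have hγ : Continuous (fun s => M.circ d (ς * s)) := (M.circ_cont d).comp (by fun_prop)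
  have e4 := dArg_square (f := M.e d) (γ := fun s => M.circ d (ς * s)) (a := 1/3) (b := 1)
    (by norm_num) hθ0 (M.e_cont d).continuousOn hγ.continuousOn
    (fun t ht s hs => M.e_far_circ d ht _)
  have e5 : dArg (fun s => M.e d (1/3) - M.circ d (ς * s)) 0 θ =
      dArg (fun s : ℝ => 2 - exp ((ς * s : ℝ) * I)) 0 θ :=
    dArg_const_mul hu6 hθ0 (by fun_prop)
      (fun s hs => slitPlane_ne_zero (two_sub_slit _))
      (fun s hs => by rw [M.e_sub_circ d (by norm_num)]; norm_num)
  have e6 : dArg (fun s : ℝ => 2 - exp ((ς * s : ℝ) * I)) 0 θ =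
      arg (2 - exp ((ς * θ : ℝ) * I)) / (2 * Real.pi) := by
    rw [dArg_slit hθ0 (by fun_prop) (fun s hs => two_sub_slit _)]
    norm_num
  simp only [mul_zero, M.circ_zero, M.e_one] at e4
  change _ - M.PV d = _ at e4
  rw [e1, e2, e3]
  rw [e5, e6] at e4
  have e7 : dArg (fun t => M.e d t - M.circ d (ς * θ)) (1/3) 1 = M.PV d +
    (dArg (fun s => M.pos d.snd - M.circ d (ς * s)) 0 θ - arg (2 - exp ((ς * θ : ℝ) * I)) / (2 * Real.pi)) := by
    linarith
  rw [e7]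
  field_simp
  ring

theorem dArg_e_split (d : G.Dart) (p : ℂ) (hp : ∀ t ∈ Set.Icc (0:ℝ) 1, M.e d t - p ≠ 0) :
    dArg (fun t => M.e d t - p) 0 1 = dArg (fun t => M.h d t - p) 0 (1/2) -
      dArg (fun t => M.h d.symm t - p) 0 (1/2) := by
  rw [dArg_add (f := fun t => M.e d t - p) (b := 1/2) (by norm_num) (by norm_num)
    ((M.e_cont d).sub continuous_const).continuousOn hp]
  have e1 : dArg (fun t => M.e d t - p) 0 (1/2) = dArg (fun t => M.h d t - p) 0 (1/2) :=
    dArg_congr (fun t ht => by rw [M.e_of_le ht.2])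
  have e2 := dArg_rev (f := fun t => M.h d.symm t - p) (g := fun t => M.e d t - p) (a := 0)
    (b := 1/2) (s := 1) (c := 1) one_ne_zero (by norm_num)
    ((M.h_cont d.symm).sub continuous_const).continuousOn
    (by
      intro t ht
      have := hp (1 - t) ⟨by linarith [ht.2], by linarith [ht.1]⟩
      rw [M.e_of_ge (by linarith [ht.2])] at this
      simpa using this)
    (by
      intro t ht
      rw [M.e_of_ge (by linarith [ht.1])]
      simp)
  norm_num at e1 e2 ⊢
  rw [e1, e2]; ring

variable [DecidableRel G.Adj]

theorem N0_step {z : G.Dart → ℝ} (hz : ∀ d, z d.symm = - z d)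
    (hcons : ∀ x, ∑ d with d.fst = x, z d = 0) {d d₂ : G.Dart} (hx : d₂.fst = d.fst)
    (hne : d₂ ≠ d) {θ : ℝ} (hθ : θ ∈ Set.Ioo 0 (2 * Real.pi))
    (hu : M.u d₂ = M.u d * exp (θ * I))
    (hbet : ∀ d', d'.fst = d.fst → ∀ s ∈ Set.Icc 0 θ, M.u d' = M.u d * exp (s * I) →
      d' = d ∨ d' = d₂) :
    M.N0 z d₂ - M.N0 z d = (z d + z d₂) / 2 := by
  have hθ0 : (0:ℝ) ≤ θ := hθ.1.le
  have hpi := Real.pi_pos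
  have hns1 : d₂ ≠ d.symm := by
    rintro rfl; exact d.adj.ne hx.symm
  have hns2 : d₂.symm ≠ d := by
    intro h; apply hns1; rw [← h, d₂.symm_symm]
  have hns3 : d₂.symm ≠ d.symm := by
    intro h; apply hne; rw [← d₂.symm_symm, h, d.symm_symm]
  have hp2 : M.e d₂ (1/6) = M.circ d θ := by
    rw [← M.circ_zero, circ, circ, hx, hu]; push_cast; simp; ring
  have hp1 : M.e d (1/6) = M.circ d₂ (-θ) := by
    rw [← M.circ_zero, circ, circ, hx, hu]; push_cast
    have : exp ((θ:ℂ) * I) * exp (-(θ:ℂ) * I) = 1 := by rw [← exp_add]; simp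
    rw [zero_mul, exp_zero]
    linear_combination (-M.u d / 6) * this
  obtain ⟨S, hS⟩ : ∃ S : Finset G.Dart, S = Finset.univ.filter fun d' : G.Dart =>
    (d' ≠ d ∧ d' ≠ d.symm) ∧ (d' ≠ d₂ ∧ d' ≠ d₂.symm) := ⟨_, rfl⟩
  have hS1 : (Finset.univ.filter fun d' : G.Dart => d' ≠ d ∧ d' ≠ d.symm) =
      insert d₂ (insert d₂.symm S) := by
    ext d'; simp only [hS, Finset.mem_filter, Finset.mem_univ, true_and, Finset.mem_insert]
    constructor
    · intro h; tauto
    · rintro (rfl | rfl | h)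
      · exact ⟨hne, hns1⟩
      · exact ⟨hns2, hns3⟩
      · exact h.1
  have hS2 : (Finset.univ.filter fun d' : G.Dart => d' ≠ d₂ ∧ d' ≠ d₂.symm) =
      insert d (insert d.symm S) := by
    ext d'; simp only [hS, Finset.mem_filter, Finset.mem_univ, true_and, Finset.mem_insert]
    constructor
    · intro h; tauto
    · rintro (rfl | rfl | h)
      · exact ⟨hne.symm, hns2.symm⟩
      · exact ⟨hns1.symm, hns3.symm⟩
      · exact h.2
  have m1 : d₂ ∉ insert d₂.symm S := by
    simp [hS, d₂.symm_ne.symm]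
  have m2 : d₂.symm ∉ S := by simp [hS]
  have m3 : d ∉ insert d.symm S := by
    simp [hS, d.symm_ne.symm]
  have m4 : d.symm ∉ S := by simp [hS]
  have hcompl : Sᶜ = insert d (insert d.symm (insert d₂ {d₂.symm})) := by
    ext d'; simp only [hS, Finset.mem_compl, Finset.mem_filter, Finset.mem_univ, true_and,
      Finset.mem_insert, Finset.mem_singleton]; tauto
  have htel := M.telescope hz hcons (fun q => dArg (fun s => q - M.circ d s) 0 θ) S (by
    intro d' hd'
    simp only [hS, Finset.mem_filter, Finset.mem_univ, true_and] at hd' ⊢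
    refine ⟨⟨fun h => hd'.1.2 ?_, fun h => hd'.1.1 ?_⟩, ⟨fun h => hd'.2.2 ?_, fun h => hd'.2.1 ?_⟩⟩
    · rw [← h, d'.symm_symm]
    · rw [← d'.symm_symm, h, d.symm_symm]
    · rw [← h, d'.symm_symm]
    · rw [← d'.symm_symm, h, d₂.symm_symm])
  rw [hcompl, Finset.sum_insert (by simp [d.symm_ne.symm, hne.symm, hns2.symm]),
    Finset.sum_insert (by simp [hns1.symm, hns3.symm]),
    Finset.sum_pair d₂.symm_ne.symm, hz, hz] at htel
  have hc1 : ∀ x : G.Dart, x.symm.fst = x.snd := fun _ => rfl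
  rw [hc1, hc1, hx] at htel
  have hsq : ∀ d' ∈ S, dArg (fun t => M.h d' t - M.circ d θ) 0 (1/2) -
      dArg (fun t => M.h d' t - M.e d (1/6)) 0 (1/2) =
      dArg (fun s => M.h d' (1/2) - M.circ d s) 0 θ -
      dArg (fun s => M.pos d'.fst - M.circ d s) 0 θ := by
    intro d' hd'
    rw [hS] at hd'
    obtain ⟨⟨h1, h2⟩, h3, h4⟩ := (Finset.mem_filter.1 hd').2
    have := dArg_square (f := M.h d') (γ := M.circ d) (a := 0) (b := 1/2) (by norm_num) hθ0
      (M.h_cont _).continuousOn (M.circ_cont d).continuousOn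
      (by
        intro t ht s hs heq
        have hn := M.circ_norm d s
        rw [← heq] at hn
        have hcase : t < 1/3 ∧ d.fst = d'.fst := by
          by_contra hcon
          have := M.h_far d' t ht d.fst (by
            by_cases ht3 : t < 1/3
            · right; intro h; exact hcon ⟨ht3, h⟩
            · left; linarith)
          linarith [M.r_pos]
        have hl := M.h_lin d' t ⟨ht.1, hcase.1.le⟩
        rw [hl, hcase.2, add_sub_cancel_left, norm_mul, M.norm_u, norm_real, Real.norm_eq_abs,
          abs_of_nonneg ht.1] at hn
        have ht6 : t = 1/6 := by
          have := M.r_pos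
          have h5 : M.r * (6 * t - 1) = 0 := by linarith
          rcases mul_eq_zero.1 h5 with h6 | h6 <;> linarith
        rw [hl, circ, hcase.2, ht6] at heq
        have hud : M.u d' = M.u d * exp (s * I) := by
          have := add_left_cancel heq
          push_cast at this
          linear_combination 6 * this
        rcases hbet d' hcase.2.symm s hs hud with h | h
        · exact h1 h
        · exact h3 h)
    rw [M.circ_zero, M.h_lin d' 0 (by norm_num)] at this
    simpa using this
  have hsum : ∑ d' ∈ S, z d' * dArg (fun t => M.h d' t - M.circ d θ) 0 (1/2) -
      ∑ d' ∈ S, z d' * dArg (fun t => M.h d' t - M.e d (1/6)) 0 (1/2) =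
      ∑ d' ∈ S, z d' * (dArg (fun s => M.h d' (1/2) - M.circ d s) 0 θ -
      dArg (fun s => M.pos d'.fst - M.circ d s) 0 θ) := by
    rw [← Finset.sum_sub_distrib]
    apply Finset.sum_congr rfl
    intro d' hd'
    rw [← hsq d' hd']; ring
  rw [htel] at hsum
  have hTx : dArg (fun s => M.pos d.fst - M.circ d s) 0 θ = θ / (2 * Real.pi) := by
    have hu6 : -(M.u d / 6) ≠ 0 := neg_ne_zero.2 (div_ne_zero (M.u_ne d) (by norm_num))
    rw [dArg_eq (L := fun s : ℝ => log (-(M.u d / 6)) + s * I) hθ0 ⟨by fun_prop, fun s hs => by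
      rw [exp_add, exp_log hu6, circ]; ring⟩]
    simp
  have st1 := M.star d hθ (Or.inl rfl)
  have st2 := M.star d₂ hθ (Or.inr rfl)
  simp only [one_mul, neg_mul] at st1 st2
  have hrev : dArg (fun s => M.pos d₂.snd - M.circ d₂ (-s)) 0 θ =
      - dArg (fun s => M.pos d₂.snd - M.circ d s) 0 θ := by
    have := dArg_rev (f := fun s => M.pos d₂.snd - M.circ d s)
      (g := fun s => M.pos d₂.snd - M.circ d₂ (-s)) (a := 0) (b := θ) (s := θ) (c := 1)
      one_ne_zero hθ0 ((continuous_const.sub (M.circ_cont d))).continuousOn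
      (by
        intro s hs h
        have h1 := M.e_far d₂ (t := 1) (by norm_num)
        have h2 := M.circ_norm d s
        rw [M.e_one, sub_eq_zero.1 h, hx, h2] at h1
        linarith [M.r_pos])
      (by
        intro s hs
        rw [one_mul]
        congr 1
        rw [circ, circ, hx, hu]
        push_cast
        have : exp ((θ:ℂ) * I) * exp (-(s:ℂ) * I) = exp (((θ:ℂ) - s) * I) := by
          rw [← exp_add]; congr 1; ring
        rw [← this]; ring)
    simpa using this
  rw [hrev, ← hp1] at st2
  rw [M.dArg_e_split d _ (fun t ht => by
    have := M.e_ne_circ d hθ (Or.inl rfl) ht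
    rwa [one_mul] at this)] at st1
  rw [M.dArg_e_split d₂ _ (fun t ht => by
    have := M.e_ne_circ d₂ hθ (Or.inr rfl) ht
    rw [neg_one_mul] at this
    rwa [hp1])] at st2
  unfold N0
  rw [hS1, hS2, Finset.sum_insert m1, Finset.sum_insert m2, Finset.sum_insert m3,
    Finset.sum_insert m4, hz, hz, hp2]
  rw [hTx] at hsum
  linear_combination hsum + z d * st1 - z d₂ * st2

end Arms

end PartG3

end

section

set_option linter.unusedSectionVars false
set_option linter.unusedVariables false
set_option linter.unusedSimpArgs false

section PartG4

open Complex

theorem finRotate_sameCycle (k : ℕ) (x y : Fin k) : (finRotate k).SameCycle x y := by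
  match k with
  | 0 => exact x.elim0
  | 1 => rw [Subsingleton.elim x y]
  | n + 2 =>
    have h : ∀ w : Fin (n+2), finRotate (n+2) w ≠ w := by
      intro w
      rw [← Equiv.Perm.mem_support, support_finRotate]; simp
    exact isCycle_finRotate.sameCycle (h x) (h y)

theorem angular_order {S : Type} [Fintype S] (a : S → ℝ) (hinj : Function.Injective a)
    (hr : ∀ i, a i ∈ Set.Ioc (-Real.pi) Real.pi) :
    ∃ σ : Equiv.Perm S, (∀ i j, σ.SameCycle i j) ∧ ∀ i, σ i ≠ i →
      ∃ θ ∈ Set.Ioo 0 (2 * Real.pi), (a (σ i) = a i + θ ∨ a (σ i) = a i + θ - 2 * Real.pi) ∧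
        ∀ j, ∀ s ∈ Set.Icc 0 θ, (a j = a i + s ∨ a j = a i + s - 2 * Real.pi) → j = i ∨ j = σ i := by
  classical
  let _ : LinearOrder S := LinearOrder.lift' a hinj
  have hlt : ∀ i j : S, i < j ↔ a i < a j := fun i j => Iff.rfl
  have hle : ∀ i j : S, i ≤ j ↔ a i ≤ a j := fun i j => Iff.rfl
  obtain ⟨k, hk⟩ : ∃ k, Fintype.card S = k := ⟨_, rfl⟩
  let f : Fin k ≃o S := Fintype.orderIsoFinOfCardEq S hk
  refine ⟨f.toEquiv.permCongr (finRotate k), ?_, ?_⟩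
  · intro i j
    obtain ⟨n, hn⟩ := finRotate_sameCycle k (f.symm i) (f.symm j)
    refine ⟨n, ?_⟩
    have h1 : (f.toEquiv.permCongr (finRotate k)) ^ n = f.toEquiv.permCongr ((finRotate k) ^ n) :=
      (map_zpow f.toEquiv.permCongrHom (finRotate k) n).symm
    rw [h1, Equiv.permCongr_apply]
    have h2 : f.toEquiv.symm i = f.symm i := rfl
    rw [h2, hn]
    exact f.apply_symm_apply j
  · intro i hi
    have hσ : f.toEquiv.permCongr (finRotate k) i = f (finRotate k (f.symm i)) := rfl
    rw [hσ] at hi ⊢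
    obtain ⟨p, hp⟩ : ∃ p, p = f.symm i := ⟨_, rfl⟩
    have hip : i = f p := by rw [hp, f.apply_symm_apply]
    rw [← hp] at hi ⊢
    have hpi := Real.pi_pos
    match k, f, p, hip, hi with
    | 0, f, p, hip, hi => exact p.elim0
    | m + 1, f, p, hip, hi =>
      have r1 := hr i
      have r2 := hr (f (finRotate (m+1) p))
      rcases eq_or_ne p (Fin.last m) with hlast | hlast
      · have hrot : finRotate (m+1) p = 0 := by rw [hlast]; exact finRotate_last
        rw [hrot] at hi r2 ⊢
        have hmin : ∀ j, a (f 0) ≤ a j := by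
          intro j
          rw [← hle, ← f.apply_symm_apply j, f.le_iff_le]
          exact Fin.zero_le _
        have hmax : ∀ j, a j ≤ a i := by
          intro j
          rw [← hle, hip, ← f.apply_symm_apply j, f.le_iff_le, hlast]
          exact Fin.le_last _
        have hlt0 : a (f 0) < a i := lt_of_le_of_ne (hmin i) (fun h => hi (hinj h))
        refine ⟨a (f 0) - a i + 2 * Real.pi, ⟨by linarith [r1.2, r2.1], by linarith⟩,
          Or.inr (by ring), ?_⟩
        rintro j s hs (h | h)
        · left; apply hinj; have := hmax j; linarith [hs.1]
        · right; apply hinj; have := hmin j; linarith [hs.2]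
      · have hval : ((finRotate (m+1) p : Fin (m+1)) : ℕ) = p + 1 := coe_finRotate_of_ne_last hlast
        have hlt0 : a i < a (f (finRotate (m+1) p)) := by
          rw [← hlt, hip, f.lt_iff_lt, Fin.lt_def, hval]; omega
        refine ⟨a (f (finRotate (m+1) p)) - a i, ⟨by linarith, by linarith [r1.1, r2.2]⟩,
          Or.inl (by ring), ?_⟩
        rintro j s hs (h | h)
        · have h1 : a i ≤ a j := by linarith [hs.1]
          have h2 : a j ≤ a (f (finRotate (m+1) p)) := by linarith [hs.2]
          rw [← hle, hip, ← f.apply_symm_apply j, f.le_iff_le, Fin.le_def] at h1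
          rw [← hle, ← f.apply_symm_apply j, f.le_iff_le, Fin.le_def, hval] at h2
          have h3 : (f.symm j : ℕ) = p ∨ (f.symm j : ℕ) = p + 1 := by omega
          rcases h3 with h3 | h3
          · left; rw [hip, ← f.apply_symm_apply j]; congr 1; exact Fin.ext h3
          · right; rw [← f.apply_symm_apply j]; congr 1; apply Fin.ext; rw [h3, hval]
        · exfalso
          have := (hr j).1
          linarith [hs.2, r2.2]

variable {V : Type} [Fintype V] [DecidableEq V]

theorem Arms.u_inj {G : SimpleGraph V} (M : Arms G) {d d' : G.Dart} (h : d.fst = d'.fst)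
    (hu : M.u d = M.u d') : d = d' := by
  have h1 : M.h d (1/6) = M.h d' (1/6) := by
    rw [M.h_lin d _ (by norm_num), M.h_lin d' _ (by norm_num), h, hu]
  rcases (M.h_inj d d' _ (by norm_num) _ (by norm_num) h1).2 with h2 | h2 | h2
  · exact h2
  · norm_num at h2
  · norm_num at h2

theorem Arms.u_eq {G : SimpleGraph V} (M : Arms G) (d : G.Dart) :
    M.u d = (3 * M.r : ℝ) * exp ((arg (M.u d) : ℂ) * I) := by
  rw [← M.norm_u d, norm_mul_exp_arg_mul_I]

theorem Arms.rot {G : SimpleGraph V} [DecidableRel G.Adj] (M : Arms G) : Nonempty (Rot G) := by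
  classical
  have hex := fun x : V => angular_order (S := {d : G.Dart // d.fst = x})
    (fun d => arg (M.u d.1)) (by
      intro d d' h
      apply Subtype.ext
      apply M.u_inj (by rw [d.2, d'.2])
      simp only at h
      rw [M.u_eq d.1, M.u_eq d'.1, h]) (fun d => arg_mem_Ioc _)
  choose τ hτc hτ using hex
  have hdep : ∀ (x : V) (d : G.Dart) (h : d.fst = x), (τ d.fst ⟨d, rfl⟩).1 = (τ x ⟨d, h⟩).1 := by
    rintro x d rfl; rfl
  have hdep' : ∀ (x : V) (d : G.Dart) (h : d.fst = x),
      ((τ d.fst).symm ⟨d, rfl⟩).1 = ((τ x).symm ⟨d, h⟩).1 := by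
    rintro x d rfl; rfl
  let σ : Equiv.Perm G.Dart :=
    { toFun := fun d => (τ d.fst ⟨d, rfl⟩).1
      invFun := fun d => ((τ d.fst).symm ⟨d, rfl⟩).1
      left_inv := by
        intro d
        simp only
        rw [hdep' d.fst _ (τ d.fst ⟨d, rfl⟩).2]
        simp
      right_inv := by
        intro d
        simp only
        rw [hdep d.fst _ ((τ d.fst).symm ⟨d, rfl⟩).2]
        simp }
  have hσ : ∀ d, σ d = (τ d.fst ⟨d, rfl⟩).1 := fun d => rfl
  have hfst : ∀ d, (σ d).fst = d.fst := fun d => (τ d.fst ⟨d, rfl⟩).2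
  have hpow : ∀ (x : V) (d : {d : G.Dart // d.fst = x}) (n : ℕ),
      (σ ^ n) d.1 = ((τ x ^ n) d).1 := by
    intro x d n
    induction n with
    | zero => rfl
    | succ n ih =>
      rw [pow_succ', pow_succ', Equiv.Perm.mul_apply, Equiv.Perm.mul_apply, ih, hσ,
        hdep x _ ((τ x ^ n) d).2]
  have hcyc : ∀ d d', d.fst = d'.fst → σ.SameCycle d d' := by
    intro d d' h
    obtain ⟨n, -, hn⟩ := (hτc d.fst ⟨d, rfl⟩ ⟨d', h.symm⟩).exists_pow_eq'
    refine ⟨n, ?_⟩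
    rw [zpow_natCast, hpow d.fst ⟨d, rfl⟩ n, hn]
  refine ⟨⟨σ, hfst, hcyc, ?_⟩⟩
  intro z hz hcons
  refine ⟨fun d => M.N0 z d - z d / 2, ?_, ?_⟩
  · intro d
    by_cases hd : σ d = d
    · have hz0 : z d = 0 := by
        rw [← hcons d.fst]
        symm
        apply Finset.sum_eq_single_of_mem d (by simp)
        intro d' hd' hne
        exfalso
        apply hne
        obtain ⟨n, hn⟩ := hcyc d d' (Finset.mem_filter.1 hd').2.symm
        rw [← hn]
        exact Equiv.Perm.zpow_apply_eq_self_of_apply_eq_self hd n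
      simp only [hd, hz0]; ring
    · have hne : τ d.fst ⟨d, rfl⟩ ≠ ⟨d, rfl⟩ := fun h => hd (congrArg Subtype.val h)
      obtain ⟨θ, hθ, h1, h2⟩ := hτ d.fst ⟨d, rfl⟩ hne
      have hstep := M.N0_step hz hcons (hfst d) hd hθ (by
          rw [M.u_eq (σ d), M.u_eq d, mul_assoc, ← exp_add]
          congr 1
          rw [exp_eq_exp_iff_exists_int]
          simp only at h1
          rw [← hσ] at h1
          rcases h1 with h1 | h1
          · exact ⟨0, by rw [h1]; push_cast; ring⟩
          · exact ⟨-1, by rw [h1]; push_cast; ring⟩)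
        (by
          intro d' hd' s hs hu
          have h3 : exp ((arg (M.u d') : ℂ) * I) = exp ((arg (M.u d) : ℂ) * I + s * I) := by
            rw [M.u_eq d', M.u_eq d, mul_assoc, ← exp_add] at hu
            exact mul_left_cancel₀ (by
              have := M.r_pos
              exact_mod_cast (by positivity : (3 * M.r) ≠ 0)) hu
          obtain ⟨n, hn⟩ := exp_eq_exp_iff_exists_int.1 h3
          have h4 : arg (M.u d') = arg (M.u d) + s + n * (2 * Real.pi) := by
            have := congrArg Complex.im hn
            simpa using this
          have hpi := Real.pi_pos
          have b1 := arg_mem_Ioc (M.u d')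
          have b2 := arg_mem_Ioc (M.u d)
          have hn1 : n < 1 := by
            by_contra h
            have : (1:ℝ) ≤ n := by exact_mod_cast not_lt.1 h
            nlinarith [b1.1, b1.2, b2.1, b2.2, hs.1, hs.2, hθ.2]
          have hn2 : -2 < n := by
            by_contra h
            have : (n:ℝ) ≤ -2 := by exact_mod_cast not_lt.1 h
            nlinarith [b1.1, b1.2, b2.1, b2.2, hs.1, hs.2, hθ.2]
          have h5 := h2 ⟨d', hd'⟩ s hs (by
            simp only
            have : n = 0 ∨ n = -1 := by omega
            rcases this with rfl | rfl
            · left; rw [h4]; simp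
            · right; rw [h4]; push_cast; ring)
          rcases h5 with h5 | h5
          · left; exact congrArg Subtype.val h5
          · right; exact congrArg Subtype.val h5)
      simp only
      linarith
  · intro d
    simp only
    rw [M.N0_symm hz hcons, hz]; ring

end PartG4

end

section

set_option linter.unusedSectionVars false
set_option linter.unusedVariables false
set_option linter.unusedSimpArgs false

section PartG5

open Complex Filter Topology

/-- the embedding data transported to `ℂ` and indexed by darts. -/
structure DEmb {V : Type} (G : SimpleGraph V) where
  P : V → ℂ
  a : G.Dart → ℝ → ℂ
  inj : Function.Injective P
  cont : ∀ d, Continuous (a d)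
  a_inj : ∀ d, ∀ s ∈ Set.Icc (0:ℝ) 1, ∀ t ∈ Set.Icc (0:ℝ) 1, a d s = a d t → s = t
  a_zero : ∀ d, a d 0 = P d.fst
  a_one : ∀ d, a d 1 = P d.snd
  a_symm : ∀ d t, a d.symm t = a d (1 - t)
  avoid : ∀ d w, ∀ t ∈ Set.Ioo (0:ℝ) 1, a d t ≠ P w
  meet : ∀ d d', d' ≠ d → d' ≠ d.symm → ∀ t ∈ Set.Ioo (0:ℝ) 1, ∀ t' ∈ Set.Icc (0:ℝ) 1,
    a d t ≠ a d' t'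

theorem PlaneEmbedding.toDEmb {V : Type} {G : SimpleGraph V} (E : PlaneEmbedding G) :
    Nonempty (DEmb G) := by
  let φ := Complex.equivRealProdCLM.symm
  have hφ : Function.Injective φ := φ.injective
  have hav : ∀ (d : G.Dart) w, ∀ t ∈ Set.Ioo (0:ℝ) 1, E.arc d.fst d.snd t ≠ E.pos w := by
    intro d w t ht h
    exact E.arc_avoid d.adj w ⟨t, ht, h⟩
  refine ⟨⟨fun x => φ (E.pos x), fun d t => φ (E.arc d.fst d.snd t), hφ.comp E.pos_inj,
    fun d => φ.continuous.comp (E.arc_cont d.adj), ?_, ?_, ?_, ?_, ?_, ?_⟩⟩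
  · intro d s hs t ht h
    exact E.arc_injOn d.adj hs ht (hφ h)
  · intro d; simp only [E.arc_zero d.adj]
  · intro d; simp only [E.arc_one d.adj]
  · intro d t
    exact congrArg φ (E.arc_symm d.adj t)
  · intro d w t ht h
    exact hav d w t ht (hφ h)
  · intro d d' h1 h2 t ht t' ht' h
    have hne : s(d.fst, d.snd) ≠ s(d'.fst, d'.snd) := by
      intro he
      have he' : d'.edge = d.edge := he.symm
      rcases (SimpleGraph.dart_edge_eq_iff d' d).1 he' with h3 | h3
      · exact h1 h3
      · exact h2 h3
    have := E.arc_meet d.adj d'.adj hne ⟨⟨t, ⟨ht.1.le, ht.2.le⟩, rfl⟩, ⟨t', ht', (hφ h).symm⟩⟩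
    rcases this.1 with h3 | h3
    · exact hav d _ t ht h3
    · exact hav d _ t ht h3

theorem small_radius {f : ℝ → ℝ} (hf : Continuous f) {b c : ℝ}
    (h : ∀ t ∈ Set.Icc b c, 0 < f t) : ∀ᶠ r in 𝓝[>] (0:ℝ), ∀ t ∈ Set.Icc b c, r < f t := by
  rcases (Set.Icc b c).eq_empty_or_nonempty with he | hne
  · rw [he]; simp
  obtain ⟨t0, ht0, hmin⟩ := isCompact_Icc.exists_isMinOn hne hf.continuousOn
  have h1 : ∀ᶠ r in 𝓝[>] (0:ℝ), r < f t0 :=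
    nhdsWithin_le_nhds (Iio_mem_nhds (h t0 ht0))
  filter_upwards [h1] with r hr t ht
  exact hr.trans_le (hmin ht)

variable {V : Type} [Fintype V] [DecidableEq V] {G : SimpleGraph V} [DecidableRel G.Adj]

theorem DEmb.exists_radius (D : DEmb G) : ∃ r : ℝ, 0 < r ∧
    (∀ x y, x ≠ y → 2 * r < ‖D.P x - D.P y‖) ∧
    (∀ d : G.Dart, ∀ t ∈ Set.Icc (1/2:ℝ) 1, r < ‖D.a d t - D.P d.fst‖) ∧
    (∀ (d : G.Dart) w, w ≠ d.fst → w ≠ d.snd → ∀ t ∈ Set.Icc (0:ℝ) 1, r < ‖D.a d t - D.P w‖) := by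
  have h0 : ∀ᶠ r in 𝓝[>] (0:ℝ), 0 < r := self_mem_nhdsWithin
  have h1 : ∀ᶠ r in 𝓝[>] (0:ℝ), ∀ x y, x ≠ y → 2 * r < ‖D.P x - D.P y‖ := by
    rw [eventually_all]; intro x
    rw [eventually_all]; intro y
    by_cases hxy : x = y
    · simp [hxy]
    have hpos : 0 < ‖D.P x - D.P y‖ := norm_pos_iff.2 (sub_ne_zero.2 (fun h => hxy (D.inj h)))
    have : ∀ᶠ r in 𝓝[>] (0:ℝ), r < ‖D.P x - D.P y‖ / 2 :=
      nhdsWithin_le_nhds (Iio_mem_nhds (by linarith))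
    filter_upwards [this] with r hr _
    linarith
  have h2 : ∀ᶠ r in 𝓝[>] (0:ℝ), ∀ d : G.Dart, ∀ t ∈ Set.Icc (1/2:ℝ) 1,
      r < ‖D.a d t - D.P d.fst‖ := by
    rw [eventually_all]; intro d
    apply small_radius (f := fun t => ‖D.a d t - D.P d.fst‖) (((D.cont d).sub continuous_const).norm)
    intro t ht
    show 0 < ‖D.a d t - D.P d.fst‖
    rw [norm_pos_iff, sub_ne_zero, ← D.a_zero]
    intro h
    have := D.a_inj d t ⟨by linarith [ht.1], ht.2⟩ 0 (by norm_num) h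
    linarith [ht.1]
  have h3 : ∀ᶠ r in 𝓝[>] (0:ℝ), ∀ (d : G.Dart) w, w ≠ d.fst → w ≠ d.snd →
      ∀ t ∈ Set.Icc (0:ℝ) 1, r < ‖D.a d t - D.P w‖ := by
    rw [eventually_all]; intro d
    rw [eventually_all]; intro w
    by_cases hw : w ≠ d.fst ∧ w ≠ d.snd
    · have := small_radius (f := fun t => ‖D.a d t - D.P w‖) (b := 0) (c := 1) (((D.cont d).sub (continuous_const (y := D.P w))).norm) (by
        intro t ht
        show 0 < ‖D.a d t - D.P w‖
        rw [norm_pos_iff, sub_ne_zero]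
        rcases eq_or_lt_of_le ht.1 with h | h
        · rw [← h, D.a_zero]; exact fun h => hw.1 (D.inj h).symm
        rcases eq_or_lt_of_le ht.2 with h' | h'
        · rw [h', D.a_one]; exact fun h => hw.2 (D.inj h).symm
        exact D.avoid d w t ⟨h, h'⟩)
      filter_upwards [this] with r hr _ _
      exact hr
    · exact Eventually.of_forall (fun r g1 g2 => absurd ⟨g1, g2⟩ hw)
  obtain ⟨r, hr⟩ := (h0.and (h1.and (h2.and h3))).exists
  exact ⟨r, hr.1, hr.2.1, hr.2.2.1, hr.2.2.2⟩

theorem DEmb.exists_exit (D : DEmb G) {r : ℝ} (hr : 0 < r)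
    (h2 : ∀ d : G.Dart, ∀ t ∈ Set.Icc (1/2:ℝ) 1, r < ‖D.a d t - D.P d.fst‖) (d : G.Dart) :
    ∃ t0 : ℝ, 0 < t0 ∧ t0 < 1/2 ∧ ‖D.a d t0 - D.P d.fst‖ = r ∧
      ∀ t ∈ Set.Icc t0 (1/2), r ≤ ‖D.a d t - D.P d.fst‖ := by
  have hc : Continuous fun t => ‖D.a d t - D.P d.fst‖ := ((D.cont d).sub continuous_const).norm
  have hK : IsCompact (Set.Icc (0:ℝ) (1/2) ∩ {t | ‖D.a d t - D.P d.fst‖ ≤ r}) :=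
    isCompact_Icc.inter_right (isClosed_le hc continuous_const)
  have h00 : ‖D.a d 0 - D.P d.fst‖ = 0 := by rw [D.a_zero, sub_self, norm_zero]
  obtain ⟨t0, ht0, hmax⟩ := hK.exists_isGreatest ⟨0, by norm_num, by
    show ‖D.a d 0 - D.P d.fst‖ ≤ r
    rw [h00]; exact hr.le⟩
  have hlt : t0 < 1/2 := by
    apply lt_of_le_of_ne ht0.1.2
    intro h
    have h3 := h2 d (1/2) (by norm_num)
    have h4 : ‖D.a d t0 - D.P d.fst‖ ≤ r := ht0.2
    rw [h] at h4
    linarith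
  have heq : ‖D.a d t0 - D.P d.fst‖ = r := by
    have h3 := h2 d (1/2) (by norm_num)
    obtain ⟨t, ht, hte⟩ := intermediate_value_Icc hlt.le hc.continuousOn ⟨ht0.2, h3.le⟩
    have : t ≤ t0 := hmax ⟨⟨ht0.1.1.trans ht.1, ht.2⟩, le_of_eq hte⟩
    rw [← le_antisymm this ht.1]; exact hte
  refine ⟨t0, ?_, hlt, heq, ?_⟩
  · apply lt_of_le_of_ne ht0.1.1
    rintro rfl
    linarith
  · intro t ht
    by_contra hcon
    have : t ≤ t0 := hmax ⟨⟨ht0.1.1.trans ht.1, ht.2⟩, (not_le.1 hcon).le⟩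
    have := le_antisymm this ht.1
    rw [this] at hcon
    exact hcon heq.ge

theorem DEmb.arms (D : DEmb G) : Nonempty (Arms G) := by
  obtain ⟨r, hr, ha, hb, hc⟩ := D.exists_radius
  choose t0 h1 h2 h3 h4 using D.exists_exit hr hb
  let q : G.Dart → ℝ → ℝ := fun d t => t0 d + max 0 (min (6 * t - 2) 1) * (1/2 - t0 d)
  let h : G.Dart → ℝ → ℂ := fun d t => D.P d.fst + (max 0 (min (3 * t) 1) : ℝ) *
    (D.a d (t0 d) - D.P d.fst) + (D.a d (q d t) - D.a d (t0 d))
  have hI : ∀ d, ∀ t ∈ Set.Icc (0:ℝ) (1/3), h d t = D.P d.fst +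
      t * (3 * (D.a d (t0 d) - D.P d.fst)) := by
    intro d t ht
    have e1 : max 0 (min (6 * t - 2) 1) = 0 := max_eq_left (min_le_of_left_le (by linarith [ht.2]))
    have e2 : max 0 (min (3 * t) 1) = 3 * t := by
      rw [min_eq_left (by linarith [ht.2]), max_eq_right (by linarith [ht.1])]
    simp only [h, q, e1, e2]
    push_cast
    simp
    ring
  have hq : ∀ d, ∀ t ∈ Set.Icc (1/3:ℝ) (1/2), q d t = t0 d + (6 * t - 2) * (1/2 - t0 d) := by
    intro d t ht
    simp only [q]
    rw [min_eq_left (by linarith [ht.2]), max_eq_right (by linarith [ht.1])]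
  have hqm : ∀ d, ∀ t ∈ Set.Icc (1/3:ℝ) (1/2), q d t ∈ Set.Icc (t0 d) (1/2) := by
    intro d t ht
    have := h2 d
    rw [hq d t ht]
    constructor
    · have : 0 ≤ (6 * t - 2) * (1/2 - t0 d) := mul_nonneg (by linarith [ht.1]) (by linarith)
      linarith
    · have : (6 * t - 2) * (1/2 - t0 d) ≤ 1 * (1/2 - t0 d) :=
        mul_le_mul_of_nonneg_right (by linarith [ht.2]) (by linarith)
      linarith
  have hII : ∀ d, ∀ t ∈ Set.Icc (1/3:ℝ) (1/2), h d t = D.a d (q d t) := by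
    intro d t ht
    have e2 : max 0 (min (3 * t) 1) = 1 := by
      rw [min_eq_right (by linarith [ht.1]), max_eq_right (by norm_num)]
    simp only [h, e2]
    push_cast
    ring
  have hfar2 : ∀ d, ∀ t ∈ Set.Icc (1/3:ℝ) (1/2), ∀ w, r ≤ ‖h d t - D.P w‖ := by
    intro d t ht w
    rw [hII d t ht]
    have hm := hqm d t ht
    by_cases e1 : w = d.fst
    · rw [e1]; exact h4 d _ hm
    by_cases e2 : w = d.snd
    · have := hb d.symm (1 - q d t) ⟨by linarith [hm.2], by linarith [hm.1, h1 d]⟩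
      rw [D.a_symm, sub_sub_cancel] at this
      rw [e2]; exact this.le
    · exact (hc d w e1 e2 _ ⟨by linarith [hm.1, h1 d], by linarith [hm.2]⟩).le
  have hnI : ∀ d, ∀ t ∈ Set.Icc (0:ℝ) (1/3), ‖h d t - D.P d.fst‖ = 3 * t * r := by
    intro d t ht
    rw [hI d t ht, add_sub_cancel_left, norm_mul, norm_mul, h3, norm_real, Real.norm_eq_abs,
      abs_of_nonneg ht.1]
    norm_num
    ring
  have hmeet : ∀ d d', ∀ s ∈ Set.Icc (t0 d) (1/2), ∀ s' ∈ Set.Icc (t0 d') (1/2),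
      D.a d s = D.a d' s' → (d = d' ∧ s = s') ∨ (d' = d.symm ∧ s = 1/2 ∧ s' = 1/2) := by
    intro d d' s hs s' hs' heq
    have p1 := h1 d
    have p2 := h1 d'
    by_cases e1 : d' = d
    · subst e1
      left
      exact ⟨rfl, D.a_inj _ s ⟨by linarith [hs.1], by linarith [hs.2]⟩ s'
        ⟨by linarith [hs'.1], by linarith [hs'.2]⟩ heq⟩
    by_cases e2 : d' = d.symm
    · right
      rw [e2, D.a_symm] at heq
      have := D.a_inj _ s ⟨by linarith [hs.1], by linarith [hs.2]⟩ (1 - s')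
        ⟨by linarith [hs'.2], by linarith [hs'.1]⟩ heq
      exact ⟨e2, by linarith [hs.2, hs'.2], by linarith [hs.2, hs'.2]⟩
    · exact absurd heq (D.meet d d' e1 e2 s ⟨by linarith [hs.1], by linarith [hs.2]⟩ s'
        ⟨by linarith [hs'.1], by linarith [hs'.2]⟩)
  have hqinj : ∀ d, ∀ t ∈ Set.Icc (1/3:ℝ) (1/2), ∀ t' ∈ Set.Icc (1/3:ℝ) (1/2),
      q d t = q d t' → t = t' := by
    intro d t ht t' ht' heq
    rw [hq d t ht, hq d t' ht'] at heq
    have := mul_right_cancel₀ (by have := h2 d; linarith : (1/2 - t0 d) ≠ 0) (add_left_cancel heq)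
    linarith
  have hq2 : ∀ d, ∀ t ∈ Set.Icc (1/3:ℝ) (1/2), q d t = 1/2 → t = 1/2 := by
    intro d t ht heq
    apply hqinj d t ht (1/2) (by norm_num)
    rw [heq, hq d _ (by norm_num)]; ring
  have hII2 : ∀ d d', ∀ t ∈ Set.Icc (1/3:ℝ) (1/2), ∀ t' ∈ Set.Icc (1/3:ℝ) (1/2),
      h d t = h d' t' →
      t = t' ∧ (d = d' ∨ (t = 0 ∧ d.fst = d'.fst) ∨ (t = 1/2 ∧ d' = d.symm)) := by
    intro d d' t ht t' ht' heq
    rw [hII d t ht, hII d' t' ht'] at heq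
    rcases hmeet d d' _ (hqm d t ht) _ (hqm d' t' ht') heq with ⟨e1, e2⟩ | ⟨e1, e2, e3⟩
    · subst e1
      exact ⟨hqinj _ t ht t' ht' e2, Or.inl rfl⟩
    · have e4 := hq2 d t ht e2
      have e5 := hq2 d' t' ht' e3
      exact ⟨by rw [e4, e5], Or.inr (Or.inr ⟨e4, e1⟩)⟩
  have hIII : ∀ d d', ∀ t ∈ Set.Icc (0:ℝ) (1/3), ∀ t' ∈ Set.Icc (1/3:ℝ) (1/2),
      h d t = h d' t' → t = 1/3 := by
    intro d d' t ht t' ht' heq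
    have e1 := hfar2 d' t' ht' d.fst
    rw [← heq, hnI d t ht] at e1
    have : 1 ≤ 3 * t := by
      by_contra hcon
      nlinarith
    linarith [ht.2]
  refine ⟨{ pos := D.P, h := h, u := fun d => 3 * (D.a d (t0 d) - D.P d.fst), r := r,
            r_pos := hr, norm_u := ?_, h_cont := ?_, h_mid := ?_, h_lin := hI, h_inj := ?_,
            h_far := ?_ }⟩
  · intro d; rw [norm_mul, h3]; norm_num
  · intro d
    have := D.cont d
    simp only [h, q]
    fun_prop
  · intro d
    have e1 : ∀ d, q d (1/2) = 1/2 := by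
      intro d; rw [hq d _ (by norm_num)]; ring
    rw [hII d _ (by norm_num), hII d.symm _ (by norm_num), e1, e1, D.a_symm]
    norm_num
  · intro d d' t ht t' ht' heq
    rcases le_total t (1/3) with c1 | c1 <;> rcases le_total t' (1/3) with c2 | c2
    · have m1 : t ∈ Set.Icc (0:ℝ) (1/3) := ⟨ht.1, c1⟩
      have m2 : t' ∈ Set.Icc (0:ℝ) (1/3) := ⟨ht'.1, c2⟩
      have n1 := hnI d t m1
      have n2 := hnI d' t' m2
      have hf : d.fst = d'.fst := by
        by_contra hne
        have e1 := ha _ _ hne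
        have e2 : D.P d.fst - D.P d'.fst = (h d' t' - D.P d'.fst) - (h d t - D.P d.fst) := by
          rw [heq]; ring
        have e3 := norm_sub_le (h d' t' - D.P d'.fst) (h d t - D.P d.fst)
        rw [← e2, n1, n2] at e3
        nlinarith
      have htt : t = t' := by
        rw [heq, hf, n2] at n1
        have := mul_right_cancel₀ hr.ne' n1
        linarith
      refine ⟨htt, ?_⟩
      by_cases hz : t = 0
      · exact Or.inr (Or.inl ⟨hz, hf⟩)
      left
      rw [hI d t m1, hI d' t' m2, ← htt, hf] at heq
      have e1 := mul_left_cancel₀ (by exact_mod_cast hz : (t:ℂ) ≠ 0) (add_left_cancel heq)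
      have e2 : D.a d (t0 d) = D.a d' (t0 d') := by linear_combination e1 / 3
      rcases hmeet d d' _ ⟨le_rfl, (h2 d).le⟩ _ ⟨le_rfl, (h2 d').le⟩ e2 with e3 | e3
      · exact e3.1
      · have := h2 d
        linarith [e3.2.1]
    · have := hIII d d' t ⟨ht.1, c1⟩ t' ⟨c2, ht'.2⟩ heq
      exact hII2 d d' t ⟨by linarith, ht.2⟩ t' ⟨c2, ht'.2⟩ heq
    · have := hIII d' d t' ⟨ht'.1, c2⟩ t ⟨c1, ht.2⟩ heq.symm
      exact hII2 d d' t ⟨c1, ht.2⟩ t' ⟨by linarith, ht'.2⟩ heq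
    · exact hII2 d d' t ⟨c1, ht.2⟩ t' ⟨c2, ht'.2⟩ heq
  · intro d t ht w hw
    rcases le_or_gt (1/3) t with c1 | c1
    · exact hfar2 d t ⟨c1, ht.2⟩ w
    · have hw' := hw.resolve_left (not_le.2 c1)
      have e1 := ha _ _ hw'
      have e0 := hnI d t ⟨ht.1, c1.le⟩
      have e2 : D.P w - D.P d.fst = (h d t - D.P d.fst) - (h d t - D.P w) := by ring
      have e3 := norm_sub_le (h d t - D.P d.fst) (h d t - D.P w)
      rw [← e2, e0] at e3
      nlinarith

theorem hasRot : HasRot := by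
  intro W _ _ H _ hpl
  obtain ⟨E⟩ := hpl
  obtain ⟨D⟩ := E.toDEmb
  obtain ⟨M⟩ := D.arms
  exact M.rot

end PartG5

end

/-- Theorem 1.2 (case ε ≤ 1): a connected planar graph with `n ≥ 2` vertices, `m` edges
and average degree `2m/n = 9/2 - ε` with `ε ∈ (0, 1]` has 2-surviving rate at least
`(2/9)ε`. -/
theorem surviving_rate_two_of_avg_degree_small {V : Type} [Fintype V] (G : SimpleGraph V)
    (hconn : G.Connected) (hplanar : IsPlanar G)
    (n m : ℕ) (hn : n = Fintype.card V) (hm : m = Nat.card G.edgeSet)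
    (hn2 : 2 ≤ n) (ε : ℝ) (hε : ε ∈ Set.Ioc (0 : ℝ) 1)
    (hdeg : (2 * m : ℝ) / n = 9 / 2 - ε) :
    survivingRate G (fun _ => 2) ≥ 2 / 9 * ε := by
  classical
  exact main_of_rot hasRot G hconn hplanar n m hn hm hn2 ε hε hdeg
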